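/- arXiv:cs/0102007 — 2 statements merged into one kernel-verified Lean document; each statement's English description precedes it below -/
import Mathlib

section
/- Let G be a finite simple triconnected graph with a fixed plane embedding Φ. Let v₁ and v₂ be distinct vertices of G, and let F₁ and F₂ be distinct faces of Φ. Then v₁ and v₂ both lie on the boundaries of both F₁ and F₂ if and only if {v₁,v₂} is an edge of G that lies on the boundary of both F₁ and F₂. -/
open Set Topology

/-- A plane embedding of a simple graph `G`: an injective placement of the vertices in the
plane together with, for each edge, an arc (the image of an injective continuous path) whose
endpoints are the images of the endpoints of the edge, such that two distinct arcs intersect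
only in images of common endpoints and an arc meets the image of a vertex only if that vertex
is an endpoint of the corresponding edge. -/
structure PlaneEmbedding {V : Type*} (G : SimpleGraph V) where
  vmap : V → ℝ × ℝ
  vmap_inj : Function.Injective vmap
  arc : G.edgeSet → Set (ℝ × ℝ)
  arc_path : ∀ e : G.edgeSet, ∃ f : unitInterval → ℝ × ℝ,
    Continuous f ∧ Function.Injective f ∧ Set.range f = arc e ∧
    ∃ u v : V, (e : Sym2 V) = s(u, v) ∧ f 0 = vmap u ∧ f 1 = vmap v
  arc_inter : ∀ e e' : G.edgeSet, e ≠ e' →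
    arc e ∩ arc e' ⊆ vmap '' {x : V | x ∈ (e : Sym2 V) ∧ x ∈ (e' : Sym2 V)}
  vmap_mem_arc : ∀ (e : G.edgeSet) (x : V), vmap x ∈ arc e → x ∈ (e : Sym2 V)

namespace PlaneEmbedding

variable {V : Type*} {G : SimpleGraph V}

/-- The union of all arcs of the embedding. -/
def drawing (Φ : PlaneEmbedding G) : Set (ℝ × ℝ) :=
  ⋃ e : G.edgeSet, Φ.arc e

/-- The faces of the embedding: connected components of the complement of the drawing. -/
def IsFace (Φ : PlaneEmbedding G) (F : Set (ℝ × ℝ)) : Prop :=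
  ∃ p ∈ Φ.drawingᶜ, F = connectedComponentIn Φ.drawingᶜ p

/-- The vertex `v` lies on the boundary of the face `F`. -/
def OnFace (Φ : PlaneEmbedding G) (F : Set (ℝ × ℝ)) (v : V) : Prop :=
  Φ.vmap v ∈ frontier F

/-- The embedding satisfies a family `C` of vertex subsets: some face has on its boundary
at least one vertex from each set in `C`. -/
def SatisfiesFam (Φ : PlaneEmbedding G) (C : Set (Set V)) : Prop :=
  ∃ F : Set (ℝ × ℝ), Φ.IsFace F ∧ ∀ U ∈ C, ∃ v ∈ U, Φ.OnFace F v

end PlaneEmbedding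

/-- A graph is planar if it has a plane embedding. -/
def Planar {V : Type*} (G : SimpleGraph V) : Prop :=
  Nonempty (PlaneEmbedding G)
/-- A cut vertex: a vertex whose removal increases the number of connected components. -/
def IsCutVertex {V : Type*} (G : SimpleGraph V) (w : V) : Prop :=
  Nat.card G.ConnectedComponent < Nat.card ((G.induce {v : V | v ≠ w}).ConnectedComponent)

/-- A graph is biconnected if it is connected, has at least two vertices and no cut vertex. -/
def Biconnected {V : Type*} (G : SimpleGraph V) : Prop :=
  G.Connected ∧ 2 ≤ Nat.card V ∧ ∀ w : V, ¬ IsCutVertex G w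

/-- A graph is triconnected if it is biconnected, has at least three vertices, and the removal
of any two vertices cannot disconnect it. -/
def Triconnected {V : Type*} (G : SimpleGraph V) : Prop :=
  Biconnected G ∧ 3 ≤ Nat.card V ∧
    ∀ u v : V, u ≠ v → ((G.induce {x : V | x ≠ u ∧ x ≠ v}).Connected)


namespace PlaneSep

lemma const_of_exp {X : Type*} [TopologicalSpace X] {S : Set X} (hS : IsPreconnected S)
    {f : X → ℂ} (hf : ContinuousOn f S)
    (he : ∀ x ∈ S, ∀ y ∈ S, Complex.exp (f x) = Complex.exp (f y)) {x y : X}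
    (hx : x ∈ S) (hy : y ∈ S) : f x = f y := by
  refine hS.induction₂ (fun a b => f a = f b) ?_ (fun _ _ _ _ _ _ h1 h2 => h1.trans h2)
    (fun _ _ _ _ h => h.symm) hx hy
  intro a ha
  have h1 : ∀ᶠ b in 𝓝[S] a, dist (f b) (f a) < 1 :=
    (hf a ha).eventually (Metric.ball_mem_nhds _ one_pos)
  filter_upwards [h1, self_mem_nhdsWithin] with b hb hbS
  obtain ⟨n, hn⟩ := Complex.exp_eq_exp_iff_exists_int.1 (he b hbS a ha)
  rw [hn, dist_eq_norm, add_sub_cancel_left] at hb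
  have h2 : ‖(n : ℂ) * (2 * Real.pi * Complex.I)‖ = |(n : ℝ)| * (2 * Real.pi) := by
    simp [abs_of_pos Real.pi_pos]
  rw [h2] at hb
  have h3 : n = 0 := by
    by_contra hne
    have : (1 : ℝ) ≤ |(n : ℝ)| := by exact_mod_cast Int.one_le_abs hne
    nlinarith [Real.pi_gt_three]
  rw [hn, h3]; simp

lemma no_winding {F : ℂ → ℂ} (hF : Continuous F) (h0 : ∀ z, F z ≠ 0) (p : ℂ) (M : ℝ)
    (hM : ∀ z, M < ‖z‖ → F z = z - p) : False := by
  obtain ⟨L, ⟨-, hL⟩, -⟩ := Complex.isCoveringMapOn_exp.existsUnique_continuousMap_lifts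
    (⟨F, hF⟩ : C(ℂ, ℂ)) (a₀ := 0) (Complex.exp_log (h0 0)) (fun a => h0 a)
  have hL' : ∀ z, Complex.exp (L z) = F z := fun z => congrFun hL z
  obtain ⟨r, hr⟩ : ∃ r : ℝ, r = |M| + ‖p‖ + 1 := ⟨_, rfl⟩
  have hrp : 0 < r := by rw [hr]; positivity
  let c : ℝ → ℂ := fun θ => p + r * Complex.exp (θ * Complex.I)
  have hc : ∀ θ, F (c θ) = r * Complex.exp (θ * Complex.I) := by
    intro θ
    rw [hM (c θ)]
    · simp [c]
    · have h1 : ‖(r : ℂ) * Complex.exp (θ * Complex.I)‖ = r := by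
        rw [norm_mul, Complex.norm_exp_ofReal_mul_I]; simp [abs_of_pos hrp]
      have h2 : ‖(r : ℂ) * Complex.exp (θ * Complex.I)‖ ≤ ‖c θ‖ + ‖p‖ := by
        have : (r : ℂ) * Complex.exp (θ * Complex.I) = c θ - p := by simp [c]
        rw [this]; exact norm_sub_le _ _
      linarith [le_abs_self M]
  have hcc : Continuous c := by fun_prop
  let h : ℝ → ℂ := fun θ => L (c θ) - θ * Complex.I
  have hh : Continuous h := by fun_prop
  have he : ∀ θ, Complex.exp (h θ) = r := by
    intro θ
    simp only [h]
    rw [Complex.exp_sub, hL', hc, mul_div_assoc, div_self (Complex.exp_ne_zero _), mul_one]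
  have := const_of_exp (S := univ) isPreconnected_univ hh.continuousOn
    (fun x _ y _ => by rw [he, he]) (mem_univ (0:ℝ)) (mem_univ (2 * Real.pi))
  have hc0 : c (2 * Real.pi) = c 0 := by simp [c, Complex.exp_two_pi_mul_I]
  simp only [h, hc0] at this
  have h3 : ((2 * Real.pi : ℝ) : ℂ) * Complex.I = 0 := by
    have := sub_right_injective this
    rw [← this]; simp
  simp [Real.pi_ne_zero] at h3

/-- `z ↦ (z - p) / (z - q)` has a continuous logarithm on `K`. -/
def LogRel (K : Set ℂ) (p q : ℂ) : Prop :=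
  ∃ g : ℂ → ℂ, ContinuousOn g K ∧ ∀ z ∈ K, z - p = Complex.exp (g z) * (z - q)

lemma LogRel.symm {K : Set ℂ} {p q : ℂ} (h : LogRel K p q) : LogRel K q p := by
  obtain ⟨g, hg, hh⟩ := h
  refine ⟨fun z => - g z, hg.neg, fun z hz => ?_⟩
  rw [hh z hz, ← mul_assoc, ← Complex.exp_add]; simp

lemma LogRel.trans {K : Set ℂ} {p q r : ℂ} (h : LogRel K p q) (h' : LogRel K q r) :
    LogRel K p r := by
  obtain ⟨g, hg, hh⟩ := h
  obtain ⟨g', hg', hh'⟩ := h'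
  refine ⟨fun z => g z + g' z, hg.add hg', fun z hz => ?_⟩
  rw [hh z hz, hh' z hz, ← mul_assoc, ← Complex.exp_add]

lemma LogRel.mono {K K' : Set ℂ} {p q : ℂ} (h : LogRel K p q) (hK : K' ⊆ K) : LogRel K' p q := by
  obtain ⟨g, hg, hh⟩ := h
  exact ⟨g, hg.mono hK, fun z hz => hh z (hK hz)⟩

lemma LogRel.of_preconnected {K C : Set ℂ} (hK : IsClosed K) (hC : IsPreconnected C)
    (hd : C ⊆ Kᶜ) {p q : ℂ} (hp : p ∈ C) (hq : q ∈ C) : LogRel K p q := by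
  refine hC.induction₂ (LogRel K) ?_ (fun _ _ _ _ _ _ h1 h2 => h1.trans h2)
    (fun _ _ _ _ h => h.symm) hp hq
  intro a ha
  obtain ⟨ε, hε, hball⟩ := Metric.isOpen_iff.1 hK.isOpen_compl a (hd ha)
  filter_upwards [mem_nhdsWithin_of_mem_nhds (Metric.ball_mem_nhds a hε)] with b hb
  refine LogRel.symm ?_
  have hne : ∀ z ∈ K, z - a ≠ 0 := fun z hz h => by
    rw [sub_eq_zero] at h; subst h; exact hd ha hz
  have hs : ∀ z ∈ K, (z - b) / (z - a) ∈ Complex.slitPlane := by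
    intro z hz
    have h1 : (z - b) / (z - a) = 1 + (a - b) / (z - a) := by
      field_simp [hne z hz]; ring
    rw [h1]
    apply Complex.mem_slitPlane_of_norm_lt_one
    have h2 : ε ≤ ‖z - a‖ := by
      by_contra! hlt
      exact hball (by simpa [dist_eq_norm] using hlt) hz
    have h3 : ‖a - b‖ < ε := by
      rw [← dist_eq_norm, dist_comm]; exact hb
    rw [norm_div, div_lt_one (by linarith)]; linarith
  refine ⟨fun z => Complex.log ((z - b) / (z - a)), ?_, ?_⟩
  · refine ContinuousOn.clog ?_ hs
    exact ContinuousOn.div (by fun_prop) (by fun_prop) hne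
  · intro z hz
    rw [Complex.exp_log (Complex.slitPlane_ne_zero (hs z hz)), div_mul_cancel₀ _ (hne z hz)]

/-- Janiszewski in logarithm form. -/
lemma LogRel.union {K₁ K₂ : Set ℂ} (h₁ : IsClosed K₁) (h₂ : IsClosed K₂)
    (hc : IsPreconnected (K₁ ∩ K₂)) {p q : ℂ} (hq : q ∉ K₁ ∩ K₂)
    (r₁ : LogRel K₁ p q) (r₂ : LogRel K₂ p q) : LogRel (K₁ ∪ K₂) p q := by
  classical
  obtain ⟨g₁, c₁, e₁⟩ := r₁
  obtain ⟨g₂, c₂, e₂⟩ := r₂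
  obtain ⟨k, hk, hk'⟩ : ∃ k : ℂ, Complex.exp k = 1 ∧ ∀ z ∈ K₁ ∩ K₂, g₁ z = g₂ z + k := by
    have hexp : ∀ x ∈ K₁ ∩ K₂, Complex.exp (g₁ x - g₂ x) = 1 := by
      intro x hx
      have hne : x - q ≠ 0 := fun h => hq (by rw [← sub_eq_zero.1 h]; exact hx)
      have := (e₁ x hx.1).symm.trans (e₂ x hx.2)
      rw [Complex.exp_sub, mul_right_cancel₀ hne this, div_self (Complex.exp_ne_zero _)]
    rcases (K₁ ∩ K₂).eq_empty_or_nonempty with h | ⟨x, hx⟩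
    · exact ⟨0, by simp, by simp [h]⟩
    · refine ⟨g₁ x - g₂ x, hexp x hx, fun z hz => ?_⟩
      have := const_of_exp hc (f := fun z => g₁ z - g₂ z)
        ((c₁.mono inter_subset_left).sub (c₂.mono inter_subset_right))
        (fun x hx y hy => by rw [hexp x hx, hexp y hy]) hz hx
      rw [← this]; ring
  let g : ℂ → ℂ := fun z => if z ∈ K₁ then g₁ z else g₂ z + k
  have hg₁ : EqOn g g₁ K₁ := fun z hz => by simp [g, hz]
  have hg₂ : EqOn g (fun z => g₂ z + k) K₂ := fun z hz => by
    by_cases hz1 : z ∈ K₁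
    · simp [g, hz1, hk' z ⟨hz1, hz⟩]
    · simp [g, hz1]
  refine ⟨g, ?_, ?_⟩
  · exact ContinuousOn.union_of_isClosed (c₁.congr hg₁)
      ((c₂.add continuousOn_const).congr hg₂) h₁ h₂
  · rintro z (hz | hz)
    · rw [hg₁ hz]; exact e₁ z hz
    · rw [hg₂ hz]; simp only
      rw [Complex.exp_add, hk, mul_one]; exact e₂ z hz

lemma exterior_preconnected {M : ℝ} (hM : 0 < M) : IsPreconnected {z : ℂ | M < ‖z‖} := by
  have h : {z : ℂ | M < ‖z‖} = Complex.exp '' {z : ℂ | Real.log M < z.re} := by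
    ext z
    constructor
    · intro hz
      have hz' : M < ‖z‖ := hz
      have h0 : z ≠ 0 := fun h => by rw [h, norm_zero] at hz'; linarith
      refine ⟨Complex.log z, ?_, Complex.exp_log h0⟩
      simp only [mem_ofPred_eq, Complex.log_re]
      exact Real.log_lt_log hM hz'
    · rintro ⟨w, hw, rfl⟩
      simp only [mem_ofPred_eq, Complex.norm_exp] at hw ⊢
      exact (Real.log_lt_iff_lt_exp hM).1 hw
  rw [h]
  exact (convex_halfSpace_re_gt _).isPreconnected.image _ Complex.continuous_exp.continuousOn

lemma frontier_component {X : Type*} [TopologicalSpace X] [LocallyConnectedSpace X]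
    {K : Set X} (hK : IsClosed K) {p : X} (hp : p ∈ Kᶜ) :
    frontier (connectedComponentIn Kᶜ p) ⊆ K := by
  intro y hy
  by_contra hyK
  have ho : IsOpen (connectedComponentIn Kᶜ p) := hK.isOpen_compl.connectedComponentIn
  have ho' : IsOpen (connectedComponentIn Kᶜ y) := hK.isOpen_compl.connectedComponentIn
  obtain ⟨w, hw1, hw2⟩ := mem_closure_iff.1 hy.1 _ ho' (mem_connectedComponentIn hyK)
  have : connectedComponentIn Kᶜ p = connectedComponentIn Kᶜ y :=
    (connectedComponentIn_eq hw2).trans (connectedComponentIn_eq hw1).symm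
  apply hy.2
  rw [ho.interior_eq, this]
  exact mem_connectedComponentIn hyK

lemma sep_aux {K : Set ℂ} (hK : IsClosed K) {p q : ℂ} (hp : p ∈ Kᶜ)
    (hr : LogRel K p q) (hq : q ∉ connectedComponentIn Kᶜ p) (M : ℝ)
    (hM : ∀ z ∈ connectedComponentIn Kᶜ p, ‖z‖ ≤ M) : False := by
  classical
  obtain ⟨g, hg, he⟩ := hr
  obtain ⟨G, hG⟩ := ContinuousMap.exists_restrict_eq hK
    (⟨K.domRestrict g, continuousOn_iff_continuous_domRestrict.1 hg⟩ : C(K, ℂ))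
  have hG' : ∀ z ∈ K, G z = g z := fun z hz => DFunLike.congr_fun hG ⟨z, hz⟩
  set U := connectedComponentIn Kᶜ p with hU
  have ho : IsOpen U := hK.isOpen_compl.connectedComponentIn
  have hpU : p ∈ U := mem_connectedComponentIn hp
  have hfr : frontier U ⊆ K := frontier_component hK hp
  let F : ℂ → ℂ := fun z => if z ∈ U then Complex.exp (G z) * (z - q) else z - p
  have hF : Continuous F := by
    refine Continuous.if ?_ (by fun_prop) (by fun_prop)
    intro a ha
    have := hfr ha
    rw [hG' a this, he a this]
  refine no_winding hF ?_ p M ?_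
  · intro z
    by_cases hz : z ∈ U
    · simp only [F, hz, if_true]
      refine mul_ne_zero (Complex.exp_ne_zero _) (fun h => hq ?_)
      rw [← sub_eq_zero.1 h]; exact hz
    · simp only [F, hz, if_false]
      intro h
      exact hz (by rw [sub_eq_zero.1 h]; exact hpU)
  · intro z hz
    have : z ∉ U := fun h => absurd (hM z h) (not_le.2 hz)
    simp [F, this]

lemma LogRel.mem_component {K : Set ℂ} (hK : IsCompact K) {p q : ℂ} (hp : p ∈ Kᶜ) (hq : q ∈ Kᶜ)
    (hr : LogRel K p q) : q ∈ connectedComponentIn Kᶜ p := by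
  by_contra hn
  have hn' : p ∉ connectedComponentIn Kᶜ q := fun h => hn <| by
    rw [← connectedComponentIn_eq h]; exact mem_connectedComponentIn hq
  obtain ⟨M, hM0, hM⟩ : ∃ M : ℝ, 0 < M ∧ ∀ z ∈ K, ‖z‖ ≤ M := hK.isBounded.exists_pos_norm_le
  have hE : {z : ℂ | M < ‖z‖} ⊆ Kᶜ := fun z hz hzK => absurd (hM z hzK) (not_le.2 hz)
  by_cases h1 : ∀ z ∈ connectedComponentIn Kᶜ p, ‖z‖ ≤ M
  · exact sep_aux hK.isClosed hp hr hn M h1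
  by_cases h2 : ∀ z ∈ connectedComponentIn Kᶜ q, ‖z‖ ≤ M
  · exact sep_aux hK.isClosed hq hr.symm hn' M h2
  push Not at h1 h2
  obtain ⟨a, ha, haM⟩ := h1
  obtain ⟨b, hb, hbM⟩ := h2
  have hab : b ∈ connectedComponentIn Kᶜ a :=
    (exterior_preconnected hM0).subset_connectedComponentIn haM hE hbM
  apply hn
  rw [connectedComponentIn_eq ha, connectedComponentIn_eq hab, ← connectedComponentIn_eq hb]
  exact mem_connectedComponentIn hq

/-- Arcs carry logarithms. -/
lemma LogRel.of_arc {f : unitInterval → ℂ} (hf : Continuous f) (hi : Function.Injective f)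
    {p q : ℂ} (hp : p ∉ range f) (hq : q ∉ range f) : LogRel (range f) p q := by
  have hne : ∀ r, r ∉ range f → ∀ t, f t - r ≠ 0 := fun r hr t h =>
    hr ⟨t, sub_eq_zero.1 h⟩
  let e : ℝ → ℂ := fun t => f (Set.projIcc 0 1 zero_le_one t)
  have hec : Continuous e := hf.comp continuous_projIcc
  let φ : C(ℝ, ℂ) := ⟨fun t => (e t - p) / (e t - q),
    Continuous.div (by fun_prop) (by fun_prop) (fun t => hne q hq _)⟩
  have hφ : ∀ t, φ t ≠ 0 := fun t => div_ne_zero (hne p hp _) (hne q hq _)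
  obtain ⟨L, ⟨-, hL⟩, -⟩ := Complex.isCoveringMapOn_exp.existsUnique_continuousMap_lifts
    φ (a₀ := 0) (Complex.exp_log (hφ 0)) (fun a => hφ a)
  have hL' : ∀ z, Complex.exp (L z) = φ z := fun z => congrFun hL z
  have hemb : IsClosedEmbedding f := hf.isClosedEmbedding hi
  obtain ⟨G, hG⟩ := ContinuousMap.exists_extension' hemb
    (⟨fun t : unitInterval => L t, by fun_prop⟩ : C(unitInterval, ℂ))
  refine ⟨G, G.continuous.continuousOn, ?_⟩
  rintro _ ⟨t, rfl⟩
  have h1 : G (f t) = L t := congrFun hG t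
  have h2 : e t = f t := by simp [e]
  rw [h1, hL']
  simp only [φ, ContinuousMap.coe_mk]
  rw [h2, div_mul_cancel₀ _ (hne q hq t)]

/-- The plane identified with the complex numbers. -/
noncomputable def toC : ℝ × ℝ ≃ₜ ℂ := Complex.equivRealProdCLM.symm.toHomeomorph

/-- `LogRel` transported to the plane. -/
def PRel (K : Set (ℝ × ℝ)) (p q : ℝ × ℝ) : Prop := LogRel (toC '' K) (toC p) (toC q)

lemma PRel.symm {K : Set (ℝ × ℝ)} {p q : ℝ × ℝ} (h : PRel K p q) : PRel K q p := LogRel.symm h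

lemma PRel.trans {K : Set (ℝ × ℝ)} {p q r : ℝ × ℝ} (h : PRel K p q) (h' : PRel K q r) :
    PRel K p r := LogRel.trans h h'

lemma PRel.mono {K K' : Set (ℝ × ℝ)} {p q : ℝ × ℝ} (h : PRel K p q) (hK : K' ⊆ K) :
    PRel K' p q := LogRel.mono h (image_mono hK)

lemma PRel.of_preconnected {K C : Set (ℝ × ℝ)} (hK : IsClosed K) (hC : IsPreconnected C)
    (hd : C ⊆ Kᶜ) {p q : ℝ × ℝ} (hp : p ∈ C) (hq : q ∈ C) : PRel K p q := by
  refine LogRel.of_preconnected (C := toC '' C) (toC.isClosed_image.2 hK)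
    (hC.image _ toC.continuous.continuousOn) ?_ (mem_image_of_mem _ hp) (mem_image_of_mem _ hq)
  rw [← image_compl_eq toC.bijective]
  exact image_mono hd

lemma PRel.union {K₁ K₂ : Set (ℝ × ℝ)} (h₁ : IsClosed K₁) (h₂ : IsClosed K₂)
    (hc : IsPreconnected (K₁ ∩ K₂)) {p q : ℝ × ℝ} (hq : q ∉ K₁ ∩ K₂)
    (r₁ : PRel K₁ p q) (r₂ : PRel K₂ p q) : PRel (K₁ ∪ K₂) p q := by
  unfold PRel
  rw [image_union]
  refine LogRel.union (toC.isClosed_image.2 h₁) (toC.isClosed_image.2 h₂) ?_ ?_ r₁ r₂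
  · rw [← image_inter toC.injective]; exact hc.image _ toC.continuous.continuousOn
  · rw [← image_inter toC.injective]
    rintro ⟨x, hx, hxq⟩
    exact hq (toC.injective hxq ▸ hx)

lemma PRel.of_arc {f : unitInterval → ℝ × ℝ} (hf : Continuous f) (hi : Function.Injective f)
    {p q : ℝ × ℝ} (hp : p ∉ range f) (hq : q ∉ range f) : PRel (range f) p q := by
  unfold PRel
  rw [← range_comp]
  refine LogRel.of_arc (toC.continuous.comp hf) (toC.injective.comp hi) ?_ ?_
  · rintro ⟨t, ht⟩; exact hp ⟨t, toC.injective ht⟩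
  · rintro ⟨t, ht⟩; exact hq ⟨t, toC.injective ht⟩

lemma PRel.joined {K : Set (ℝ × ℝ)} (hK : IsCompact K) {p q : ℝ × ℝ} (hp : p ∉ K) (hq : q ∉ K)
    (h : PRel K p q) : ∃ C : Set (ℝ × ℝ), IsPreconnected C ∧ C ⊆ Kᶜ ∧ p ∈ C ∧ q ∈ C := by
  have hm : ∀ r, r ∉ K → toC r ∈ (toC '' K)ᶜ := by
    rintro r hr ⟨x, hx, hxr⟩
    exact hr (toC.injective hxr ▸ hx)
  have := LogRel.mem_component (hK.image toC.continuous) (hm p hp) (hm q hq) h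
  refine ⟨toC ⁻¹' (connectedComponentIn (toC '' K)ᶜ (toC p)), ?_, ?_, ?_, this⟩
  · rw [toC.isPreconnected_preimage]; exact isPreconnected_connectedComponentIn
  · intro x hx hxK
    exact connectedComponentIn_subset _ _ hx (mem_image_of_mem _ hxK)
  · exact mem_connectedComponentIn (hm p hp)

end PlaneSep

namespace PlaneEmbedding

open PlaneSep

variable {V : Type*} {G : SimpleGraph V}

lemma exists_par (Φ : PlaneEmbedding G) {u w : V} (h : G.Adj u w) :
    ∃ f : unitInterval → ℝ × ℝ, Continuous f ∧ Function.Injective f ∧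
      range f = Φ.arc ⟨s(u, w), h⟩ ∧ f 0 = Φ.vmap u ∧ f 1 = Φ.vmap w := by
  obtain ⟨f, hc, hi, hr, a, b, hab, h0, h1⟩ := Φ.arc_path ⟨s(u, w), h⟩
  rcases Sym2.eq_iff.1 hab with ⟨rfl, rfl⟩ | ⟨rfl, rfl⟩
  · exact ⟨f, hc, hi, hr, h0, h1⟩
  · refine ⟨f ∘ unitInterval.symm, hc.comp unitInterval.continuous_symm,
      hi.comp unitInterval.symm_bijective.injective, ?_, by simpa using h1, by simpa using h0⟩
    rw [← hr]
    exact unitInterval.symm_bijective.surjective.range_comp f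

/-- A parametrization of the arc of an edge, from `u` to `w`. -/
noncomputable def par (Φ : PlaneEmbedding G) {u w : V} (h : G.Adj u w) : unitInterval → ℝ × ℝ :=
  (Φ.exists_par h).choose

section par
variable (Φ : PlaneEmbedding G) {u w : V} (h : G.Adj u w)

lemma par_cont : Continuous (Φ.par h) := (Φ.exists_par h).choose_spec.1
lemma par_inj : Function.Injective (Φ.par h) := (Φ.exists_par h).choose_spec.2.1
lemma par_range : range (Φ.par h) = Φ.arc ⟨s(u, w), h⟩ := (Φ.exists_par h).choose_spec.2.2.1
lemma par_zero : Φ.par h 0 = Φ.vmap u := (Φ.exists_par h).choose_spec.2.2.2.1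
lemma par_one : Φ.par h 1 = Φ.vmap w := (Φ.exists_par h).choose_spec.2.2.2.2
lemma par_mem (t : unitInterval) : Φ.par h t ∈ Φ.arc ⟨s(u, w), h⟩ :=
  Φ.par_range h ▸ mem_range_self t

lemma par_eq_vmap {t : unitInterval} {x : V} (hx : Φ.par h t = Φ.vmap x) :
    (x = u ∧ t = 0) ∨ (x = w ∧ t = 1) := by
  have h1 : Φ.vmap x ∈ Φ.arc ⟨s(u, w), h⟩ := hx ▸ Φ.par_mem h t
  rcases Sym2.mem_iff.1 (Φ.vmap_mem_arc _ _ h1) with rfl | rfl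
  · exact .inl ⟨rfl, Φ.par_inj h (hx.trans (Φ.par_zero h).symm)⟩
  · exact .inr ⟨rfl, Φ.par_inj h (hx.trans (Φ.par_one h).symm)⟩

end par

lemma arc_compact (Φ : PlaneEmbedding G) (e : G.edgeSet) : IsCompact (Φ.arc e) := by
  obtain ⟨f, hc, -, hr, -⟩ := Φ.arc_path e
  rw [← hr]; exact isCompact_range hc

lemma arc_preconnected (Φ : PlaneEmbedding G) (e : G.edgeSet) : IsPreconnected (Φ.arc e) := by
  obtain ⟨f, hc, -, hr, -⟩ := Φ.arc_path e
  rw [← hr]; exact isPreconnected_range hc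

lemma vmap_mem (Φ : PlaneEmbedding G) {e : G.edgeSet} {x : V} (hx : x ∈ e.1) :
    Φ.vmap x ∈ Φ.arc e := by
  obtain ⟨f, hc, -, hr, u, v, huv, h0, h1⟩ := Φ.arc_path e
  rw [huv] at hx
  rw [← hr]
  rcases Sym2.mem_iff.1 hx with rfl | rfl
  · exact ⟨0, h0⟩
  · exact ⟨1, h1⟩

/-- Halves, near `u`, of the edges from `u` to vertices other than `v₁`, `v₂`. -/
def near (Φ : PlaneEmbedding G) (v₁ v₂ u : V) : Set (ℝ × ℝ) :=
  ⋃ w : V, ⋃ _ : w ≠ v₁ ∧ w ≠ v₂, ⋃ h : G.Adj u w, Φ.par h '' {t | (t : ℝ) ≤ 1 / 2}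

/-- Halves, far from `u`, of the edges from `u` to vertices other than `v₁`, `v₂`. -/
def far (Φ : PlaneEmbedding G) (v₁ v₂ u : V) : Set (ℝ × ℝ) :=
  ⋃ w : V, ⋃ _ : w ≠ v₁ ∧ w ≠ v₂, ⋃ h : G.Adj u w, Φ.par h '' {t | 1 / 2 ≤ (t : ℝ)}

/-- The vertices other than `v₁`, `v₂`. -/
def verts (Φ : PlaneEmbedding G) (v₁ v₂ : V) : Set (ℝ × ℝ) :=
  ⋃ w : V, ⋃ _ : w ≠ v₁ ∧ w ≠ v₂, {Φ.vmap w}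

/-- The edges avoiding `v₁`, `v₂`. -/
def inner (Φ : PlaneEmbedding G) (v₁ v₂ : V) : Set (ℝ × ℝ) :=
  ⋃ e : G.edgeSet, ⋃ _ : v₁ ∉ e.1 ∧ v₂ ∉ e.1, Φ.arc e

/-- The drawing with halves of edges next to `v₁` and `v₂` removed. -/
def core (Φ : PlaneEmbedding G) (v₁ v₂ : V) : Set (ℝ × ℝ) :=
  Φ.verts v₁ v₂ ∪ Φ.inner v₁ v₂ ∪ (Φ.far v₁ v₂ v₁ ∪ Φ.far v₁ v₂ v₂)

variable (Φ : PlaneEmbedding G) {v₁ v₂ : V}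

lemma mem_near {u : V} {x : ℝ × ℝ} : x ∈ Φ.near v₁ v₂ u ↔
    ∃ w, (w ≠ v₁ ∧ w ≠ v₂) ∧ ∃ h : G.Adj u w, ∃ t : unitInterval, (t : ℝ) ≤ 1 / 2 ∧
      Φ.par h t = x := by
  simp only [near, mem_iUnion, exists_prop, mem_image, mem_ofPred_eq]

lemma mem_far {u : V} {x : ℝ × ℝ} : x ∈ Φ.far v₁ v₂ u ↔
    ∃ w, (w ≠ v₁ ∧ w ≠ v₂) ∧ ∃ h : G.Adj u w, ∃ t : unitInterval, 1 / 2 ≤ (t : ℝ) ∧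
      Φ.par h t = x := by
  simp only [far, mem_iUnion, exists_prop, mem_image, mem_ofPred_eq]

lemma mem_verts {x : ℝ × ℝ} : x ∈ Φ.verts v₁ v₂ ↔
    ∃ w, (w ≠ v₁ ∧ w ≠ v₂) ∧ x = Φ.vmap w := by
  simp only [verts, mem_iUnion, exists_prop, mem_singleton_iff]

lemma mem_inner {x : ℝ × ℝ} : x ∈ Φ.inner v₁ v₂ ↔
    ∃ e : G.edgeSet, (v₁ ∉ e.1 ∧ v₂ ∉ e.1) ∧ x ∈ Φ.arc e := by
  simp only [inner, mem_iUnion, exists_prop]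

lemma near_compact [Finite V] (u : V) : IsCompact (Φ.near v₁ v₂ u) := by
  refine isCompact_iUnion fun w => isCompact_iUnion fun _ => isCompact_iUnion fun h => ?_
  refine IsCompact.image ?_ (Φ.par_cont h)
  exact (isClosed_le (by fun_prop) (by fun_prop)).isCompact

lemma core_compact [Finite V] : IsCompact (Φ.core v₁ v₂) := by
  have hf : ∀ u, IsCompact (Φ.far v₁ v₂ u) := by
    intro u
    refine isCompact_iUnion fun w => isCompact_iUnion fun _ => isCompact_iUnion fun h => ?_
    refine IsCompact.image ?_ (Φ.par_cont h)
    exact (isClosed_le (by fun_prop) (by fun_prop)).isCompact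
  refine IsCompact.union (IsCompact.union ?_ ?_) ((hf _).union (hf _))
  · exact isCompact_iUnion fun w => isCompact_iUnion fun _ => isCompact_singleton
  · exact isCompact_iUnion fun e => isCompact_iUnion fun _ => Φ.arc_compact e

lemma drawing_compact [Finite V] : IsCompact Φ.drawing :=
  isCompact_iUnion fun e => Φ.arc_compact e

lemma vmap_near {u x : V} (hx : Φ.vmap x ∈ Φ.near v₁ v₂ u) : x = u := by
  obtain ⟨w, -, h, t, ht, hxt⟩ := Φ.mem_near.1 hx
  rcases Φ.par_eq_vmap h hxt with h1 | h1
  · exact h1.1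
  · rw [h1.2] at ht; norm_num at ht

lemma vmap_core {x : V} (hx : Φ.vmap x ∈ Φ.core v₁ v₂) : x ≠ v₁ ∧ x ≠ v₂ := by
  have hfar : ∀ u, Φ.vmap x ∈ Φ.far v₁ v₂ u → x ≠ v₁ ∧ x ≠ v₂ := by
    intro u hx
    obtain ⟨w, hw, h, t, ht, hxt⟩ := Φ.mem_far.1 hx
    rcases Φ.par_eq_vmap h hxt with h1 | h1
    · rw [h1.2] at ht; norm_num at ht
    · rw [h1.1]; exact hw
  rcases hx with (hx | hx) | (hx | hx)
  · obtain ⟨w, hw, hxw⟩ := Φ.mem_verts.1 hx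
    rw [Φ.vmap_inj hxw]; exact hw
  · obtain ⟨e, he, hxe⟩ := Φ.mem_inner.1 hx
    have := Φ.vmap_mem_arc _ _ hxe
    exact ⟨fun h => he.1 (h ▸ this), fun h => he.2 (h ▸ this)⟩
  · exact hfar _ hx
  · exact hfar _ hx

lemma near_inter (hv : v₁ ≠ v₂) : Φ.near v₁ v₂ v₁ ∩ Φ.near v₁ v₂ v₂ = ∅ := by
  rw [eq_empty_iff_forall_notMem]
  rintro x ⟨h1, h2⟩
  obtain ⟨w, hw, h, t, ht, hxt⟩ := Φ.mem_near.1 h1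
  obtain ⟨w', hw', h', t', ht', hxt'⟩ := Φ.mem_near.1 h2
  have hne : (⟨s(v₁, w), h⟩ : G.edgeSet) ≠ ⟨s(v₂, w'), h'⟩ := by
    intro he
    rcases Sym2.eq_iff.1 (Subtype.ext_iff.1 he) with h3 | h3
    · exact hv h3.1
    · exact hw.2 h3.2
  obtain ⟨y, hy, hyx⟩ := Φ.arc_inter _ _ hne ⟨hxt ▸ Φ.par_mem h t, hxt' ▸ Φ.par_mem h' t'⟩
  rw [← hyx] at h1 h2
  exact hv ((Φ.vmap_near h1).symm.trans (Φ.vmap_near h2))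

/-- The drawing without the edge `v₁ v₂`. -/
def rest (v₁ v₂ : V) : Set (ℝ × ℝ) :=
  (Φ.core v₁ v₂ ∪ Φ.near v₁ v₂ v₂) ∪ (Φ.core v₁ v₂ ∪ Φ.near v₁ v₂ v₁)

lemma mem_rest {x : ℝ × ℝ} (hx : x ∈ Φ.rest v₁ v₂) :
    (∃ w, (w ≠ v₁ ∧ w ≠ v₂) ∧ x = Φ.vmap w) ∨
      ∃ e : G.edgeSet, e.1 ≠ s(v₁, v₂) ∧ x ∈ Φ.arc e := by
  have hE : ∀ u w, (w ≠ v₁ ∧ w ≠ v₂) → s(u, w) ≠ s(v₁, v₂) := by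
    intro u w hw he
    rcases Sym2.eq_iff.1 he with h3 | h3
    · exact hw.2 h3.2
    · exact hw.1 h3.2
  have hn : ∀ u, x ∈ Φ.near v₁ v₂ u → ∃ e : G.edgeSet, e.1 ≠ s(v₁, v₂) ∧ x ∈ Φ.arc e := by
    intro u hx
    obtain ⟨w, hw, h, t, ht, hxt⟩ := Φ.mem_near.1 hx
    exact ⟨⟨s(u, w), h⟩, hE u w hw, hxt ▸ Φ.par_mem h t⟩
  have hf : ∀ u, x ∈ Φ.far v₁ v₂ u → ∃ e : G.edgeSet, e.1 ≠ s(v₁, v₂) ∧ x ∈ Φ.arc e := by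
    intro u hx
    obtain ⟨w, hw, h, t, ht, hxt⟩ := Φ.mem_far.1 hx
    exact ⟨⟨s(u, w), h⟩, hE u w hw, hxt ▸ Φ.par_mem h t⟩
  have hc : x ∈ Φ.core v₁ v₂ → (∃ w, (w ≠ v₁ ∧ w ≠ v₂) ∧ x = Φ.vmap w) ∨
      ∃ e : G.edgeSet, e.1 ≠ s(v₁, v₂) ∧ x ∈ Φ.arc e := by
    rintro ((hx | hx) | (hx | hx))
    · exact .inl (Φ.mem_verts.1 hx)
    · obtain ⟨e, he, hxe⟩ := Φ.mem_inner.1 hx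
      exact .inr ⟨e, fun h => he.1 (h ▸ Sym2.mem_mk_left _ _), hxe⟩
    · exact .inr (hf _ hx)
    · exact .inr (hf _ hx)
  rcases hx with (hx | hx) | (hx | hx)
  · exact hc hx
  · exact .inr (hn _ hx)
  · exact hc hx
  · exact .inr (hn _ hx)

lemma rest_inter (h : s(v₁, v₂) ∈ G.edgeSet) {x : ℝ × ℝ} (hx : x ∈ Φ.rest v₁ v₂)
    (hx' : x ∈ Φ.arc ⟨s(v₁, v₂), h⟩) : x = Φ.vmap v₁ ∨ x = Φ.vmap v₂ := by
  rcases Φ.mem_rest hx with ⟨w, hw, rfl⟩ | ⟨e, he, hxe⟩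
  · rcases Sym2.mem_iff.1 (Φ.vmap_mem_arc _ _ hx') with rfl | rfl
    · exact .inl rfl
    · exact .inr rfl
  · obtain ⟨y, hy, rfl⟩ := Φ.arc_inter e ⟨s(v₁, v₂), h⟩ (fun h => he (Subtype.ext_iff.1 h))
      ⟨hxe, hx'⟩
    rcases Sym2.mem_iff.1 hy.2 with rfl | rfl
    · exact .inl rfl
    · exact .inr rfl

lemma rest_subset (hn : ∀ w : V, ∃ u, G.Adj w u) : Φ.rest v₁ v₂ ⊆ Φ.drawing := by
  intro x hx
  rcases Φ.mem_rest hx with ⟨w, hw, rfl⟩ | ⟨e, he, hxe⟩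
  · obtain ⟨u, hu⟩ := hn w
    exact mem_iUnion.2 ⟨⟨s(w, u), hu⟩, Φ.vmap_mem (Sym2.mem_mk_left _ _)⟩
  · exact mem_iUnion.2 ⟨e, hxe⟩

lemma drawing_subset {x : ℝ × ℝ} (hx : x ∈ Φ.drawing) :
    x ∈ Φ.rest v₁ v₂ ∨ ∃ h : s(v₁, v₂) ∈ G.edgeSet, x ∈ Φ.arc ⟨s(v₁, v₂), h⟩ := by
  obtain ⟨⟨e, he⟩, hx⟩ := mem_iUnion.1 hx
  have key : ∀ u, (u = v₁ ∨ u = v₂) → u ∈ e → x ∈ Φ.rest v₁ v₂ ∨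
      ∃ h : s(v₁, v₂) ∈ G.edgeSet, x ∈ Φ.arc ⟨s(v₁, v₂), h⟩ := by
    intro u hu hue
    obtain ⟨w, rfl⟩ := Sym2.mem_iff_exists.1 hue
    have hadj : G.Adj u w := he
    have hne : u ≠ w := hadj.ne
    by_cases hw : w ≠ v₁ ∧ w ≠ v₂
    · left
      rw [← Φ.par_range hadj] at hx
      obtain ⟨t, ht⟩ := hx
      rcases le_total (t : ℝ) (1 / 2) with h | h
      · have : x ∈ Φ.near v₁ v₂ u := Φ.mem_near.2 ⟨w, hw, hadj, t, h, ht⟩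
        rcases hu with rfl | rfl
        · exact .inr (.inr this)
        · exact .inl (.inr this)
      · have : x ∈ Φ.far v₁ v₂ u := Φ.mem_far.2 ⟨w, hw, hadj, t, h, ht⟩
        rcases hu with rfl | rfl
        · exact .inl (.inl (.inr (.inl this)))
        · exact .inl (.inl (.inr (.inr this)))
    · right
      have : s(u, w) = s(v₁, v₂) := by
        rw [Sym2.eq_iff]
        by_cases h1 : w = v₁
        · subst h1
          rcases hu with rfl | rfl
          · exact absurd rfl hne
          · exact .inr ⟨rfl, rfl⟩
        · have h2 : w = v₂ := by by_contra h2; exact hw ⟨h1, h2⟩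
          subst h2
          rcases hu with rfl | rfl
          · exact .inl ⟨rfl, rfl⟩
          · exact absurd rfl hne
      exact ⟨this ▸ he, by simpa only [this] using hx⟩
  by_cases h1 : v₁ ∈ e
  · exact key v₁ (.inl rfl) h1
  by_cases h2 : v₂ ∈ e
  · exact key v₂ (.inr rfl) h2
  exact .inl (.inl (.inl (.inl (.inr (Φ.mem_inner.2 ⟨⟨e, he⟩, ⟨h1, h2⟩, hx⟩)))))

lemma core_preconnected
    (hG : (G.induce {x : V | x ≠ v₁ ∧ x ≠ v₂}).Connected) : IsPreconnected (Φ.core v₁ v₂) := by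
  have hvm : ∀ w, (w ≠ v₁ ∧ w ≠ v₂) → Φ.vmap w ∈ Φ.core v₁ v₂ := fun w hw =>
    .inl (.inl (Φ.mem_verts.2 ⟨w, hw, rfl⟩))
  have harc : ∀ e : G.edgeSet, (v₁ ∉ e.1 ∧ v₂ ∉ e.1) → Φ.arc e ⊆ Φ.core v₁ v₂ :=
    fun e he x hx => .inl (.inr (Φ.mem_inner.2 ⟨e, he, hx⟩))
  obtain ⟨w₀⟩ := hG.nonempty
  have hreach : ∀ w : {x : V | x ≠ v₁ ∧ x ≠ v₂},
      Φ.vmap w ∈ connectedComponentIn (Φ.core v₁ v₂) (Φ.vmap w₀) := by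
    intro w
    obtain ⟨p⟩ := hG.preconnected w w₀
    induction p with
    | @nil u =>
      have hu : (u : V) ≠ v₁ ∧ (u : V) ≠ v₂ := u.2
      exact mem_connectedComponentIn (hvm _ hu)
    | @cons a b c hab p ih =>
      have hadj : G.Adj a b := hab
      have ha : (a : V) ≠ v₁ ∧ (a : V) ≠ v₂ := a.2
      have hb : (b : V) ≠ v₁ ∧ (b : V) ≠ v₂ := b.2
      have hsub := harc ⟨s((a : V), (b : V)), hadj⟩ ⟨fun h => by
        rcases Sym2.mem_iff.1 h with h | h
        · exact ha.1 h.symm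
        · exact hb.1 h.symm, fun h => by
        rcases Sym2.mem_iff.1 h with h | h
        · exact ha.2 h.symm
        · exact hb.2 h.symm⟩
      rw [connectedComponentIn_eq ih]
      exact (Φ.arc_preconnected _).subset_connectedComponentIn
        (Φ.vmap_mem (Sym2.mem_mk_right _ _)) hsub (Φ.vmap_mem (Sym2.mem_mk_left _ _))
  have hfar : ∀ u, Φ.far v₁ v₂ u ⊆ Φ.core v₁ v₂ → 
      Φ.far v₁ v₂ u ⊆ connectedComponentIn (Φ.core v₁ v₂) (Φ.vmap w₀) := by
    intro u hu x hx
    obtain ⟨w, hw, h, t, ht, hxt⟩ := Φ.mem_far.1 hx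
    rw [connectedComponentIn_eq (hreach ⟨w, hw⟩)]
    have hpre : IsPreconnected (Φ.par h '' {t | 1 / 2 ≤ (t : ℝ)}) := by
      refine IsPreconnected.image ?_ _ (Φ.par_cont h).continuousOn
      have : {t : unitInterval | 1 / 2 ≤ (t : ℝ)} = Ici ⟨1 / 2, by norm_num, by norm_num⟩ := by
        ext t; rfl
      rw [this]
      exact ordConnected_Ici.isPreconnected
    refine hpre.subset_connectedComponentIn ⟨1, by simp only [mem_ofPred_eq]; norm_num, Φ.par_one h⟩ ?_ ⟨t, ht, hxt⟩
    rintro y ⟨s, hs, hys⟩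
    exact hu (Φ.mem_far.2 ⟨w, hw, h, s, hs, hys⟩)
  have hsub : Φ.core v₁ v₂ ⊆ connectedComponentIn (Φ.core v₁ v₂) (Φ.vmap w₀) := by
    rintro x ((hx | hx) | (hx | hx))
    · obtain ⟨w, hw, rfl⟩ := Φ.mem_verts.1 hx
      exact hreach ⟨w, hw⟩
    · obtain ⟨⟨e, he⟩, hev, hxe⟩ := Φ.mem_inner.1 hx
      obtain ⟨w, hwe⟩ : ∃ w, w ∈ e := ⟨_, Sym2.out_fst_mem e⟩
      have hw : w ≠ v₁ ∧ w ≠ v₂ := ⟨fun h => hev.1 (h ▸ hwe), fun h => hev.2 (h ▸ hwe)⟩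
      rw [connectedComponentIn_eq (hreach ⟨w, hw⟩)]
      exact (Φ.arc_preconnected _).subset_connectedComponentIn
        (Φ.vmap_mem hwe) (harc _ hev) hxe
    · exact hfar _ (fun y hy => .inr (.inl hy)) hx
    · exact hfar _ (fun y hy => .inr (.inr hy)) hx
  rw [hsub.antisymm (connectedComponentIn_subset _ _)]
  exact isPreconnected_connectedComponentIn

lemma rel_of_closure {K D F₁ F₂ : Set (ℝ × ℝ)} (hK : IsClosed K) (hKD : K ⊆ D)
    (h₁ : IsPreconnected F₁) (h₂ : IsPreconnected F₂) (hd₁ : F₁ ⊆ Dᶜ) (hd₂ : F₂ ⊆ Dᶜ)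
    {x p q : ℝ × ℝ} (hx : x ∉ K) (hx₁ : x ∈ closure F₁) (hx₂ : x ∈ closure F₂)
    (hp : p ∈ F₁) (hq : q ∈ F₂) : PRel K p q := by
  obtain ⟨ε, hε, hb⟩ := Metric.isOpen_iff.1 hK.isOpen_compl x hx
  obtain ⟨p', hp', hp'b⟩ := mem_closure_iff.1 hx₁ _ Metric.isOpen_ball (Metric.mem_ball_self hε)
  obtain ⟨q', hq', hq'b⟩ := mem_closure_iff.1 hx₂ _ Metric.isOpen_ball (Metric.mem_ball_self hε)
  have hs := compl_subset_compl.2 hKD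
  have r1 : PRel K p p' := PRel.of_preconnected hK h₁ (hd₁.trans hs) hp hp'b
  have r2 : PRel K q' q := PRel.of_preconnected hK h₂ (hd₂.trans hs) hq'b hq
  have r3 : PRel K p' q' :=
    PRel.of_preconnected hK (convex_ball x ε).isPreconnected hb hp' hq'
  exact (r1.trans r3).trans r2

lemma rest_rel [Finite V] (hv : v₁ ≠ v₂) (hn : ∀ w : V, ∃ u, G.Adj w u)
    (hG : (G.induce {x : V | x ≠ v₁ ∧ x ≠ v₂}).Connected)
    {F₁ F₂ : Set (ℝ × ℝ)}
    (h₁ : IsPreconnected F₁) (h₂ : IsPreconnected F₂)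
    (hd₁ : F₁ ⊆ Φ.drawingᶜ) (hd₂ : F₂ ⊆ Φ.drawingᶜ)
    (h11 : Φ.vmap v₁ ∈ closure F₁) (h12 : Φ.vmap v₁ ∈ closure F₂)
    (h21 : Φ.vmap v₂ ∈ closure F₁) (h22 : Φ.vmap v₂ ∈ closure F₂)
    {p q : ℝ × ℝ} (hp : p ∈ F₁) (hq : q ∈ F₂) : PRel (Φ.rest v₁ v₂) p q := by
  have hr : Φ.rest v₁ v₂ ⊆ Φ.drawing := Φ.rest_subset hn
  have c2 : IsClosed (Φ.core v₁ v₂ ∪ Φ.near v₁ v₂ v₂) :=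
    (Φ.core_compact.union (Φ.near_compact _)).isClosed
  have c1 : IsClosed (Φ.core v₁ v₂ ∪ Φ.near v₁ v₂ v₁) :=
    (Φ.core_compact.union (Φ.near_compact _)).isClosed
  refine PRel.union c2 c1 ?_ ?_ ?_ ?_
  · rw [← union_inter_distrib_left, inter_comm, Φ.near_inter hv, union_empty]
    exact Φ.core_preconnected hG
  · exact fun h => hd₂ hq (hr (.inl h.1))
  · refine rel_of_closure c2 (subset_union_left.trans hr) h₁ h₂ hd₁ hd₂ ?_ h11 h12 hp hq
    rintro (h | h)
    · exact (Φ.vmap_core h).1 rfl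
    · exact hv (Φ.vmap_near h)
  · refine rel_of_closure c1 (subset_union_right.trans hr) h₁ h₂ hd₁ hd₂ ?_ h21 h22 hp hq
    rintro (h | h)
    · exact (Φ.vmap_core h).2 rfl
    · exact hv (Φ.vmap_near h).symm

lemma rest_compact [Finite V] : IsCompact (Φ.rest v₁ v₂) :=
  (Φ.core_compact.union (Φ.near_compact _)).union (Φ.core_compact.union (Φ.near_compact _))

lemma face_frontier [Finite V] {F : Set (ℝ × ℝ)} (hF : Φ.IsFace F) :
    frontier F ⊆ Φ.drawing := by
  obtain ⟨p, hp, rfl⟩ := hF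
  exact frontier_component Φ.drawing_compact.isClosed hp

lemma arc_on_face [Finite V] (h : s(v₁, v₂) ∈ G.edgeSet)
    (hn : ∀ w : V, ∃ u, G.Adj w u)
    {F : Set (ℝ × ℝ)} (hF : Φ.IsFace F) {p q : ℝ × ℝ} (hp : p ∈ F) (hq : q ∉ F)
    (hpD : p ∉ Φ.drawing) (hqD : q ∉ Φ.drawing)
    (hr : PRel (Φ.rest v₁ v₂) p q)
    (hf1 : Φ.vmap v₁ ∈ frontier F) (hf2 : Φ.vmap v₂ ∈ frontier F) :
    Φ.arc ⟨s(v₁, v₂), h⟩ ⊆ frontier F := by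
  intro x hx
  have hadj : G.Adj v₁ v₂ := h
  have hrange := Φ.par_range hadj
  have hx0 := hx
  rw [← hrange] at hx
  obtain ⟨t₀, rfl⟩ := hx
  by_contra hxF
  have ht0 : t₀ ≠ 0 := by rintro rfl; rw [Φ.par_zero] at hxF; exact hxF hf1
  have ht1 : t₀ ≠ 1 := by rintro rfl; rw [Φ.par_one] at hxF; exact hxF hf2
  have ht0' : (0 : ℝ) < t₀ := unitInterval.pos_iff_ne_zero.2 ht0
  have ht1' : (t₀ : ℝ) < 1 := unitInterval.lt_one_iff_ne_one.2 ht1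
  set f := Φ.par hadj with hfdef
  have hfc : Continuous f := Φ.par_cont hadj
  have hfi : Function.Injective f := Φ.par_inj hadj
  obtain ⟨ε, hε, hb⟩ := Metric.isOpen_iff.1
    (isClosed_frontier.isOpen_compl.preimage hfc) t₀ (show f t₀ ∈ (frontier F)ᶜ from hxF)
  let E₁ : Set (ℝ × ℝ) := f '' {t | (t : ℝ) ≤ t₀ - ε / 2}
  let E₂ : Set (ℝ × ℝ) := f '' {t | (t₀ : ℝ) + ε / 2 ≤ t}
  have hE₁c : IsCompact E₁ :=
    (isClosed_le (by fun_prop) (by fun_prop)).isCompact.image hfc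
  have hE₂c : IsCompact E₂ :=
    (isClosed_le (by fun_prop) (by fun_prop)).isCompact.image hfc
  have hfD : ∀ t, f t ∈ Φ.drawing := fun t => mem_iUnion.2 ⟨_, Φ.par_mem hadj t⟩
  have hparc : PRel (range f) p q := PRel.of_arc hfc hfi
    (by rintro ⟨t, rfl⟩; exact hpD (hfD t)) (by rintro ⟨t, rfl⟩; exact hqD (hfD t))
  have hE₁D : E₁ ⊆ Φ.drawing := by rintro _ ⟨t, -, rfl⟩; exact hfD t
  have hE₂D : E₂ ⊆ Φ.drawing := by rintro _ ⟨t, -, rfl⟩; exact hfD t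
  have hrD : Φ.rest v₁ v₂ ⊆ Φ.drawing := Φ.rest_subset hn
  have r1 : PRel (Φ.rest v₁ v₂ ∪ E₁) p q := by
    refine PRel.union Φ.rest_compact.isClosed hE₁c.isClosed ?_ (fun hh => hqD (hrD hh.1)) hr
      (hparc.mono (image_subset_range _ _))
    refine Set.Subsingleton.isPreconnected (subsingleton_of_subset_singleton (a := Φ.vmap v₁) ?_)
    rintro y ⟨hy, ⟨t, ht, rfl⟩⟩
    rcases Φ.rest_inter h hy (Φ.par_mem hadj t) with h1 | h1
    · exact h1
    · exfalso
      have : t = 1 := hfi (h1.trans (Φ.par_one hadj).symm)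
      subst this
      simp only [mem_ofPred_eq, Set.Icc.coe_one] at ht
      linarith
  have r2 : PRel (Φ.rest v₁ v₂ ∪ E₁ ∪ E₂) p q := by
    refine PRel.union (Φ.rest_compact.union hE₁c).isClosed hE₂c.isClosed ?_
      (fun hh => hqD (hE₂D hh.2)) r1 (hparc.mono (image_subset_range _ _))
    refine Set.Subsingleton.isPreconnected (subsingleton_of_subset_singleton (a := Φ.vmap v₂) ?_)
    rintro y ⟨hy | ⟨s, hs, hst⟩, ⟨t, ht, rfl⟩⟩
    · rcases Φ.rest_inter h hy (Φ.par_mem hadj t) with h1 | h1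
      · exfalso
        have : t = 0 := hfi (h1.trans (Φ.par_zero hadj).symm)
        subst this
        simp only [mem_ofPred_eq, Set.Icc.coe_zero] at ht
        linarith
      · exact h1
    · exfalso
      have := hfi hst
      subst this
      simp only [mem_ofPred_eq] at hs ht
      linarith
  have hsubD : Φ.rest v₁ v₂ ∪ E₁ ∪ E₂ ⊆ Φ.drawing :=
    union_subset (union_subset hrD hE₁D) hE₂D
  obtain ⟨C, hC, hCK, hpC, hqC⟩ := r2.joined ((Φ.rest_compact.union hE₁c).union hE₂c)
    (fun hh => hpD (hsubD hh)) (fun hh => hqD (hsubD hh))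
  obtain ⟨y, hyC, hyF⟩ : (C ∩ frontier F).Nonempty := by
    by_contra hem
    rw [not_nonempty_iff_eq_empty] at hem
    have hsub : C ⊆ interior F ∪ (closure F)ᶜ := by
      intro z hz
      by_cases h1 : z ∈ interior F
      · exact .inl h1
      · exact .inr fun h2 => by
          have : z ∈ C ∩ frontier F := ⟨hz, h2, h1⟩
          rw [hem] at this; exact this
    have hpF : p ∈ interior F := by
      rcases hsub hpC with h1 | h1
      · exact h1
      · exact absurd (subset_closure hp) h1
    have := hC.subset_left_of_subset_union isOpen_interior isClosed_closure.isOpen_compl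
      (disjoint_compl_right.mono_left interior_subset_closure) hsub ⟨p, hpC, hpF⟩
    exact hq (interior_subset (this hqC))
  rcases Φ.drawing_subset (v₁ := v₁) (v₂ := v₂) (Φ.face_frontier hF hyF) with h1 | ⟨_, h1⟩
  · exact hCK hyC (.inl (.inl h1))
  · rw [← hrange] at h1
    obtain ⟨t, rfl⟩ := h1
    by_cases hta : (t : ℝ) ≤ t₀ - ε / 2
    · exact hCK hyC (.inl (.inr ⟨t, hta, rfl⟩))
    by_cases htb : (t₀ : ℝ) + ε / 2 ≤ t
    · exact hCK hyC (.inr ⟨t, htb, rfl⟩)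
    push Not at hta htb
    have : t ∈ Metric.ball t₀ ε := by
      rw [Metric.mem_ball, Subtype.dist_eq, Real.dist_eq, abs_lt]
      constructor <;> linarith
    exact hb this hyF

end PlaneEmbedding

/-- for a finite simple triconnected graph `G` with a plane embedding `Φ`,
distinct vertices `v₁ ≠ v₂` and distinct faces `F₁ ≠ F₂`: both `v₁` and `v₂` lie on the
boundaries of both `F₁` and `F₂` iff `{v₁, v₂}` is an edge of `G` whose arc lies on the
boundary of both `F₁` and `F₂`. -/
theorem statement4 {V : Type*} [Fintype V] (G : SimpleGraph V) (hG : Triconnected G)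
    (Φ : PlaneEmbedding G) (v₁ v₂ : V) (hv : v₁ ≠ v₂)
    (F₁ F₂ : Set (ℝ × ℝ)) (hF₁ : Φ.IsFace F₁) (hF₂ : Φ.IsFace F₂) (hne : F₁ ≠ F₂) :
    (Φ.OnFace F₁ v₁ ∧ Φ.OnFace F₂ v₁ ∧ Φ.OnFace F₁ v₂ ∧ Φ.OnFace F₂ v₂) ↔
      (∃ h : s(v₁, v₂) ∈ G.edgeSet,
        Φ.arc ⟨s(v₁, v₂), h⟩ ⊆ frontier F₁ ∧ Φ.arc ⟨s(v₁, v₂), h⟩ ⊆ frontier F₂) := by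
  have hconn : G.Connected := hG.1.1
  have hn : ∀ w : V, ∃ u, G.Adj w u := by
    intro w
    have : Nontrivial V := ⟨v₁, v₂, hv⟩
    obtain ⟨u, hu⟩ := exists_ne w
    obtain ⟨p⟩ := hconn.preconnected w u
    cases p with
    | nil => exact absurd rfl hu
    | cons h _ => exact ⟨_, h⟩
  constructor
  · rintro ⟨h11, h12, h21, h22⟩
    obtain ⟨p, hp, hpF⟩ := id hF₁
    obtain ⟨q, hq, hqF⟩ := id hF₂
    have pF : p ∈ F₁ := hpF ▸ mem_connectedComponentIn hp
    have qF : q ∈ F₂ := hqF ▸ mem_connectedComponentIn hq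
    have hqp : q ∉ connectedComponentIn Φ.drawingᶜ p := fun h => hne <| by
      rw [hpF, hqF]; exact connectedComponentIn_eq h
    have hpq : p ∉ connectedComponentIn Φ.drawingᶜ q := fun h => hne <| by
      rw [hpF, hqF]; exact (connectedComponentIn_eq h).symm
    have hr : PlaneSep.PRel (Φ.rest v₁ v₂) p q := by
      refine Φ.rest_rel hv hn (hG.2.2 v₁ v₂ hv) (F₁ := F₁) (F₂ := F₂) ?_ ?_ ?_ ?_
        h11.1 h12.1 h21.1 h22.1 pF qF
      · rw [hpF]; exact isPreconnected_connectedComponentIn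
      · rw [hqF]; exact isPreconnected_connectedComponentIn
      · rw [hpF]; exact connectedComponentIn_subset _ _
      · rw [hqF]; exact connectedComponentIn_subset _ _
    have hrD := Φ.rest_subset (v₁ := v₁) (v₂ := v₂) hn
    have hedge : s(v₁, v₂) ∈ G.edgeSet := by
      by_contra hno
      obtain ⟨C, hC, hCK, hpC, hqC⟩ := hr.joined Φ.rest_compact
        (fun h => hp (hrD h)) (fun h => hq (hrD h))
      refine hqp (hC.subset_connectedComponentIn hpC ?_ hqC)
      intro z hz hzD
      rcases Φ.drawing_subset (v₁ := v₁) (v₂ := v₂) hzD with h | ⟨h, -⟩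
      · exact hCK hz h
      · exact hno h
    refine ⟨hedge, ?_, ?_⟩
    · exact Φ.arc_on_face hedge hn hF₁ pF (hpF ▸ hqp) hp hq hr h11 h21
    · exact Φ.arc_on_face hedge hn hF₂ qF (hqF ▸ hpq) hq hp hr.symm h12 h22
  · rintro ⟨h, h1, h2⟩
    have m1 := Φ.vmap_mem (e := ⟨s(v₁, v₂), h⟩) (Sym2.mem_mk_left v₁ v₂)
    have m2 := Φ.vmap_mem (e := ⟨s(v₁, v₂), h⟩) (Sym2.mem_mk_right v₁ v₂)
    exact ⟨h1 m1, h2 m1, h1 m2, h2 m2⟩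
end

section
/- There is a constant c > 0 such that the following holds. Let G be a finite simple triconnected graph with a fixed plane embedding Φ, and let U be any set of vertices of G. Then the number of faces of Φ whose boundary contains at least two vertices of U is at most c·|U|. -/
open Set Topology

namespace PF
open Complex

/-- `f` has a continuous logarithm on `K`. -/
def Lg (f : ℂ → ℂ) (K : Set ℂ) : Prop :=
  ∃ h : ℂ → ℂ, ContinuousOn h K ∧ ∀ z ∈ K, f z = exp (h z)

lemma Lg.mono {f : ℂ → ℂ} {K L : Set ℂ} (h : Lg f L) (hKL : K ⊆ L) : Lg f K := by
  obtain ⟨g, hg, hg2⟩ := h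
  exact ⟨g, hg.mono hKL, fun z hz => hg2 z (hKL hz)⟩

lemma Lg.congr {f g : ℂ → ℂ} {K : Set ℂ} (h : Lg f K) (hfg : ∀ z ∈ K, f z = g z) : Lg g K := by
  obtain ⟨k, hk, hk2⟩ := h
  exact ⟨k, hk, fun z hz => by rw [← hfg z hz, hk2 z hz]⟩

lemma Lg.mul {f g : ℂ → ℂ} {K : Set ℂ} (hf : Lg f K) (hg : Lg g K) :
    Lg (fun z => f z * g z) K := by
  obtain ⟨k, hk, hk2⟩ := hf
  obtain ⟨l, hl, hl2⟩ := hg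
  exact ⟨fun z => k z + l z, hk.add hl, fun z hz => by
    beta_reduce; rw [hk2 z hz, hl2 z hz, exp_add]⟩

lemma Lg.inv {f : ℂ → ℂ} {K : Set ℂ} (hf : Lg f K) : Lg (fun z => (f z)⁻¹) K := by
  obtain ⟨k, hk, hk2⟩ := hf
  exact ⟨fun z => - k z, hk.neg, fun z hz => by
    beta_reduce; rw [hk2 z hz, exp_neg]⟩

lemma Lg.zpow {f : ℂ → ℂ} {K : Set ℂ} (hf : Lg f K) (n : ℤ) : Lg (fun z => (f z) ^ n) K := by
  obtain ⟨k, hk, hk2⟩ := hf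
  exact ⟨fun z => n * k z, continuousOn_const.mul hk, fun z hz => by
    beta_reduce; rw [hk2 z hz, exp_int_mul]⟩

lemma Lg.const {K : Set ℂ} {c : ℂ} (hc : c ≠ 0) : Lg (fun _ => c) K :=
  ⟨fun _ => log c, continuousOn_const, fun z _ => by rw [exp_log hc]⟩

lemma Lg.prod {ι : Type*} {K : Set ℂ} (s : Finset ι) (f : ι → ℂ → ℂ) (h : ∀ i ∈ s, Lg (f i) K) :
    Lg (fun z => ∏ i ∈ s, f i z) K := by
  classical
  induction s using Finset.induction_on with
  | empty => simpa using Lg.const one_ne_zero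
  | insert a s ha ih =>
    have := (h a (by simp)).mul (ih (fun i hi => h i (by simp [hi])))
    exact this.congr (fun z _ => by rw [Finset.prod_insert ha])

lemma Lg.near_one {f : ℂ → ℂ} {K : Set ℂ} (hf : ContinuousOn f K)
    (h : ∀ z ∈ K, ‖f z - 1‖ < 1) : Lg f K := by
  have hs : ∀ z ∈ K, f z ∈ slitPlane := fun z hz => by
    apply ball_one_subset_slitPlane
    simpa [dist_eq_norm] using h z hz
  refine ⟨fun z => log (f z), hf.clog hs, fun z hz => ?_⟩
  rw [exp_log (slitPlane_ne_zero (hs z hz))]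

lemma exists_log {X : Type*} [TopologicalSpace X] [SimplyConnectedSpace X]
    [LocallyPathConnectedSpace X] (f : X → ℂ) (hf : Continuous f) (h0 : ∀ x, f x ≠ 0) :
    ∃ g : X → ℂ, Continuous g ∧ ∀ x, f x = exp (g x) := by
  obtain ⟨x0⟩ : Nonempty X := inferInstance
  obtain ⟨F, ⟨_, hF⟩, _⟩ := isCoveringMapOn_exp.existsUnique_continuousMap_lifts ⟨f, hf⟩
    (a₀ := x0) (e₀ := log (f x0)) (exp_log (h0 x0)) (fun a => h0 a)
  exact ⟨F, F.continuous, fun x => (congrFun hF x).symm⟩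

lemma Lg.of_global {f : ℂ → ℂ} (hf : Continuous f) (h0 : ∀ x, f x ≠ 0) (K : Set ℂ) : Lg f K := by
  obtain ⟨g, hg, hg2⟩ := exists_log f hf h0
  exact ⟨g, hg.continuousOn, fun z _ => hg2 z⟩

lemma const_of_exp {X : Type*} [TopologicalSpace X] {s : Set X} (hs : IsPreconnected s)
    {h : X → ℂ} (hc : ContinuousOn h s) (he : ∀ x ∈ s, ∀ y ∈ s, exp (h x) = exp (h y))
    {x y : X} (hx : x ∈ s) (hy : y ∈ s) : h x = h y :=
  isCoveringMap_exp.constOn_of_comp hs hc (fun a ha b hb => Subtype.ext (he a ha b hb)) hx hy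

lemma exp_eq_imp {a b : ℂ} (h : exp a = exp b) : ∃ n : ℤ, a = b + n * (2 * Real.pi * I) :=
  exp_eq_exp_iff_exists_int.1 h

lemma exp_shift (a : ℂ) (n : ℤ) : exp (a + n * (2 * Real.pi * I)) = exp a :=
  exp_eq_exp_iff_exists_int.2 ⟨n, rfl⟩

/-- Gluing of logarithms that agree on the intersection. -/
lemma glue_aux {f h k : ℂ → ℂ} {K L : Set ℂ} (hK : IsClosed K) (hL : IsClosed L)
    (hh : ContinuousOn h K) (hk : ContinuousOn k L) (eh : ∀ z ∈ K, f z = exp (h z))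
    (ek : ∀ z ∈ L, f z = exp (k z)) (hkh : ∀ z ∈ K ∩ L, k z = h z) : Lg f (K ∪ L) := by
  classical
  have hE : EqOn (K.piecewise h k) k L := by
    intro z hz
    by_cases hzK : z ∈ K
    · rw [piecewise_eq_of_mem _ _ _ hzK, hkh z ⟨hzK, hz⟩]
    · rw [piecewise_eq_of_notMem _ _ _ hzK]
  refine ⟨K.piecewise h k, ?_, ?_⟩
  · apply ContinuousOn.union_of_isClosed _ _ hK hL
    · exact hh.congr (piecewise_eqOn K h k)
    · exact hk.congr hE
  · rintro z (hz | hz)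
    · rw [piecewise_eq_of_mem _ _ _ hz]; exact eh z hz
    · rw [hE hz]; exact ek z hz

lemma Lg.glue {f : ℂ → ℂ} {K L : Set ℂ} {c : ℂ} (hK : IsClosed K) (hL : IsClosed L)
    (h1 : Lg f K) (h2 : Lg f L) (hc : K ∩ L ⊆ {c}) : Lg f (K ∪ L) := by
  obtain ⟨h, hh, eh⟩ := h1
  obtain ⟨k, hk, ek⟩ := h2
  by_cases hcc : c ∈ K ∩ L
  · obtain ⟨n, hn⟩ := exp_eq_imp ((eh c hcc.1).symm.trans (ek c hcc.2))
    refine glue_aux (k := fun z => k z + n * (2 * Real.pi * I)) hK hL hh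
      (hk.add continuousOn_const) eh (fun z hz => by rw [exp_shift, ek z hz]) ?_
    intro z hz
    rw [hc hz]; exact hn.symm
  · refine glue_aux hK hL hh hk eh ek ?_
    intro z hz
    exact absurd (hc hz ▸ hz) hcc

/-- The mismatch of logarithms at a pair of points. -/
def Mis (f : ℂ → ℂ) (K L : Set ℂ) (a b : ℂ) (n : ℤ) : Prop :=
  ∃ h k : ℂ → ℂ, ContinuousOn h K ∧ ContinuousOn k L ∧ (∀ z ∈ K, f z = exp (h z)) ∧
    (∀ z ∈ L, f z = exp (k z)) ∧ k a = h a ∧ k b = h b + n * (2 * Real.pi * I)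

lemma Mis.exists {f : ℂ → ℂ} {K L : Set ℂ} {a b : ℂ} (h1 : Lg f K) (h2 : Lg f L)
    (ha : a ∈ K ∩ L) (hb : b ∈ K ∩ L) : ∃ n, Mis f K L a b n := by
  obtain ⟨h, hh, eh⟩ := h1
  obtain ⟨k, hk, ek⟩ := h2
  obtain ⟨n, hn⟩ := exp_eq_imp ((eh a ha.1).symm.trans (ek a ha.2))
  obtain ⟨m, hm⟩ := exp_eq_imp ((ek b hb.2).symm.trans (eh b hb.1))
  refine ⟨m + n, h, fun z => k z + n * (2 * Real.pi * I), hh, hk.add continuousOn_const, eh,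
    fun z hz => by rw [exp_shift, ek z hz], hn.symm, ?_⟩
  simp only [hm]; push_cast; ring

lemma Mis.comb {f g : ℂ → ℂ} {K L : Set ℂ} {a b : ℂ} {n m : ℤ} (hK : IsClosed K)
    (hL : IsClosed L) (hf : Mis f K L a b n) (hg : Mis g K L a b m) (hKL : K ∩ L ⊆ {a, b})
    (α β : ℤ) (h0 : α * n + β * m = 0) : Lg (fun z => f z ^ α * g z ^ β) (K ∪ L) := by
  obtain ⟨h, k, hh, hk, eh, ek, ha, hb⟩ := hf
  obtain ⟨h', k', hh', hk', eh', ek', ha', hb'⟩ := hg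
  refine glue_aux (h := fun z => α * h z + β * h' z) (k := fun z => α * k z + β * k' z) hK hL
    ((continuousOn_const.mul hh).add (continuousOn_const.mul hh'))
    ((continuousOn_const.mul hk).add (continuousOn_const.mul hk')) ?_ ?_ ?_
  · intro z hz
    rw [exp_add, exp_int_mul, exp_int_mul, eh z hz, eh' z hz]
  · intro z hz
    rw [exp_add, exp_int_mul, exp_int_mul, ek z hz, ek' z hz]
  · intro z hz
    rcases hKL hz with rfl | rfl
    · rw [ha, ha']
    · rw [hb, hb']
      have : (α : ℂ) * n + β * m = 0 := by exact_mod_cast h0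
      linear_combination (2 * Real.pi * I) * this

/-- Descending a function along a continuous surjection from a compact space. -/
lemma descend {X : Type*} [TopologicalSpace X] [CompactSpace X] (φ : X → ℂ) (hφ : Continuous φ)
    (H : X → ℂ) (hH : Continuous H) (hc : ∀ x y, φ x = φ y → H x = H y) :
    ∃ h : ℂ → ℂ, ContinuousOn h (range φ) ∧ ∀ x, h (φ x) = H x := by
  classical
  have hq : IsQuotientMap (rangeFactorization φ) := by
    apply IsClosedMap.isQuotientMap
    · exact (hφ.rangeFactorization).isClosedMap
    · exact hφ.rangeFactorization
    · exact rangeFactorization_surjective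
  let g : range φ → ℂ := fun z => H z.2.choose
  have hg : ∀ x, g (rangeFactorization φ x) = H x := fun x =>
    hc _ _ (rangeFactorization φ x).2.choose_spec
  have hgc : Continuous g := by
    rw [hq.continuous_iff]
    convert hH using 1
    ext x; exact hg x
  refine ⟨fun z => if hz : z ∈ range φ then g ⟨z, hz⟩ else 0, ?_, ?_⟩
  · rw [continuousOn_iff_continuous_domRestrict]
    convert hgc using 1
    ext z
    simp only [domRestrict_apply, z.2, dite_true]
  · intro x
    simp only [mem_range_self, dite_true]
    exact hg x

/-- Logarithms on arcs. -/
lemma Lg.arc {γ : unitInterval → ℂ} (hγ : Continuous γ) (hi : Function.Injective γ) {f : ℂ → ℂ}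
    (hf : ContinuousOn f (range γ)) (h0 : ∀ z ∈ range γ, f z ≠ 0) : Lg f (range γ) := by
  have hc : Continuous (fun t => f (γ t)) := hf.comp_continuous hγ (fun t => mem_range_self t)
  have : SimplyConnectedSpace unitInterval := by
    have : ContractibleSpace unitInterval :=
      (convex_Icc (0 : ℝ) 1).contractibleSpace ⟨0, by simp⟩
    infer_instance
  have : LocallyPathConnectedSpace unitInterval :=
    (convex_Icc (0 : ℝ) 1).locallyPathConnectedSpace
  obtain ⟨g, hg, hg2⟩ := exists_log (fun t => f (γ t)) hc (fun t => h0 _ (mem_range_self t))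
  obtain ⟨h, hh, hh2⟩ := descend γ hγ g hg (fun x y hxy => by rw [hi hxy])
  refine ⟨h, hh, ?_⟩
  rintro _ ⟨t, rfl⟩
  rw [hh2, hg2]

/-- The class of a nonvanishing function on a circle. -/
lemma Lg.circle {c : ℂ} {r : ℝ} (hr : 0 < r) {f : ℂ → ℂ}
    (hf : ContinuousOn f (Metric.sphere c r)) (h0 : ∀ z ∈ Metric.sphere c r, f z ≠ 0) :
    ∃ n : ℤ, Lg (fun z => f z * (z - c) ^ n) (Metric.sphere c r) := by
  have hmem : ∀ θ, circleMap c r θ ∈ Metric.sphere c r := fun θ => circleMap_mem_sphere c hr.le θ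
  obtain ⟨g, hg, hg2⟩ := exists_log (fun θ : ℝ => f (circleMap c r θ))
    (hf.comp_continuous (continuous_circleMap c r) hmem) (fun θ => h0 _ (hmem θ))
  have hper : exp (g 0) = exp (g (2 * Real.pi)) := by
    rw [← hg2, ← hg2]
    congr 1
    simpa using ((periodic_circleMap c r) 0).symm
  obtain ⟨n, hn⟩ := exp_eq_imp hper
  let φ : Icc (0 : ℝ) (2 * Real.pi) → ℂ := fun t => circleMap c r t
  have hφ : Continuous φ := (continuous_circleMap c r).comp continuous_subtype_val
  have hran : range φ = Metric.sphere c r := by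
    apply Subset.antisymm
    · rintro _ ⟨t, rfl⟩; exact hmem _
    · intro z hz
      have : z ∈ circleMap c r '' Ioc 0 (2 * Real.pi) := by
        rw [image_circleMap_Ioc, abs_of_pos hr]; exact hz
      obtain ⟨t, ht, rfl⟩ := this
      exact ⟨⟨t, ht.1.le, ht.2⟩, rfl⟩
  have hinj : ∀ x y : Icc (0 : ℝ) (2 * Real.pi), φ x = φ y →
      g x + n * (x * I) = g y + n * (y * I) := by
    have key : ∀ x y : Icc (0 : ℝ) (2 * Real.pi), (x : ℝ) < y → φ x = φ y →
      g x + n * (x * I) = g y + n * (y * I) := by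
      rintro ⟨x, hx⟩ ⟨y, hy⟩ hlt hxy
      simp only [φ] at hxy hlt ⊢
      have h1 : x = 0 ∧ y = 2 * Real.pi := by
        rw [circleMap_eq_circleMap_iff _ hr.ne'] at hxy
        obtain ⟨k, hk⟩ := hxy
        have hk' : x = y + k * (2 * Real.pi) := by
          have : (x : ℂ) * I = ((y + k * (2 * Real.pi) : ℝ) : ℂ) * I := by
            rw [hk]; push_cast; ring
          exact_mod_cast mul_right_cancel₀ I_ne_zero this
        have hp := Real.pi_pos
        have hk1 : k < 0 := by
          by_contra hcon
          push Not at hcon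
          have : (0 : ℝ) ≤ k := by exact_mod_cast hcon
          nlinarith
        have hk2 : (-1 : ℝ) ≥ k := by
          have : k ≤ -1 := by omega
          exact_mod_cast this
        constructor <;> nlinarith [hx.1, hx.2, hy.1, hy.2]
      obtain ⟨rfl, rfl⟩ := h1
      rw [hn]; push_cast; ring
    intro x y hxy
    rcases lt_trichotomy (x : ℝ) y with h | h | h
    · exact key x y h hxy
    · rw [h]
    · exact (key y x h hxy.symm).symm
  obtain ⟨h, hh, hh2⟩ := descend φ hφ (fun t => g t + n * (t * I)) (by fun_prop) hinj
  refine ⟨n, fun z => h z + n * log r, ?_, ?_⟩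
  · rw [← hran]; exact hh.add continuousOn_const
  · rw [← hran]
    rintro _ ⟨t, rfl⟩
    simp only [hh2]
    have e1 : φ t - c = exp (log r + t * I) := by
      rw [exp_add, exp_log (by exact_mod_cast hr.ne')]
      simp [φ, circleMap]
    rw [e1, ← exp_int_mul, show f (φ t) = exp (g t) from hg2 t, ← exp_add]
    congr 1; ring

/-- Nontrivial powers of `z` have no logarithm on a circle. -/
lemma not_Lg_zpow {r : ℝ} (hr : 0 < r) {n : ℤ} (h : Lg (fun z => z ^ n) (Metric.sphere 0 r)) :
    n = 0 := by
  obtain ⟨g, hg, hg2⟩ := h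
  have hmem : ∀ θ, circleMap 0 r θ ∈ Metric.sphere (0 : ℂ) r :=
    fun θ => circleMap_mem_sphere 0 hr.le θ
  have hc : Continuous (fun θ : ℝ => g (circleMap 0 r θ) - n * (θ * I)) :=
    (hg.comp_continuous (continuous_circleMap 0 r) hmem).sub (by fun_prop)
  have hval : ∀ θ : ℝ, exp (g (circleMap 0 r θ) - n * (θ * I)) = (r : ℂ) ^ n := by
    intro θ
    rw [exp_sub, ← hg2 _ (hmem θ), exp_int_mul]
    beta_reduce
    rw [circleMap_zero, mul_zpow, mul_div_assoc, div_self, mul_one]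
    exact zpow_ne_zero _ (exp_ne_zero _)
  have := const_of_exp isPreconnected_univ hc.continuousOn
    (fun x _ y _ => by rw [hval x, hval y]) (mem_univ (0 : ℝ)) (mem_univ (2 * Real.pi))
  have hp : circleMap 0 r (2 * Real.pi) = circleMap 0 r 0 := by
    simpa using ((periodic_circleMap 0 r) 0)
  rw [hp] at this
  have h2 : (n : ℂ) * (2 * Real.pi * I) = 0 := by
    push_cast at this
    linear_combination this
  rcases mul_eq_zero.1 h2 with h3 | h3
  · exact_mod_cast h3
  · exact absurd h3 two_pi_I_ne_zero

end PF

namespace PF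
open Complex

/-- The component of the complement of `K` containing `p`. -/
def fc (K : Set ℂ) (p : ℂ) : Set ℂ := connectedComponentIn Kᶜ p

lemma fc_mem {K : Set ℂ} {p : ℂ} (hp : p ∉ K) : p ∈ fc K p := mem_connectedComponentIn hp

lemma fc_sub (K : Set ℂ) (p : ℂ) : fc K p ⊆ Kᶜ := connectedComponentIn_subset _ _

lemma fc_eq {K : Set ℂ} {p q : ℂ} (h : q ∈ fc K p) : fc K q = fc K p :=
  (connectedComponentIn_eq h).symm

lemma fc_open {K : Set ℂ} (hK : IsClosed K) (p : ℂ) : IsOpen (fc K p) :=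
  hK.isOpen_compl.connectedComponentIn

lemma fc_conn (K : Set ℂ) (p : ℂ) : IsPreconnected (fc K p) := isPreconnected_connectedComponentIn

lemma fc_max {K S : Set ℂ} {p : ℂ} (hS : IsPreconnected S) (hp : p ∈ S) (hSK : S ⊆ Kᶜ) :
    S ⊆ fc K p := hS.subset_connectedComponentIn hp hSK

lemma fc_frontier {K : Set ℂ} (hK : IsClosed K) (p : ℂ) : frontier (fc K p) ⊆ K := by
  intro z hz
  by_contra hzK
  have h1 : fc K z ∈ 𝓝 z := (fc_open hK z).mem_nhds (fc_mem hzK)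
  obtain ⟨w, hw1, hw2⟩ := mem_closure_iff_nhds.1 hz.1 _ h1
  have : fc K z = fc K p := (fc_eq hw1).symm.trans (fc_eq hw2)
  apply hz.2
  rw [(fc_open hK p).interior_eq, ← this]
  exact fc_mem hzK

/-- Tietze extension for complex valued functions. -/
lemma tietze {K : Set ℂ} (hK : IsClosed K) {f : ℂ → ℂ} (hf : ContinuousOn f K) :
    ∃ g : ℂ → ℂ, Continuous g ∧ ∀ z ∈ K, g z = f z := by
  obtain ⟨g, hg⟩ := ContinuousMap.exists_restrict_eq hK ⟨K.domRestrict f, hf.domRestrict⟩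
  refine ⟨g, g.continuous, fun z hz => ?_⟩
  exact congrArg (fun φ : C(K, ℂ) => φ ⟨z, hz⟩) hg

lemma Lg.near {K : Set ℂ} {p q : ℂ} {ε : ℝ} (hb : Metric.ball p ε ⊆ Kᶜ)
    (hq : q ∈ Metric.ball p ε) : Lg (fun z => (z - q) / (z - p)) K := by
  have hε : 0 < ε := Metric.pos_of_mem_ball hq
  have hd : ∀ z ∈ K, ε ≤ ‖z - p‖ := by
    intro z hz
    by_contra hlt
    push Not at hlt
    exact hb (by simpa [dist_eq_norm] using hlt) hz
  have hne : ∀ z ∈ K, z - p ≠ 0 := fun z hz h => by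
    have := hd z hz
    rw [h, norm_zero] at this; linarith
  apply Lg.near_one
  · exact ContinuousOn.div (by fun_prop) (by fun_prop) hne
  · intro z hz
    have : (z - q) / (z - p) - 1 = (p - q) / (z - p) := by
      field_simp [hne z hz]; ring
    rw [this, norm_div, div_lt_one (lt_of_lt_of_le hε (hd z hz))]
    have h1 : ‖p - q‖ < ε := by simpa [dist_eq_norm, norm_sub_rev] using hq
    linarith [hd z hz]

lemma Lg.same {K : Set ℂ} (hK : IsClosed K) {p q : ℂ} (hp : p ∉ K) (hq : q ∈ fc K p) :
    Lg (fun z => (z - q) / (z - p)) K := by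
  refine (fc_conn K p).induction₂ (fun p q => Lg (fun z => (z - q) / (z - p)) K) ?_ ?_ ?_
    (fc_mem hp) hq
  · intro x hx
    obtain ⟨ε, hε, hb⟩ := Metric.isOpen_iff.1 hK.isOpen_compl x (fc_sub K p hx)
    apply mem_nhdsWithin_of_mem_nhds
    filter_upwards [Metric.ball_mem_nhds x hε] with y hy
    exact Lg.near hb hy
  · intro x y z hx hy hz h1 h2
    refine (h1.mul h2).congr (fun w hw => ?_)
    have hy' : w - y ≠ 0 := sub_ne_zero.2 (fun h => fc_sub K p hy (h ▸ hw))
    have hx' : w - x ≠ 0 := sub_ne_zero.2 (fun h => fc_sub K p hx (h ▸ hw))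
    field_simp
  · intro x y hx hy h
    exact h.inv.congr (fun w _ => by rw [inv_div])

lemma Lg.far {K : Set ℂ} {M : ℝ} (hM : ∀ z ∈ K, ‖z‖ ≤ M) {q : ℂ} (hq : M < ‖q‖) (hq0 : q ≠ 0) :
    Lg (fun z => z - q) K := by
  have : Lg (fun z => 1 - z / q) K := by
    apply Lg.near_one (by fun_prop)
    intro z hz
    have : (1 - z / q) - 1 = - (z / q) := by ring
    rw [this, norm_neg, norm_div, div_lt_one (norm_pos_iff.2 hq0)]
    exact lt_of_le_of_lt (hM z hz) hq
  refine ((Lg.const (neg_ne_zero.2 hq0)).mul this).congr (fun z _ => ?_)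
  field_simp; ring

lemma Lg.unbdd {K : Set ℂ} (hK : IsCompact K) {p : ℂ} (hp : p ∉ K)
    (hb : ¬ Bornology.IsBounded (fc K p)) : Lg (fun z => z - p) K := by
  obtain ⟨M, hM⟩ := hK.isBounded.exists_norm_le
  have : ∃ q ∈ fc K p, max M 0 < ‖q‖ := by
    by_contra hcon
    push Not at hcon
    exact hb (isBounded_iff_forall_norm_le.2 ⟨_, hcon⟩)
  obtain ⟨q, hq, hq2⟩ := this
  have h1 := Lg.far hM (lt_of_le_of_lt (le_max_left _ _) hq2)
    (norm_pos_iff.1 (lt_of_le_of_lt (le_max_right _ _) hq2))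
  refine ((Lg.same hK.isClosed hp hq).inv.mul h1).congr (fun z hz => ?_)
  have h2 : z - q ≠ 0 := sub_ne_zero.2 (fun h => fc_sub K p hq (h ▸ hz))
  field_simp

lemma prod_zpow_sum {z : ℂ} (h : z ≠ 0) (s : Finset ℂ) (n : ℂ → ℤ) :
    ∏ p ∈ s, z ^ n p = z ^ (∑ p ∈ s, n p) := by
  classical
  induction s using Finset.induction_on with
  | empty => simp
  | insert a s ha ih => rw [Finset.prod_insert ha, Finset.sum_insert ha, zpow_add₀ h, ih]

/-- Rational functions. -/
noncomputable def R (s : Finset ℂ) (n : ℂ → ℤ) (z : ℂ) : ℂ := ∏ p ∈ s, (z - p) ^ n p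

lemma R_ne_zero {s : Finset ℂ} {n : ℂ → ℤ} {z : ℂ} (h : z ∉ s) : R s n z ≠ 0 := by
  rw [R, Finset.prod_ne_zero_iff]
  intro p hp
  exact zpow_ne_zero _ (sub_ne_zero.2 (fun e => h (e ▸ hp)))

lemma R_cont {s : Finset ℂ} {n : ℂ → ℤ} {K : Set ℂ} (h : ∀ p ∈ s, p ∉ K) :
    ContinuousOn (R s n) K := by
  apply continuousOn_finsetProd
  intro p hp
  apply ContinuousOn.zpow₀ (by fun_prop)
  intro z hz
  exact Or.inl (sub_ne_zero.2 (fun e => h p hp (e ▸ hz)))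

open Classical in
lemma R_split (s : Finset ℂ) (n : ℂ → ℤ) (P : ℂ → Prop) (z : ℂ) :
    R s n z = R (s.filter P) n z * R (s.filter (fun p => ¬ P p)) n z :=
  (Finset.prod_filter_mul_prod_filter_not s P _).symm

open Classical in
/-- Functions with a logarithm have degree zero on each bounded component. -/
theorem deg_zero {K : Set ℂ} (hK : IsCompact K) {s : Finset ℂ} {n : ℂ → ℤ}
    (hs : ∀ p ∈ s, p ∉ K) (hL : Lg (R s n) K) {p0 : ℂ}
    (hb : Bornology.IsBounded (fc K p0)) : ∑ p ∈ s.filter (· ∈ fc K p0), n p = 0 := by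
  set Ω := fc K p0 with hΩ
  obtain ⟨g, hg, hg2⟩ := hL
  obtain ⟨g', hg', hgg⟩ := tietze hK.isClosed hg
  set s1 := s.filter (· ∈ Ω) with hs1
  set s2 := s.filter (fun p => ¬ p ∈ Ω) with hs2
  have hop : IsOpen Ω := fc_open hK.isClosed p0
  have hs2c : ∀ p ∈ s2, p ∉ closure Ω := by
    intro p hp hpc
    have hp' := Finset.mem_filter.1 hp
    refine hs p hp'.1 (fc_frontier hK.isClosed p0 ⟨hpc, ?_⟩)
    rw [hop.interior_eq]; exact hp'.2
  let F : ℂ → ℂ := fun z => if z ∈ Ω then exp (g' z) / R s2 n z else R s1 n z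
  have hF1 : EqOn F (fun z => exp (g' z) / R s2 n z) (closure Ω) := by
    intro z hz
    by_cases hzΩ : z ∈ Ω
    · simp [F, hzΩ]
    · have hzK : z ∈ K := fc_frontier hK.isClosed p0 ⟨hz, by rwa [hop.interior_eq]⟩
      have h0 : R s2 n z ≠ 0 := R_ne_zero (fun h => hs2c z h hz)
      simp only [F, hzΩ, if_false]
      rw [hgg z hzK, ← hg2 z hzK, R_split s n (· ∈ Ω) z, mul_div_assoc, div_self h0, mul_one]
  have hF2 : EqOn F (R s1 n) Ωᶜ := by
    intro z hz
    have : z ∉ Ω := hz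
    simp [F, this]
  have hs1c : ∀ p ∈ s1, p ∉ Ωᶜ := fun p hp h => h (Finset.mem_filter.1 hp).2
  have hFc : Continuous F := by
    rw [← continuousOn_univ, ← show closure Ω ∪ Ωᶜ = univ from
      eq_univ_of_forall (fun z => (Classical.em (z ∈ Ω)).imp (fun h => subset_closure h) id)]
    apply ContinuousOn.union_of_isClosed _ _ isClosed_closure hop.isClosed_compl
    · refine ContinuousOn.congr ?_ hF1
      apply ContinuousOn.div (by fun_prop) (R_cont hs2c)
      intro z hz
      exact R_ne_zero (fun h => hs2c z h hz)
    · exact (R_cont hs1c).congr hF2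
  have hF0 : ∀ z, F z ≠ 0 := by
    intro z
    by_cases hz : z ∈ Ω
    · rw [hF1 (subset_closure hz)]
      exact div_ne_zero (exp_ne_zero _) (R_ne_zero (fun h => hs2c z h (subset_closure hz)))
    · rw [hF2 hz]
      exact R_ne_zero (fun h => hs1c z h hz)
  obtain ⟨M, hM⟩ := hb.exists_norm_le
  set r := max M 0 + 1 with hr
  have hr0 : 0 < r := by positivity
  have hMr : M < r := by have := le_max_left M 0; linarith
  have hLs : Lg (R s1 n) (Metric.sphere 0 r) := by
    refine (Lg.of_global hFc hF0 _).congr (fun z hz => hF2 ?_)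
    intro hzΩ
    have h1 := hM z hzΩ
    have h2 : ‖z‖ = r := by simpa using hz
    linarith
  have hnz : ∀ z ∈ Metric.sphere (0 : ℂ) r, z ≠ 0 := by
    intro z hz h0
    have h2 : ‖z‖ = r := by simpa using hz
    rw [h0, norm_zero] at h2; linarith
  have hq : ∀ p ∈ s1, Lg (fun z => ((z - p) / z) ^ (- n p)) (Metric.sphere 0 r) := by
    intro p hp
    apply Lg.zpow
    have hpΩ := (Finset.mem_filter.1 hp).2
    apply Lg.near_one
    · exact ContinuousOn.div (by fun_prop) (by fun_prop) hnz
    · intro z hz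
      have h0 := hnz z hz
      have h2 : ‖z‖ = r := by simpa using hz
      have : (z - p) / z - 1 = - (p / z) := by field_simp; ring
      rw [this, norm_neg, norm_div, h2, div_lt_one hr0]
      linarith [hM p hpΩ]
  have hz : Lg (fun z => z ^ (∑ p ∈ s1, n p)) (Metric.sphere 0 r) := by
    refine (hLs.mul (Lg.prod s1 _ hq)).congr (fun z hz => ?_)
    have h0 := hnz z hz
    rw [R, ← Finset.prod_mul_distrib, ← prod_zpow_sum h0]
    apply Finset.prod_congr rfl
    intro p hp
    have hpz : z - p ≠ 0 := by
      intro h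
      have : z = p := sub_eq_zero.1 h
      have h1 := hM p (Finset.mem_filter.1 hp).2
      have h2 : ‖z‖ = r := by simpa using hz
      rw [this] at h2; linarith
    rw [div_zpow, zpow_neg, zpow_neg]
    have := zpow_ne_zero (n p) hpz
    have := zpow_ne_zero (n p) h0
    field_simp
  exact not_Lg_zpow hr0 hz

open Classical in
/-- The converse: degree zero on every bounded component gives a logarithm. -/
theorem Lg_of_deg {K : Set ℂ} (hK : IsCompact K) {s : Finset ℂ} {n : ℂ → ℤ}
    (hs : ∀ p ∈ s, p ∉ K) (hd : ∀ p0 ∈ s, Bornology.IsBounded (fc K p0) →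
      ∑ p ∈ s.filter (· ∈ fc K p0), n p = 0) : Lg (R s n) K := by
  have h1 : ∀ F ∈ s.image (fc K), Lg (fun z => ∏ p ∈ s with fc K p = F, (z - p) ^ n p) K := by
    intro F hF
    obtain ⟨p0, hp0, rfl⟩ := Finset.mem_image.1 hF
    by_cases hb : Bornology.IsBounded (fc K p0)
    · have hsum : ∑ p ∈ s with fc K p = fc K p0, n p = 0 := by
        rw [← hd p0 hp0 hb]
        apply Finset.sum_congr _ (fun _ _ => rfl)
        apply Finset.filter_congr
        intro p hp
        exact ⟨fun h => h ▸ fc_mem (hs p hp), fun h => fc_eq h⟩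
      have := Lg.prod (K := K) {p ∈ s | fc K p = fc K p0} (fun p z => ((z - p) / (z - p0)) ^ n p)
        (fun p hp => by
          have hp' := Finset.mem_filter.1 hp
          exact (Lg.same hK.isClosed (hs p0 hp0) (hp'.2 ▸ fc_mem (hs p hp'.1))).zpow _)
      refine this.congr (fun z hz => ?_)
      have h0 : z - p0 ≠ 0 := sub_ne_zero.2 (fun h => hs p0 hp0 (h ▸ hz))
      simp only [div_zpow]
      rw [Finset.prod_div_distrib, prod_zpow_sum h0, hsum, zpow_zero, div_one]
    · apply Lg.prod
      intro p hp
      have hp' := Finset.mem_filter.1 hp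
      exact (Lg.unbdd hK (hs p hp'.1) (hp'.2 ▸ hb)).zpow _
  refine (Lg.prod (s.image (fc K)) _ h1).congr (fun z _ => ?_)
  rw [R]
  exact Finset.prod_fiberwise_of_maps_to (fun p hp => Finset.mem_image_of_mem _ hp) _

end PF

namespace PF
open Complex

lemma Lg.ball {f : ℂ → ℂ} {M : ℝ} (hM : 0 < M) (hf : ContinuousOn f (Metric.ball 0 M))
    (h0 : ∀ z ∈ Metric.ball (0 : ℂ) M, f z ≠ 0) : Lg f (Metric.ball 0 M) := by
  classical
  have hcv := convex_ball (0 : ℂ) M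
  have : ContractibleSpace (Metric.ball (0 : ℂ) M) :=
    hcv.contractibleSpace ⟨0, Metric.mem_ball_self hM⟩
  have : LocallyPathConnectedSpace (Metric.ball (0 : ℂ) M) := hcv.locallyPathConnectedSpace
  obtain ⟨g, hg, hg2⟩ := exists_log ((Metric.ball (0 : ℂ) M).domRestrict f) hf.domRestrict
    (fun z => h0 z z.2)
  refine ⟨fun z => if hz : z ∈ Metric.ball (0 : ℂ) M then g ⟨z, hz⟩ else 0, ?_, ?_⟩
  · rw [continuousOn_iff_continuous_domRestrict]
    convert hg using 1
    ext z
    simp only [domRestrict_apply, z.2, dite_true]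
  · intro z hz
    simp only [hz, dite_true]
    exact hg2 ⟨z, hz⟩

lemma gen_ind {K : Set ℂ} {M : ℝ} (hM : 0 < M) (hK : IsClosed K) (hKM : K ⊆ Metric.ball 0 M)
    (Z : Finset ℂ) : ∀ Q : ℂ → ℂ, Continuous Q →
    (∀ z ∈ Metric.ball (0 : ℂ) M, Q z = 0 → z ∈ Z) → (∀ z ∈ Z, z ∉ K ∧ z ∈ Metric.ball (0 : ℂ) M) →
    ∃ s n, s ⊆ Z ∧ Lg (fun z => Q z * R s n z) K := by
  classical
  induction Z using Finset.induction_on with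
  | empty =>
    intro Q hQ h1 _
    refine ⟨∅, 0, Finset.Subset.refl _, ?_⟩
    have := (Lg.ball hM hQ.continuousOn (fun z hz h => by simpa using h1 z hz h)).mono hKM
    exact this.congr (fun z _ => by simp [R])
  | insert a Z haZ ih =>
    intro Q hQ h1 h2
    obtain ⟨haK, haM⟩ := h2 a (by simp)
    have hO : IsOpen (Kᶜ ∩ Metric.ball 0 M ∩ (Z : Set ℂ)ᶜ) :=
      (hK.isOpen_compl.inter Metric.isOpen_ball).inter Z.finite_toSet.isClosed.isOpen_compl
    obtain ⟨r, hr, hrs⟩ := Metric.nhds_basis_closedBall.mem_iff.1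
      (hO.mem_nhds (show a ∈ Kᶜ ∩ Metric.ball 0 M ∩ (Z : Set ℂ)ᶜ from
        ⟨⟨haK, haM⟩, by simpa using haZ⟩))
    have hsb : Metric.sphere a r ⊆ Metric.closedBall a r := Metric.sphere_subset_closedBall
    have hsne : ∀ z ∈ Metric.sphere a r, z ≠ a := by
      rintro z hz rfl
      simp at hz; linarith
    have hQs : ∀ z ∈ Metric.sphere a r, Q z ≠ 0 := by
      intro z hz h0
      have h3 := hrs (hsb hz)
      rcases Finset.mem_insert.1 (h1 z h3.1.2 h0) with h | h
      · exact hsne z hz h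
      · exact h3.2 h
    obtain ⟨m, k, hk, hk2⟩ := Lg.circle hr hQ.continuousOn hQs
    obtain ⟨k', hk', hkk⟩ := tietze Metric.isClosed_sphere hk
    let Q' : ℂ → ℂ := fun z => if z ∈ Metric.ball a r then exp (k' z) else Q z * (z - a) ^ m
    have hE1 : EqOn Q' (fun z => exp (k' z)) (Metric.closedBall a r) := by
      intro z hz
      by_cases hzb : z ∈ Metric.ball a r
      · simp only [Q', hzb, if_true]
      · simp only [Q', hzb, if_false]
        have hzs : z ∈ Metric.sphere a r := by
          rw [Metric.mem_sphere]
          exact le_antisymm hz (not_lt.1 hzb)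
        rw [hkk z hzs]; exact hk2 z hzs
    have hE2 : EqOn Q' (fun z => Q z * (z - a) ^ m) (Metric.ball a r)ᶜ := by
      intro z hz
      have hz' : z ∉ Metric.ball a r := hz
      simp only [Q', hz', if_false]
    have hne : ∀ z ∈ (Metric.ball a r)ᶜ, z - a ≠ 0 := by
      intro z hz h
      rw [sub_eq_zero] at h
      exact hz (h ▸ Metric.mem_ball_self hr)
    have hQ'c : Continuous Q' := by
      rw [← continuousOn_univ, ← show Metric.closedBall a r ∪ (Metric.ball a r)ᶜ = univ from
        eq_univ_of_forall (fun z => (Classical.em (z ∈ Metric.ball a r)).imp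
          (fun h => Metric.ball_subset_closedBall h) id)]
      apply ContinuousOn.union_of_isClosed _ _ Metric.isClosed_closedBall
        Metric.isOpen_ball.isClosed_compl
      · exact ContinuousOn.congr (by fun_prop) hE1
      · refine ContinuousOn.congr ?_ hE2
        apply hQ.continuousOn.mul
        exact ContinuousOn.zpow₀ (by fun_prop) m (fun z hz => Or.inl (hne z hz))
    obtain ⟨s, n, hsZ, hL⟩ := ih Q' hQ'c (by
        intro z hz h0
        by_cases hzb : z ∈ Metric.ball a r
        · rw [hE1 (Metric.ball_subset_closedBall hzb)] at h0
          exact absurd h0 (exp_ne_zero _)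
        · rw [hE2 hzb] at h0
          rcases mul_eq_zero.1 h0 with h | h
          · rcases Finset.mem_insert.1 (h1 z hz h) with h | h
            · exact absurd (h ▸ Metric.mem_ball_self hr) hzb
            · exact h
          · exact absurd h (zpow_ne_zero _ (hne z hzb)))
      (fun z hz => h2 z (by simp [hz]))
    have has : a ∉ s := fun h => haZ (hsZ h)
    refine ⟨insert a s, Function.update n a m, Finset.insert_subset_insert a hsZ, ?_⟩
    refine hL.congr (fun z hz => ?_)
    have hzb : z ∈ (Metric.ball a r)ᶜ := fun h =>
      (hrs (Metric.ball_subset_closedBall h)).1.1 hz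
    rw [hE2 hzb]
    simp only [R]
    rw [Finset.prod_insert has, Function.update_self, mul_assoc]
    congr 2
    apply Finset.prod_congr rfl
    intro p hp
    have hpa : p ≠ a := fun h => has (h ▸ hp)
    rw [Function.update_of_ne hpa]

/-- A smooth map has small regular values. -/
lemma sard {P : ℂ → ℂ} (hP : ContDiff ℝ 1 P) {δ : ℝ} (hδ : 0 < δ) :
    ∃ w : ℂ, ‖w‖ < δ ∧ ∀ z, P z = w → ∀ᶠ y in 𝓝[≠] z, P y ≠ w := by
  have hd : Differentiable ℝ P := hP.differentiable one_ne_zero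
  have h0 : MeasureTheory.volume (P '' {z | (fderiv ℝ P z).det = 0}) = 0 :=
    MeasureTheory.addHaar_image_eq_zero_of_det_fderivWithin_eq_zero _
      (fun x _ => (hd x).hasFDerivAt.hasFDerivWithinAt) (fun x hx => hx)
  have h1 : ∃ w ∈ Metric.ball (0 : ℂ) δ, w ∉ P '' {z | (fderiv ℝ P z).det = 0} := by
    by_contra hcon
    push Not at hcon
    have : MeasureTheory.volume (Metric.ball (0 : ℂ) δ) = 0 :=
      MeasureTheory.measure_mono_null hcon h0
    exact absurd this (Metric.measure_ball_pos _ _ hδ).ne'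
  obtain ⟨w, hw, hw2⟩ := h1
  refine ⟨w, by simpa using hw, fun z hz => ?_⟩
  apply (hd z).hasFDerivAt.eventually_ne
  have hdet : (fderiv ℝ P z).det ≠ 0 := fun h => hw2 ⟨z, h, hz⟩
  have hker : LinearMap.ker ((fderiv ℝ P z : ℂ →L[ℝ] ℂ) : ℂ →ₗ[ℝ] ℂ) = ⊥ := by
    by_contra hb
    exact hdet (LinearMap.det_eq_zero_iff_ker_ne_bot.2 hb)
  obtain ⟨C, _, hC⟩ := LinearMap.exists_antilipschitzWith _ hker
  exact ⟨C, hC⟩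

/-- Every nonvanishing function on a compact set is rational up to a logarithm. -/
theorem gen {K : Set ℂ} (hK : IsCompact K) {f : ℂ → ℂ} (hf : ContinuousOn f K)
    (h0 : ∀ z ∈ K, f z ≠ 0) :
    ∃ s n, (∀ p ∈ s, p ∉ K) ∧ Lg (fun z => f z * R s n z) K := by
  rcases K.eq_empty_or_nonempty with rfl | hne
  · exact ⟨∅, 0, by simp, fun _ => 0, by simp, by simp⟩
  obtain ⟨f', hf', hff⟩ := tietze hK.isClosed hf
  obtain ⟨δ, hδ, hδK⟩ : ∃ δ > 0, ∀ z ∈ K, δ ≤ ‖f z‖ := by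
    obtain ⟨x, hx, hmin⟩ := hK.exists_isMinOn hne hf.norm
    exact ⟨‖f x‖, norm_pos_iff.2 (h0 x hx), fun z hz => hmin hz⟩
  obtain ⟨P, hP, hPf, _⟩ := hf'.exists_contDiff_approx 1 (ε := fun _ => δ / 2) continuous_const
    (fun _ => by linarith)
  obtain ⟨w, hw, hw2⟩ := sard hP (δ := δ / 2) (by linarith)
  obtain ⟨M, hM⟩ := hK.isBounded.exists_norm_le
  set M' := max M 0 + 1
  have hM0 : 0 < M' := by positivity
  have hKM : K ⊆ Metric.ball 0 M' := by
    intro z hz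
    have h1 := hM z hz
    have h2 := le_max_left M 0
    rw [mem_ball_zero_iff]; simp only [M']; linarith
  have hPc := hP.continuous
  have hclose : ∀ z ∈ K, ‖(P z - w) - f z‖ < ‖f z‖ := by
    intro z hz
    have h1 := hPf z
    rw [dist_eq_norm, hff z hz] at h1
    calc ‖(P z - w) - f z‖ = ‖(P z - f z) - w‖ := by ring_nf
      _ ≤ ‖P z - f z‖ + ‖w‖ := norm_sub_le _ _
      _ < δ := by linarith
      _ ≤ _ := hδK z hz
  have hfin : {z ∈ Metric.closedBall (0 : ℂ) M' | P z = w}.Finite := by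
    by_contra hinf
    obtain ⟨x, hx, hacc⟩ := Set.Infinite.exists_accPt_of_subset_isCompact hinf
      (isCompact_closedBall (0 : ℂ) M') (sep_subset _ _)
    rw [accPt_iff_frequently_nhdsNE] at hacc
    have hxw : P x = w := by
      by_contra hne
      have : ∀ᶠ y in 𝓝[≠] x, P y ≠ w :=
        (hPc.continuousAt.eventually_ne hne).filter_mono nhdsWithin_le_nhds
      exact hacc (this.mono (fun y hy h => hy h.2))
    exact hacc ((hw2 x hxw).mono (fun y hy h => hy h.2))
  have hfin2 : {z ∈ Metric.ball (0 : ℂ) M' | P z = w}.Finite :=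
    hfin.subset (fun z hz => ⟨Metric.ball_subset_closedBall hz.1, hz.2⟩)
  have hZK : ∀ z ∈ hfin2.toFinset, z ∉ K ∧ z ∈ Metric.ball (0 : ℂ) M' := by
    intro z hz
    have hz' := hfin2.mem_toFinset.1 hz
    refine ⟨fun hzK => ?_, hz'.1⟩
    have := hclose z hzK
    rw [hz'.2, sub_self, zero_sub, norm_neg] at this
    exact lt_irrefl _ this
  obtain ⟨s, n, hs, hL⟩ := gen_ind hM0 hK.isClosed hKM hfin2.toFinset (fun z => P z - w)
    (by fun_prop) (fun z hz h => hfin2.mem_toFinset.2 ⟨hz, sub_eq_zero.1 h⟩) hZK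
  refine ⟨s, n, fun p hp => (hZK p (hs hp)).1, ?_⟩
  have h1 : Lg (fun z => (P z - w) / f z) K := by
    apply Lg.near_one
    · exact ContinuousOn.div (by fun_prop) hf h0
    · intro z hz
      have hz0 := h0 z hz
      have : (P z - w) / f z - 1 = ((P z - w) - f z) / f z := by field_simp
      rw [this, norm_div, div_lt_one (norm_pos_iff.2 hz0)]
      exact hclose z hz
  refine (h1.inv.mul hL).congr (fun z hz => ?_)
  have hz0 := h0 z hz
  have hz1 : P z - w ≠ 0 := by
    intro h
    have := hclose z hz
    rw [h, zero_sub, norm_neg] at this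
    exact lt_irrefl _ this
  field_simp

end PF

namespace PF
open Complex

lemma conn_ext {M : ℝ} (hM : 0 < M) : IsPreconnected {z : ℂ | M < ‖z‖} := by
  have h1 : {z : ℂ | M < ‖z‖} = exp '' {w : ℂ | Real.log M < w.re} := by
    ext z
    simp only [mem_ofPred_eq, mem_image]
    constructor
    · intro hz
      have hz0 : z ≠ 0 := norm_pos_iff.1 (hM.trans hz)
      refine ⟨log z, ?_, exp_log hz0⟩
      rw [log_re]; exact Real.log_lt_log hM hz
    · rintro ⟨w, hw, rfl⟩
      rw [norm_exp, ← Real.exp_log hM]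
      exact Real.exp_lt_exp.2 hw
  rw [h1]
  exact ((convex_halfSpace_re_gt _).isPreconnected).image _ continuous_exp.continuousOn

lemma unbdd_unique {K : Set ℂ} (hK : IsCompact K) {p q : ℂ}
    (hp : ¬ Bornology.IsBounded (fc K p)) (hq : ¬ Bornology.IsBounded (fc K q)) :
    fc K p = fc K q := by
  obtain ⟨M, hM⟩ := hK.isBounded.exists_norm_le
  have key : ∀ p, ¬ Bornology.IsBounded (fc K p) → ∃ q ∈ fc K p, max M 0 + 1 < ‖q‖ := by
    intro p hp
    by_contra hcon
    push Not at hcon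
    exact hp (isBounded_iff_forall_norm_le.2 ⟨_, hcon⟩)
  obtain ⟨p', hp', hp2⟩ := key p hp
  obtain ⟨q', hq', hq2⟩ := key q hq
  rw [← fc_eq hp', ← fc_eq hq']
  refine (fc_eq (fc_max (conn_ext (M := max M 0 + 1) (by positivity)) hq2 ?_ hp2))
  intro z hz hzK
  have h1 := hM z hzK
  have h2 := le_max_left M 0
  have h3 : max M 0 + 1 < ‖z‖ := hz
  linarith

open Classical in
/-- Total degree zero and a logarithm give degree zero on every component. -/
theorem deg_zero' {K : Set ℂ} (hK : IsCompact K) {s : Finset ℂ} {n : ℂ → ℤ}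
    (hs : ∀ p ∈ s, p ∉ K) (hL : Lg (R s n) K) (hsum : ∑ p ∈ s, n p = 0) (p0 : ℂ) :
    ∑ p ∈ s.filter (· ∈ fc K p0), n p = 0 := by
  by_cases hb : Bornology.IsBounded (fc K p0)
  · exact deg_zero hK hs hL hb
  · have h1 : ∑ p ∈ s.filter (fun p => ¬ p ∈ fc K p0), n p = 0 := by
      rw [← Finset.sum_fiberwise_of_maps_to (g := fc K)
        (t := (s.filter (fun p => ¬ p ∈ fc K p0)).image (fc K))
        (fun p hp => Finset.mem_image_of_mem _ hp)]
      apply Finset.sum_eq_zero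
      intro F hF
      obtain ⟨q, hq, rfl⟩ := Finset.mem_image.1 hF
      have hq' := Finset.mem_filter.1 hq
      have hqb : Bornology.IsBounded (fc K q) := by
        by_contra hqb
        exact hq'.2 (unbdd_unique hK hqb hb ▸ fc_mem (hs q hq'.1))
      rw [← deg_zero hK hs hL hqb]
      apply Finset.sum_congr _ (fun _ _ => rfl)
      ext p
      simp only [Finset.mem_filter]
      constructor
      · rintro ⟨⟨h1, h2⟩, h3⟩
        exact ⟨h1, h3 ▸ fc_mem (hs p h1)⟩
      · rintro ⟨h1, h2⟩
        have h3 := fc_eq h2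
        refine ⟨⟨h1, fun h => hq'.2 ?_⟩, h3⟩
        rw [← fc_eq h, h3]
        exact fc_mem (hs q hq'.1)
    have h2 := Finset.sum_filter_add_sum_filter_not s (· ∈ fc K p0) n
    rw [h1, hsum, add_zero] at h2
    exact h2

/-- Logarithms of Möbius maps detect components. -/
theorem same_of_Lg {K : Set ℂ} (hK : IsCompact K) {p q : ℂ} (hp : p ∉ K) (hq : q ∉ K)
    (hL : Lg (fun z => (z - q) / (z - p)) K) : fc K q = fc K p := by
  classical
  by_contra hne
  have hpq : p ≠ q := fun h => hne (by rw [h])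
  let n : ℂ → ℤ := fun x => if x = q then 1 else -1
  have hR : Lg (R {p, q} n) K := by
    refine hL.congr (fun z _ => ?_)
    rw [R, Finset.prod_pair hpq]
    simp only [n, hpq, if_false, if_true, zpow_one, zpow_neg]
    rw [div_eq_mul_inv, mul_comm]
  have := deg_zero' hK (s := {p, q}) (by simp [hp, hq]) hR
    (by rw [Finset.sum_pair hpq]; simp [n, hpq]) q
  have h1 : ({p, q} : Finset ℂ).filter (· ∈ fc K q) = {q} := by
    ext x
    simp only [Finset.mem_filter, Finset.mem_insert, Finset.mem_singleton]
    constructor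
    · rintro ⟨rfl | rfl, h⟩
      · exact absurd (fc_eq h).symm hne
      · rfl
    · rintro rfl
      exact ⟨Or.inr rfl, fc_mem hq⟩
  rw [h1] at this
  simp [n] at this

/-- Adding a point does not disconnect a component. -/
lemma fc_point {K : Set ℂ} (hK : IsCompact K) {p q x : ℂ} (hp : p ∉ K) (hq : q ∈ fc K p)
    (hpx : p ≠ x) (hqx : q ≠ x) : fc (insert x K) q = fc (insert x K) p := by
  have hL := Lg.same hK.isClosed hp hq
  have hqK : q ∉ K := fc_sub K p hq
  have h1 : Lg (fun z => (z - q) / (z - p)) {x} :=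
    ⟨fun _ => log ((x - q) / (x - p)), continuousOn_const, by
      rintro z rfl
      rw [exp_log]
      exact div_ne_zero (sub_ne_zero.2 hqx.symm) (sub_ne_zero.2 hpx.symm)⟩
  have h2 := Lg.glue (c := x) isClosed_singleton hK.isClosed h1 hL inter_subset_left
  rw [singleton_union] at h2
  exact same_of_Lg (hK.insert x) (by simp [hpx, hp]) (by simp [hqx, hqK]) h2

lemma fc_finite {K : Set ℂ} (hK : IsCompact K) {p q : ℂ} (hp : p ∉ K) (hq : q ∈ fc K p)
    {X : Set ℂ} (hX : X.Finite) : p ∉ X → q ∉ X → fc (X ∪ K) q = fc (X ∪ K) p := by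
  induction X, hX using Set.Finite.induction_on with
  | empty => intro _ _; rw [empty_union]; exact fc_eq hq
  | @insert x X hx hX ih =>
    intro h1 h2
    simp only [mem_insert_iff, not_or] at h1 h2
    have h3 := ih h1.2 h2.2
    rw [insert_union]
    have hqq : q ∉ X ∪ K := by
      rintro (h | h)
      · exact h2.2 h
      · exact fc_sub K p hq h
    have hpp : p ∉ X ∪ K := by
      rintro (h | h)
      · exact h1.2 h
      · exact hp h
    exact fc_point (hX.isCompact.union hK) hpp (h3 ▸ fc_mem hqq) h1.1 h2.1

/-- The set of components of the complement. -/
def comps (K : Set ℂ) : Set (Set ℂ) := {F | ∃ p, p ∉ K ∧ F = fc K p}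

lemma fc_mono {K L : Set ℂ} (h : K ⊆ L) (p : ℂ) : fc L p ⊆ fc K p :=
  connectedComponentIn_mono _ (compl_subset_compl.2 h)

lemma fc_old {K L : Set ℂ} (h : K ⊆ L) {p : ℂ} (hp : p ∉ K) (hd : Disjoint (fc K p) L) :
    fc L p = fc K p := by
  apply Subset.antisymm (fc_mono h p)
  exact fc_max (fc_conn K p) (fc_mem hp) (disjoint_left.1 hd)

/-- Data of an arc attached to a compact set. -/
structure Att (D0 : Set ℂ) (γ : unitInterval → ℂ) : Prop where
  cpt : IsCompact D0
  cont : Continuous γ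
  inj : Function.Injective γ
  inter : ∀ t, γ t ∈ D0 → t = 0 ∨ t = 1

/-- The midpoint of the unit interval. -/
noncomputable def half : unitInterval := ⟨1 / 2, by norm_num, by norm_num⟩

/-- The open arc. -/
def oarc (γ : unitInterval → ℂ) : Set ℂ := γ '' {t | t ≠ 0 ∧ t ≠ 1}

lemma conn_Ioo : IsPreconnected {t : unitInterval | t ≠ 0 ∧ t ≠ 1} := by
  have : {t : unitInterval | t ≠ 0 ∧ t ≠ 1} = Ioo 0 1 := by
    ext t
    simp [unitInterval.pos_iff_ne_zero, unitInterval.lt_one_iff_ne_one]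
  rw [this]
  exact isPreconnected_Ioo

lemma half_ne : half ≠ 0 ∧ half ≠ 1 := by
  constructor <;> intro h <;> have := congrArg Subtype.val h <;> norm_num [half] at this

lemma oarc_conn {γ : unitInterval → ℂ} (h : Continuous γ) : IsPreconnected (oarc γ) :=
  conn_Ioo.image _ h.continuousOn

variable {D0 : Set ℂ} {γ : unitInterval → ℂ}

lemma Att.oarc_sub (h : Att D0 γ) : oarc γ ⊆ fc D0 (γ half) := by
  apply fc_max (oarc_conn h.cont) ⟨half, half_ne, rfl⟩
  rintro _ ⟨t, ht, rfl⟩ hD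
  rcases h.inter t hD with h | h
  · exact ht.1 h
  · exact ht.2 h

lemma Att.half_notin (h : Att D0 γ) : γ half ∉ D0 := fun hD => by
  rcases h.inter _ hD with h | h
  · exact half_ne.1 h
  · exact half_ne.2 h

lemma Att.cptU (h : Att D0 γ) : IsCompact (D0 ∪ range γ) :=
  h.cpt.union (isCompact_range h.cont)

/-- A point of the attaching face off the arc exists. -/
lemma Att.nonempty (h : Att D0 γ) : (fc D0 (γ half) \ range γ).Nonempty := by
  by_contra hne
  rw [not_nonempty_iff_eq_empty, sdiff_eq_empty] at hne
  set x := γ half with hx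
  let t1 : unitInterval := ⟨1 / 4, by norm_num, by norm_num⟩
  let t2 : unitInterval := ⟨3 / 4, by norm_num, by norm_num⟩
  have ht1 : γ t1 ∈ fc D0 x := h.oarc_sub ⟨t1, by
    constructor <;> intro h <;> have := congrArg Subtype.val h <;> norm_num [t1] at this, rfl⟩
  have ht2 : γ t2 ∈ fc D0 x := h.oarc_sub ⟨t2, by
    constructor <;> intro h <;> have := congrArg Subtype.val h <;> norm_num [t2] at this, rfl⟩
  have hl1 : t1 < half := by rw [← Subtype.coe_lt_coe]; norm_num [t1, half]
  have hl2 : half < t2 := by rw [← Subtype.coe_lt_coe]; norm_num [t2, half]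
  have hn1 : γ t1 ≠ x := fun e => hl1.ne (h.inj e)
  have hn2 : γ t2 ≠ x := fun e => hl2.ne' (h.inj e)
  have hD1 : γ t1 ∉ D0 := fc_sub _ _ ht1
  have hD2 : γ t2 ∉ D0 := fc_sub _ _ ht2
  have ht12 : γ t2 ∈ fc D0 (γ t1) := by rw [fc_eq ht1]; exact ht2
  have h12 := fc_point h.cpt hD1 ht12 hn1 hn2
  set C := fc (insert x D0) (γ t1) with hC
  have hCsub : C ⊆ range γ := by
    refine Subset.trans ?_ hne
    rw [← fc_eq ht1]
    exact fc_mono (subset_insert _ _) _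
  have hpre : IsPreconnected (γ ⁻¹' C) := by
    have hemb : IsInducing γ := (h.cont.isClosedEmbedding h.inj).isInducing
    rw [← hemb.isPreconnected_image, image_preimage_eq_of_subset hCsub]
    exact fc_conn _ _
  have hm1 : t1 ∈ γ ⁻¹' C := fc_mem (by simp [hn1, hD1])
  have hm2 : t2 ∈ γ ⁻¹' C := by
    change γ t2 ∈ C
    rw [← h12]; exact fc_mem (by simp [hn2, hD2])
  have hm : half ∈ γ ⁻¹' C := hpre.ordConnected.out hm1 hm2 ⟨hl1.le, hl2.le⟩
  exact fc_sub _ _ hm (mem_insert _ _)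

/-- The new faces. -/
def newf (D0 : Set ℂ) (γ : unitInterval → ℂ) : Set (Set ℂ) :=
  fc (D0 ∪ range γ) '' (fc D0 (γ half) \ range γ)

lemma fc_inter_eq {K : Set ℂ} {p q : ℂ} (h : (fc K p ∩ fc K q).Nonempty) : fc K p = fc K q := by
  obtain ⟨z, h1, h2⟩ := h
  rw [← fc_eq h1, ← fc_eq h2]

lemma Att.range_sub (h : Att D0 γ) : range γ \ D0 ⊆ fc D0 (γ half) := by
  have hc : closure {t : unitInterval | t ≠ 0 ∧ t ≠ 1} = univ := by
    have : {t : unitInterval | t ≠ 0 ∧ t ≠ 1} = Ioo 0 1 := by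
      ext t
      simp [unitInterval.pos_iff_ne_zero, unitInterval.lt_one_iff_ne_one]
    rw [this, closure_Ioo zero_ne_one]
    ext t; simpa using unitInterval.le_one'
  have hsub : {t : unitInterval | t ≠ 0 ∧ t ≠ 1} ⊆ γ ⁻¹' D0ᶜ := by
    intro t ht hD
    rcases h.inter t hD with h | h
    · exact ht.1 h
    · exact ht.2 h
  have hp : IsPreconnected (γ ⁻¹' D0ᶜ) := conn_Ioo.subset_closure hsub (by rw [hc]; simp)
  have := fc_max (K := D0) (hp.image γ h.cont.continuousOn)
    (mem_image_of_mem γ (hsub half_ne)) (by rintro _ ⟨t, ht, rfl⟩; exact ht)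
  rintro _ ⟨⟨t, rfl⟩, ht⟩
  exact this ⟨t, ht, rfl⟩

lemma Att.other (h : Att D0 γ) {p : ℂ} (hne : fc D0 p ≠ fc D0 (γ half)) :
    Disjoint (fc D0 p) (D0 ∪ range γ) := by
  rw [disjoint_left]
  rintro z hz (hD | hr)
  · exact fc_sub _ _ hz hD
  · exact hne (fc_inter_eq ⟨z, hz, h.range_sub ⟨hr, fc_sub _ _ hz⟩⟩)

lemma Att.comps_eq (h : Att D0 γ) :
    comps (D0 ∪ range γ) = (comps D0 \ {fc D0 (γ half)}) ∪ newf D0 γ := by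
  ext F
  constructor
  · rintro ⟨p, hp, rfl⟩
    have hp0 : p ∉ D0 := fun h => hp (Or.inl h)
    by_cases hF : fc D0 p = fc D0 (γ half)
    · exact Or.inr ⟨p, ⟨hF ▸ fc_mem hp0, fun h => hp (Or.inr h)⟩, rfl⟩
    · left
      rw [fc_old subset_union_left hp0 (h.other hF)]
      exact ⟨⟨p, hp0, rfl⟩, hF⟩
  · rintro (⟨⟨p, hp, rfl⟩, hF⟩ | ⟨p, hp, rfl⟩)
    · have hd := h.other hF
      exact ⟨p, disjoint_left.1 hd (fc_mem hp), (fc_old subset_union_left hp hd).symm⟩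
    · exact ⟨p, by rintro (h | h); exacts [fc_sub _ _ hp.1 h, hp.2 h], rfl⟩

lemma Att.disj (_h : Att D0 γ) : Disjoint (comps D0 \ {fc D0 (γ half)}) (newf D0 γ) := by
  rw [disjoint_left]
  rintro _ ⟨⟨p, hp, rfl⟩, hF⟩ ⟨q, hq, hqe⟩
  apply hF
  have hqD : q ∉ D0 ∪ range γ := by rintro (h | h); exacts [fc_sub _ _ hq.1 h, hq.2 h]
  have h1 : q ∈ fc D0 p := hqe ▸ fc_mem hqD
  exact fc_inter_eq ⟨q, h1, hq.1⟩

lemma Att.count (h : Att D0 γ) (hf : (comps D0).Finite) (hn : (newf D0 γ).Finite) :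
    (comps (D0 ∪ range γ)).Finite ∧
      (comps (D0 ∪ range γ)).ncard + 1 = (comps D0).ncard + (newf D0 γ).ncard := by
  rw [h.comps_eq]
  have hf' : (comps D0 \ {fc D0 (γ half)}).Finite := hf.subset sdiff_subset
  refine ⟨hf'.union hn, ?_⟩
  rw [ncard_union_eq h.disj hf' hn]
  have := ncard_sdiff_singleton_add_one (s := comps D0) (a := fc D0 (γ half))
    ⟨_, h.half_notin, rfl⟩ hf
  omega

lemma Att.Lg_arc (h : Att D0 γ) {p q : ℂ} (hp : p ∉ range γ) (hq : q ∉ range γ) :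
    Lg (fun z => (z - q) / (z - p)) (range γ) := by
  have hn : ∀ x, x ∉ range γ → ∀ z ∈ range γ, z - x ≠ 0 := fun x hx z hz e =>
    hx (sub_eq_zero.1 e ▸ hz)
  apply Lg.arc h.cont h.inj
  · exact ContinuousOn.div (by fun_prop) (by fun_prop) (hn p hp)
  · intro z hz
    exact div_ne_zero (hn q hq z hz) (hn p hp z hz)

/-- An arc joining two separate parts does not separate. -/
theorem Att.E1 (h : Att D0 γ) {P Q : Set ℂ} (hP : IsClosed P) (hQ : IsClosed Q)
    (hD : D0 = P ∪ Q) (hPQ : Disjoint P Q) (ha : γ 0 ∉ Q) (hb : γ 1 ∉ P)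
    (hf : (comps D0).Finite) :
    (comps (D0 ∪ range γ)).Finite ∧ (comps (D0 ∪ range γ)).ncard = (comps D0).ncard := by
  obtain ⟨p, hp⟩ := h.nonempty
  have hN : newf D0 γ = {fc (D0 ∪ range γ) p} := by
    apply Subset.antisymm
    · rintro _ ⟨q, hq, rfl⟩
      have hpD : p ∉ D0 := fc_sub _ _ hp.1
      have hqD : q ∉ D0 := fc_sub _ _ hq.1
      have hL : Lg (fun z => (z - q) / (z - p)) D0 :=
        Lg.same h.cpt.isClosed hpD (by rw [fc_eq hp.1]; exact hq.1)
      have hA := h.Lg_arc hp.2 hq.2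
      have hAc : IsClosed (range γ) := (isCompact_range h.cont).isClosed
      have h1 := Lg.glue (c := γ 0) hP hAc (hL.mono (by simp [hD])) hA (by
        rintro _ ⟨hz, ⟨t, rfl⟩⟩
        rcases h.inter t (by rw [hD]; exact Or.inl hz) with rfl | rfl
        · rfl
        · exact absurd hz hb)
      have h2 := Lg.glue (c := γ 1) hQ (hP.union hAc) (hL.mono (by simp [hD])) h1 (by
        rintro z ⟨hz, (hz2 | ⟨t, rfl⟩)⟩
        · exact absurd hz (disjoint_left.1 hPQ hz2)
        · rcases h.inter t (by rw [hD]; exact Or.inr hz) with rfl | rfl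
          · exact absurd hz ha
          · rfl)
      refine same_of_Lg h.cptU ?_ ?_ (h2.mono ?_)
      · rintro (h | h); exacts [hpD h, hp.2 h]
      · rintro (h | h); exacts [hqD h, hq.2 h]
      · rw [hD]; intro z; simp only [mem_union]; tauto
    · rintro _ rfl
      exact ⟨p, hp, rfl⟩
  obtain ⟨h1, h2⟩ := h.count hf (by rw [hN]; exact finite_singleton _)
  refine ⟨h1, ?_⟩
  rw [hN, ncard_singleton] at h2
  omega

lemma Att.three (h : Att D0 γ) (ha : γ 0 ∈ D0) (hb : γ 1 ∈ D0) {p q r : ℂ}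
    (hp : p ∈ fc D0 (γ half) \ range γ) (hq : q ∈ fc D0 (γ half) \ range γ)
    (hr : r ∈ fc D0 (γ half) \ range γ)
    (hpq : fc (D0 ∪ range γ) p ≠ fc (D0 ∪ range γ) q)
    (hpr : fc (D0 ∪ range γ) p ≠ fc (D0 ∪ range γ) r) :
    fc (D0 ∪ range γ) q = fc (D0 ∪ range γ) r := by
  classical
  by_contra hqr
  set D := D0 ∪ range γ with hD
  have hmem : ∀ x, x ∈ fc D0 (γ half) \ range γ → x ∉ D := by
    rintro x hx (h | h); exacts [fc_sub _ _ hx.1 h, hx.2 h]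
  have hL : ∀ x, x ∈ fc D0 (γ half) \ range γ → Lg (fun z => (z - x) / (z - p)) D0 := fun x hx =>
    Lg.same h.cpt.isClosed (fc_sub _ _ hp.1) (by rw [fc_eq hp.1]; exact hx.1)
  have haI : γ 0 ∈ D0 ∩ range γ := ⟨ha, 0, rfl⟩
  have hbI : γ 1 ∈ D0 ∩ range γ := ⟨hb, 1, rfl⟩
  obtain ⟨n, hn⟩ := Mis.exists (hL q hq) (h.Lg_arc hp.2 hq.2) haI hbI
  obtain ⟨m, hm⟩ := Mis.exists (hL r hr) (h.Lg_arc hp.2 hr.2) haI hbI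
  have hab : ∃ α β : ℤ, α * n + β * m = 0 ∧ ¬ (α = 0 ∧ β = 0) := by
    by_cases h0 : n = 0
    · exact ⟨1, 0, by simp [h0], by simp⟩
    · exact ⟨m, -n, by ring, by simp [h0]⟩
  obtain ⟨α, β, h0, hne⟩ := hab
  have hLg := Mis.comb h.cpt.isClosed (isCompact_range h.cont).isClosed hn hm (by
    rintro _ ⟨hz, ⟨t, rfl⟩⟩
    rcases h.inter t hz with rfl | rfl <;> simp) α β h0
  have npq : p ≠ q := fun e => hpq (by rw [e])
  have npr : p ≠ r := fun e => hpr (by rw [e])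
  have nqr : q ≠ r := fun e => hqr (by rw [e])
  let k : ℂ → ℤ := fun x => if x = q then α else if x = r then β else - (α + β)
  have kp : k p = - (α + β) := by simp [k, npq, npr]
  have kq : k q = α := by simp [k]
  have kr : k r = β := by simp [k, nqr.symm]
  have hs : ∀ x ∈ ({p, q, r} : Finset ℂ), x ∉ D := by
    simp only [Finset.mem_insert, Finset.mem_singleton]
    rintro x (rfl | rfl | rfl)
    exacts [hmem _ hp, hmem _ hq, hmem _ hr]
  have hR : Lg (R {p, q, r} k) D := by
    refine hLg.congr (fun z hz => ?_)
    rw [R, Finset.prod_insert (by simp [npq, npr]), Finset.prod_pair nqr, kp, kq, kr]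
    have hzp : z - p ≠ 0 := sub_ne_zero.2 (fun e => hmem p hp (e ▸ hz))
    rw [div_zpow, div_zpow, zpow_neg, zpow_add₀ hzp]
    have := zpow_ne_zero α hzp
    have := zpow_ne_zero β hzp
    field_simp
  have hdeg := deg_zero' h.cptU hs hR (by
    rw [Finset.sum_insert (by simp [npq, npr]), Finset.sum_pair nqr, kp, kq, kr]; ring)
  apply hne
  constructor
  · have h1 := hdeg q
    rw [show ({p, q, r} : Finset ℂ).filter (· ∈ fc D q) = {q} from ?_] at h1
    · simpa [kq] using h1
    · ext x
      simp only [Finset.mem_filter, Finset.mem_insert, Finset.mem_singleton]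
      constructor
      · rintro ⟨rfl | rfl | rfl, hx⟩
        · exact absurd (fc_eq hx) hpq
        · rfl
        · exact absurd (fc_eq hx).symm hqr
      · rintro rfl; exact ⟨Or.inr (Or.inl rfl), fc_mem (hmem _ hq)⟩
  · have h1 := hdeg r
    rw [show ({p, q, r} : Finset ℂ).filter (· ∈ fc D r) = {r} from ?_] at h1
    · simpa [kr] using h1
    · ext x
      simp only [Finset.mem_filter, Finset.mem_insert, Finset.mem_singleton]
      constructor
      · rintro ⟨rfl | rfl | rfl, hx⟩
        · exact absurd (fc_eq hx) hpr
        · exact absurd (fc_eq hx) hqr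
        · rfl
      · rintro rfl; exact ⟨Or.inr (Or.inr rfl), fc_mem (hmem _ hr)⟩

/-- An arc joining two points of a connected part separates its face. -/
lemma Att.two (h : Att D0 γ) {C : Set ℂ} (hC : IsPreconnected C) (hCD : C ⊆ D0) (ha : γ 0 ∈ C)
    (hb : γ 1 ∈ C) (p0 : ℂ)
    (hall : ∀ p ∈ fc D0 (γ half) \ range γ, fc (D0 ∪ range γ) p = fc (D0 ∪ range γ) p0) :
    False := by
  classical
  set D := D0 ∪ range γ with hD
  have hDc : IsCompact D := h.cptU
  obtain ⟨E, hE, hE2⟩ := descend γ h.cont (fun t => exp ((t : ℝ) * (2 * Real.pi * I)))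
    (by fun_prop) (fun x y hxy => by rw [h.inj hxy])
  have hE1 : ∀ z ∈ D0 ∩ range γ, E z = 1 := by
    rintro _ ⟨hz, t, rfl⟩
    rw [hE2]
    rcases h.inter t hz with rfl | rfl
    · simp
    · simp [exp_two_pi_mul_I]
  let f : ℂ → ℂ := D0.piecewise (fun _ => 1) E
  have hf1 : EqOn f (fun _ => 1) D0 := piecewise_eqOn _ _ _
  have hf2 : EqOn f E (range γ) := by
    intro z hz
    by_cases hz0 : z ∈ D0
    · rw [hf1 hz0, hE1 z ⟨hz0, hz⟩]
    · exact piecewise_eq_of_notMem _ _ _ hz0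
  have hfc : ContinuousOn f D := by
    apply ContinuousOn.union_of_isClosed _ _ h.cpt.isClosed (isCompact_range h.cont).isClosed
    · exact continuousOn_const.congr hf1
    · exact hE.congr hf2
  have hf0 : ∀ z ∈ D, f z ≠ 0 := by
    rintro z (hz | ⟨t, rfl⟩)
    · rw [hf1 hz]; exact one_ne_zero
    · rw [hf2 ⟨t, rfl⟩, hE2]; exact exp_ne_zero _
  obtain ⟨s, n, hs, hL⟩ := gen hDc hfc hf0
  have hs0 : ∀ p ∈ s, p ∉ D0 := fun p hp hpD => hs p hp (Or.inl hpD)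
  have hL0 : Lg (R s n) D0 :=
    (hL.mono subset_union_left).congr (fun z hz => by rw [hf1 hz, one_mul])
  have hLR : Lg (R s n) D := by
    apply Lg_of_deg hDc hs
    intro p hp hbd
    by_cases hF : fc D0 p = fc D0 (γ half)
    · have hpm : p ∈ fc D0 (γ half) \ range γ :=
        ⟨hF ▸ fc_mem (hs0 p hp), fun hr => hs p hp (Or.inr hr)⟩
      have hbd0 : Bornology.IsBounded (fc D0 p) := by
        refine (hbd.union (isCompact_range h.cont).isBounded).subset ?_
        intro q hq
        by_cases hqr : q ∈ range γ
        · exact Or.inr hqr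
        · left
          have hq' : q ∈ fc D0 (γ half) \ range γ := ⟨hF ▸ hq, hqr⟩
          rw [hall p hpm, ← hall q hq']
          exact fc_mem (by rintro (h | h); exacts [fc_sub _ _ hq h, hqr h])
      rw [← deg_zero h.cpt hs0 hL0 hbd0]
      apply Finset.sum_congr _ (fun _ _ => rfl)
      apply Finset.filter_congr
      intro q hq
      constructor
      · intro hqm; exact fc_mono subset_union_left _ hqm
      · intro hqm
        have hq' : q ∈ fc D0 (γ half) \ range γ := ⟨hF ▸ hqm, fun hr => hs q hq (Or.inr hr)⟩
        rw [hall p hpm, ← hall q hq']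
        exact fc_mem (hs q hq)
    · have he := fc_old (L := D) subset_union_left (hs0 p hp) (h.other hF)
      rw [he]
      rw [he] at hbd
      exact deg_zero h.cpt hs0 hL0 hbd
  have hLf : Lg f D := by
    refine (hL.mul hLR.inv).congr (fun z hz => ?_)
    have : R s n z ≠ 0 := R_ne_zero (fun hzs => hs z hzs hz)
    field_simp
  obtain ⟨k, hk, hk2⟩ := hLf
  have hCD' : C ⊆ D := hCD.trans subset_union_left
  have e1 : k (γ 0) = k (γ 1) := const_of_exp hC (hk.mono hCD') (fun x hx y hy => by
    rw [← hk2 x (hCD' hx), ← hk2 y (hCD' hy), hf1 (hCD hx), hf1 (hCD hy)]) ha hb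
  have hcont : Continuous (fun t : unitInterval => k (γ t) - (t : ℝ) * (2 * Real.pi * I)) :=
    (hk.comp_continuous h.cont (fun t => Or.inr ⟨t, rfl⟩)).sub (by fun_prop)
  have hval : ∀ t : unitInterval, exp (k (γ t) - (t : ℝ) * (2 * Real.pi * I)) = 1 := by
    intro t
    rw [exp_sub, ← hk2 _ (Or.inr ⟨t, rfl⟩), hf2 ⟨t, rfl⟩, hE2, div_self (exp_ne_zero _)]
  have e2 := const_of_exp isPreconnected_univ hcont.continuousOn
    (fun x _ y _ => by rw [hval x, hval y]) (mem_univ (0 : unitInterval))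
    (mem_univ (1 : unitInterval))
  rw [e1] at e2
  have : (2 * Real.pi * I : ℂ) = 0 := by
    simp only [Icc.coe_zero, Icc.coe_one] at e2
    push_cast at e2
    linear_combination e2
  exact two_pi_I_ne_zero this

theorem Att.E2 (h : Att D0 γ) {C : Set ℂ} (hC : IsPreconnected C) (hCD : C ⊆ D0) (ha : γ 0 ∈ C)
    (hb : γ 1 ∈ C) (hf : (comps D0).Finite) :
    (comps (D0 ∪ range γ)).Finite ∧ (comps (D0 ∪ range γ)).ncard = (comps D0).ncard + 1 := by
  obtain ⟨p, hp⟩ := h.nonempty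
  have : ∃ q ∈ fc D0 (γ half) \ range γ, fc (D0 ∪ range γ) p ≠ fc (D0 ∪ range γ) q := by
    by_contra hcon
    push Not at hcon
    exact h.two hC hCD ha hb p (fun q hq => (hcon q hq).symm)
  obtain ⟨q, hq, hpq⟩ := this
  have hN : newf D0 γ = {fc (D0 ∪ range γ) p, fc (D0 ∪ range γ) q} := by
    apply Subset.antisymm
    · rintro _ ⟨r, hr, rfl⟩
      by_cases hpr : fc (D0 ∪ range γ) p = fc (D0 ∪ range γ) r
      · left; exact hpr.symm
      · right; exact (h.three (hCD ha) (hCD hb) hp hq hr hpq hpr).symm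
    · rintro _ (rfl | rfl)
      exacts [⟨p, hp, rfl⟩, ⟨q, hq, rfl⟩]
  obtain ⟨h1, h2⟩ := h.count hf (by rw [hN]; simp)
  refine ⟨h1, ?_⟩
  rw [hN, ncard_pair hpq] at h2
  omega

end PF

namespace PF
open Complex

/-- A drawing in the complex plane, with parametrised arcs. -/
structure Dr {V : Type} (G : SimpleGraph V) where
  pt : V → ℂ
  pt_inj : Function.Injective pt
  γ : G.edgeSet → unitInterval → ℂ
  cont : ∀ e, Continuous (γ e)
  inj : ∀ e, Function.Injective (γ e)
  ends : ∀ e : G.edgeSet, ∃ u v : V, (e : Sym2 V) = s(u, v) ∧ γ e 0 = pt u ∧ γ e 1 = pt v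
  inter : ∀ e e' : G.edgeSet, e ≠ e' →
    range (γ e) ∩ range (γ e') ⊆ pt '' {x : V | x ∈ (e : Sym2 V) ∧ x ∈ (e' : Sym2 V)}
  mem : ∀ (e : G.edgeSet) (x : V), pt x ∈ range (γ e) → x ∈ (e : Sym2 V)

variable {V : Type} {G : SimpleGraph V}

/-- The spanning subgraph with edge set `S`. -/
def Gr (S : Finset G.edgeSet) : SimpleGraph V where
  Adj u v := ∃ e ∈ S, (e : Sym2 V) = s(u, v)
  symm := ⟨fun u v ⟨e, he, h⟩ => ⟨e, he, h.trans Sym2.eq_swap⟩⟩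
  loopless := ⟨fun u ⟨e, _, h⟩ => by
    have := e.2
    rw [h] at this
    exact G.loopless.irrefl u this⟩

lemma Gr_mono {S T : Finset G.edgeSet} (h : S ⊆ T) : Gr S ≤ Gr T :=
  fun _ _ ⟨e, he, hab⟩ => ⟨e, h he, hab⟩

/-- Number of components of the spanning subgraph. -/
noncomputable def nc (S : Finset G.edgeSet) : ℕ := Nat.card (Gr S).ConnectedComponent

lemma reach_edge {S : Finset G.edgeSet} {e : G.edgeSet} (he : e ∈ S) {x y : V}
    (hx : x ∈ (e : Sym2 V)) (hy : y ∈ (e : Sym2 V)) : (Gr S).Reachable x y := by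
  by_cases hxy : x = y
  · rw [hxy]
  · exact SimpleGraph.Adj.reachable ⟨e, he, (Sym2.mem_and_mem_iff hxy).1 ⟨hx, hy⟩⟩

section
variable [DecidableEq G.edgeSet]

lemma reach_insert {S : Finset G.edgeSet} {e : G.edgeSet} {u v : V} (he : (e : Sym2 V) = s(u, v))
    {x y : V} : (Gr (insert e S)).Reachable x y ↔ (Gr S).Reachable x y ∨
      ((Gr S).Reachable x u ∧ (Gr S).Reachable v y) ∨
      ((Gr S).Reachable x v ∧ (Gr S).Reachable u y) := by
  constructor
  · rintro ⟨w⟩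
    induction w with
    | nil => left; rfl
    | @cons a b c hab w ih =>
      obtain ⟨e', he', hab'⟩ := hab
      rcases Finset.mem_insert.1 he' with rfl | he'
      · rw [he] at hab'
        rcases Sym2.eq_iff.1 hab' with ⟨rfl, rfl⟩ | ⟨rfl, rfl⟩
        · rcases ih with h | ⟨_, h⟩ | ⟨_, h⟩
          · exact Or.inr (Or.inl ⟨SimpleGraph.Reachable.refl _, h⟩)
          · exact Or.inr (Or.inl ⟨SimpleGraph.Reachable.refl _, h⟩)
          · exact Or.inl h
        · rcases ih with h | ⟨_, h⟩ | ⟨_, h⟩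
          · exact Or.inr (Or.inr ⟨SimpleGraph.Reachable.refl _, h⟩)
          · exact Or.inl h
          · exact Or.inr (Or.inr ⟨SimpleGraph.Reachable.refl _, h⟩)
      · have hR : (Gr S).Reachable a b := SimpleGraph.Adj.reachable ⟨e', he', hab'⟩
        rcases ih with h | ⟨h1, h2⟩ | ⟨h1, h2⟩
        · exact Or.inl (hR.trans h)
        · exact Or.inr (Or.inl ⟨hR.trans h1, h2⟩)
        · exact Or.inr (Or.inr ⟨hR.trans h1, h2⟩)
  · have hle := Gr_mono (Finset.subset_insert e S)
    have huv : (Gr (insert e S)).Reachable u v :=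
      reach_edge (Finset.mem_insert_self e S) (by simp [he]) (by simp [he])
    rintro (h | ⟨h1, h2⟩ | ⟨h1, h2⟩)
    · exact h.mono hle
    · exact (h1.mono hle).trans (huv.trans (h2.mono hle))
    · exact (h1.mono hle).trans (huv.symm.trans (h2.mono hle))

lemma nc_insert_same {S : Finset G.edgeSet} {e : G.edgeSet} {u v : V}
    (he : (e : Sym2 V) = s(u, v)) (h : (Gr S).Reachable u v) : nc (insert e S) = nc S := by
  have hle := Gr_mono (Finset.subset_insert e S)
  symm
  apply Nat.card_eq_of_bijective (SimpleGraph.ConnectedComponent.map (SimpleGraph.Hom.ofLE hle))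
  constructor
  · intro C C'
    induction C using SimpleGraph.ConnectedComponent.ind with | h x =>
    induction C' using SimpleGraph.ConnectedComponent.ind with | h y =>
    intro hxy
    have hr : (Gr (insert e S)).Reachable x y := SimpleGraph.ConnectedComponent.eq.1 hxy
    apply SimpleGraph.ConnectedComponent.eq.2
    rcases (reach_insert he).1 hr with h' | ⟨h1, h2⟩ | ⟨h1, h2⟩
    · exact h'
    · exact h1.trans (h.trans h2)
    · exact h1.trans (h.symm.trans h2)
  · exact SimpleGraph.ConnectedComponent.surjective_map_ofLE hle

lemma nc_insert_diff [Finite V] {S : Finset G.edgeSet} {e : G.edgeSet} {u v : V}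
    (he : (e : Sym2 V) = s(u, v)) (h : ¬ (Gr S).Reachable u v) : nc (insert e S) + 1 = nc S := by
  have hle := Gr_mono (Finset.subset_insert e S)
  let φ := SimpleGraph.ConnectedComponent.map (SimpleGraph.Hom.ofLE hle)
  let v' := (Gr S).connectedComponentMk v
  have hinj : InjOn φ (univ \ {v'}) := by
    intro C hC C' hC'
    induction C using SimpleGraph.ConnectedComponent.ind with | h x =>
    induction C' using SimpleGraph.ConnectedComponent.ind with | h y =>
    intro hxy
    have hr : (Gr (insert e S)).Reachable x y := SimpleGraph.ConnectedComponent.eq.1 hxy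
    apply SimpleGraph.ConnectedComponent.eq.2
    rcases (reach_insert he).1 hr with h' | ⟨h1, h2⟩ | ⟨h1, h2⟩
    · exact h'
    · exact absurd (SimpleGraph.ConnectedComponent.eq.2 h2.symm) hC'.2
    · exact absurd (SimpleGraph.ConnectedComponent.eq.2 h1) hC.2
  have him : φ '' (univ \ {v'}) = univ := by
    apply eq_univ_of_forall
    intro C
    induction C using SimpleGraph.ConnectedComponent.ind with | h x =>
    by_cases hx : (Gr S).Reachable x v
    · refine ⟨(Gr S).connectedComponentMk u, ⟨mem_univ _, fun hh => h ?_⟩, ?_⟩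
      · exact SimpleGraph.ConnectedComponent.eq.1 hh
      · apply SimpleGraph.ConnectedComponent.eq.2
        exact (reach_insert he).2 (Or.inr (Or.inl ⟨SimpleGraph.Reachable.refl _, hx.symm⟩))
    · exact ⟨(Gr S).connectedComponentMk x,
        ⟨mem_univ _, fun hh => hx (SimpleGraph.ConnectedComponent.eq.1 hh)⟩, rfl⟩
  have h1 := hinj.ncard_image
  rw [him, ncard_univ] at h1
  have h2 := ncard_sdiff_singleton_add_one (s := (univ : Set (Gr S).ConnectedComponent))
    (mem_univ v') (toFinite _)
  rw [ncard_univ] at h2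
  rw [nc, nc, h1, h2]
end

lemma nc_empty : nc (∅ : Finset G.edgeSet) = Nat.card V := by
  symm
  apply Nat.card_eq_of_bijective (fun v => (Gr ∅).connectedComponentMk v)
  constructor
  · intro x y hxy
    obtain ⟨w⟩ := SimpleGraph.ConnectedComponent.eq.1 hxy
    cases w with
    | nil => rfl
    | cons h _ => obtain ⟨e, he, _⟩ := h; simp at he
  · intro C
    induction C using SimpleGraph.ConnectedComponent.ind with | h x => exact ⟨x, rfl⟩

lemma nc_mono [Finite V] {S T : Finset G.edgeSet} (h : S ⊆ T) : nc T ≤ nc S :=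
  Nat.card_le_card_of_surjective _ (SimpleGraph.ConnectedComponent.surjective_map_ofLE (Gr_mono h))

namespace Dr

variable (Δ : Dr G)

/-- The union of the arcs of the edges in `S`. -/
def D (S : Finset G.edgeSet) : Set ℂ := ⋃ e ∈ S, range (Δ.γ e)

lemma mem_D {S : Finset G.edgeSet} {z : ℂ} : z ∈ Δ.D S ↔ ∃ e ∈ S, ∃ t, Δ.γ e t = z := by
  simp [D]

lemma D_cpt (S : Finset G.edgeSet) : IsCompact (Δ.D S) :=
  S.isCompact_biUnion (fun e _ => isCompact_range (Δ.cont e))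

lemma D_mono {S T : Finset G.edgeSet} (h : S ⊆ T) : Δ.D S ⊆ Δ.D T :=
  biUnion_subset_biUnion_left h

/-- Points of an arc which are vertex points are end points. -/
lemma end_of_pt {e : G.edgeSet} {t : unitInterval} {x : V} (h : Δ.γ e t = Δ.pt x) :
    t = 0 ∨ t = 1 := by
  obtain ⟨u, v, he, h0, h1⟩ := Δ.ends e
  have hx := Δ.mem e x ⟨t, h⟩
  rw [he, Sym2.mem_iff] at hx
  rcases hx with rfl | rfl
  · left; exact Δ.inj e (h.trans h0.symm)
  · right; exact Δ.inj e (h.trans h1.symm)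

lemma pt_mem {e : G.edgeSet} {x : V} (h : x ∈ (e : Sym2 V)) : Δ.pt x ∈ range (Δ.γ e) := by
  obtain ⟨u, v, he, h0, h1⟩ := Δ.ends e
  rw [he, Sym2.mem_iff] at h
  rcases h with rfl | rfl
  · exact ⟨0, h0⟩
  · exact ⟨1, h1⟩

lemma att {S : Finset G.edgeSet} {e : G.edgeSet} (he : e ∉ S) : Att (Δ.D S) (Δ.γ e) where
  cpt := Δ.D_cpt S
  cont := Δ.cont e
  inj := Δ.inj e
  inter := by
    intro t ht
    obtain ⟨e', he', t', ht'⟩ := Δ.mem_D.1 ht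
    have hne : e ≠ e' := fun h => he (h ▸ he')
    obtain ⟨x, _, hx⟩ := Δ.inter e e' hne ⟨⟨t, rfl⟩, ⟨t', ht'⟩⟩
    exact Δ.end_of_pt hx.symm

lemma conn_of_walk {S : Finset G.edgeSet} {x y : V} (h : (Gr S).Reachable x y) :
    x = y ∨ ∃ C, IsPreconnected C ∧ C ⊆ Δ.D S ∧ Δ.pt x ∈ C ∧ Δ.pt y ∈ C := by
  obtain ⟨w⟩ := h
  induction w with
  | nil => left; rfl
  | @cons a b c hab w ih =>
    right
    obtain ⟨e, he, hab⟩ := hab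
    have ha : Δ.pt a ∈ range (Δ.γ e) := Δ.pt_mem (by simp [hab])
    have hb : Δ.pt b ∈ range (Δ.γ e) := Δ.pt_mem (by simp [hab])
    have hc : IsPreconnected (range (Δ.γ e)) := isPreconnected_range (Δ.cont e)
    have hs : range (Δ.γ e) ⊆ Δ.D S := by
      rintro _ ⟨t, rfl⟩; exact Δ.mem_D.2 ⟨e, he, t, rfl⟩
    rcases ih with rfl | ⟨C, hC, hCS, h1, h2⟩
    · exact ⟨_, hc, hs, ha, hb⟩
    · exact ⟨range (Δ.γ e) ∪ C, hc.union _ hb h1 hC, union_subset hs hCS, Or.inl ha, Or.inr h2⟩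

lemma comps_empty : comps (∅ : Set ℂ) = {univ} := by
  ext F
  have h : ∀ p, fc (∅ : Set ℂ) p = univ := by
    intro p
    apply eq_univ_of_univ_subset
    exact fc_max isPreconnected_univ (mem_univ p) (by simp)
  constructor
  · rintro ⟨p, _, rfl⟩; exact h p
  · rintro rfl; exact ⟨0, by simp, (h 0).symm⟩

/-- Euler's formula. -/
theorem euler [Finite V] (S : Finset G.edgeSet) : (comps (Δ.D S)).Finite ∧
    (comps (Δ.D S)).ncard + Nat.card V = S.card + nc S + 1 := by
  classical
  induction S using Finset.induction_on with
  | empty =>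
    have : Δ.D ∅ = ∅ := by simp [D]
    rw [this, comps_empty, nc_empty]
    simp
    omega
  | insert e S he ih =>
    obtain ⟨hfin, hcard⟩ := ih
    obtain ⟨u, v, huv, h0, h1⟩ := Δ.ends e
    have hA := Δ.att he
    have hD : Δ.D (insert e S) = Δ.D S ∪ range (Δ.γ e) := by
      simp [D, union_comm]
    rw [hD, Finset.card_insert_of_notMem he]
    by_cases hR : (Gr S).Reachable u v
    · have hne : u ≠ v := by
        rintro rfl
        have := e.2
        rw [huv] at this
        exact G.loopless.irrefl u this
      rcases Δ.conn_of_walk hR with h | ⟨C, hC, hCS, hu, hv⟩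
      · exact absurd h hne
      obtain ⟨hf, hc⟩ := hA.E2 hC hCS (h0 ▸ hu) (h1 ▸ hv) hfin
      refine ⟨hf, ?_⟩
      rw [hc, nc_insert_same huv hR]; omega
    · let SP : Finset G.edgeSet := S.filter (fun e' : G.edgeSet => ∀ x ∈ (e' : Sym2 V), (Gr S).Reachable u x)
      let SQ : Finset G.edgeSet := S.filter (fun e' : G.edgeSet => ¬ ∀ x ∈ (e' : Sym2 V), (Gr S).Reachable u x)
      have hSQ : ∀ e' ∈ SQ, ∀ x ∈ (e' : Sym2 V), ¬ (Gr S).Reachable u x := by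
        intro e' he' x hx hr
        have h' := Finset.mem_filter.1 he'
        exact h'.2 (fun y hy => hr.trans (reach_edge h'.1 hx hy))
      obtain ⟨hf, hc⟩ := hA.E1 (P := Δ.D SP) (Q := Δ.D SQ) (Δ.D_cpt _).isClosed
        (Δ.D_cpt _).isClosed (by
          ext z
          simp only [mem_union, mem_D, SP, SQ, Finset.mem_filter]
          constructor
          · rintro ⟨e', he', ht⟩
            by_cases hp : ∀ x ∈ (e' : Sym2 V), (Gr S).Reachable u x
            · exact Or.inl ⟨e', ⟨he', hp⟩, ht⟩
            · exact Or.inr ⟨e', ⟨he', hp⟩, ht⟩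
          · rintro (⟨e', ⟨he', _⟩, ht⟩ | ⟨e', ⟨he', _⟩, ht⟩) <;> exact ⟨e', he', ht⟩)
        (by
          rw [disjoint_left]
          intro z hz1 hz2
          obtain ⟨e1, he1, ht1⟩ := Δ.mem_D.1 hz1
          obtain ⟨e2, he2, ht2⟩ := Δ.mem_D.1 hz2
          have he1' := (Finset.mem_filter.1 he1)
          have hne : e1 ≠ e2 := by
            rintro rfl
            exact (Finset.mem_filter.1 he2).2 he1'.2
          obtain ⟨x, hx, _⟩ := Δ.inter e1 e2 hne ⟨ht1, ht2⟩
          exact hSQ e2 he2 x hx.2 (he1'.2 x hx.1))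
        (by
          rw [h0]
          intro hz
          obtain ⟨e2, he2, ht2⟩ := Δ.mem_D.1 hz
          exact hSQ e2 he2 u (Δ.mem e2 u ht2) (SimpleGraph.Reachable.refl _))
        (by
          rw [h1]
          intro hz
          obtain ⟨e1, he1, ht1⟩ := Δ.mem_D.1 hz
          exact hR ((Finset.mem_filter.1 he1).2 v (Δ.mem e1 v ht1)))
        hfin
      refine ⟨hf, ?_⟩
      have := nc_insert_diff huv hR
      rw [hc]; omega

end Dr

end PF

namespace PF
open Complex Classical

variable {V : Type} {G : SimpleGraph V}

lemma conn_frontier {H F : Set ℂ} (hH : IsPreconnected H) (hF : IsOpen F)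
    (h1 : (H ∩ F).Nonempty) (h2 : (H ∩ Fᶜ).Nonempty) : (H ∩ frontier F).Nonempty := by
  by_contra hne
  have hcov : H ⊆ F ∪ (closure F)ᶜ := by
    intro z hz
    by_cases hzF : z ∈ F
    · exact Or.inl hzF
    · right
      intro hc
      exact hne ⟨z, hz, hc, by rwa [hF.interior_eq]⟩
  obtain ⟨q, hq, hqF⟩ := h2
  obtain ⟨z, _, hz1, hz2⟩ := hH F (closure F)ᶜ hF isClosed_closure.isOpen_compl hcov h1
    ⟨q, hq, (hcov hq).resolve_left hqF⟩
  exact hz2 (subset_closure hz1)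

namespace Dr

variable (Δ : Dr G)

/-- The faces of the drawing of the edges in `S`. -/
noncomputable def faces [Finite V] (S : Finset G.edgeSet) : Finset (Set ℂ) :=
  (Δ.euler S).1.toFinset

lemma mem_faces [Finite V] {S : Finset G.edgeSet} {F : Set ℂ} :
    F ∈ Δ.faces S ↔ ∃ p, p ∉ Δ.D S ∧ F = fc (Δ.D S) p := by
  simp [faces, comps]

lemma euler' [Finite V] (S : Finset G.edgeSet) :
    (Δ.faces S).card + Nat.card V = S.card + nc S + 1 := by
  rw [← (Δ.euler S).2, faces, ncard_eq_toFinset_card _ (Δ.euler S).1]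

/-- The edges touching a face. -/
noncomputable def TE (S : Finset G.edgeSet) (F : Set ℂ) : Finset G.edgeSet :=
  S.filter (fun e => (frontier F ∩ oarc (Δ.γ e)).Nonempty)

lemma TE_sub (S : Finset G.edgeSet) (F : Set ℂ) : Δ.TE S F ⊆ S := Finset.filter_subset _ _

lemma faces_of_TE [Finite V] {S S' : Finset G.edgeSet} {F : Set ℂ} (hF : F ∈ Δ.faces S)
    (hS : S' ⊆ S) (hT : Δ.TE S F ⊆ S') : F ∈ Δ.faces S' := by
  obtain ⟨p, hp, rfl⟩ := Δ.mem_faces.1 hF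
  have hKS := Δ.D_mono hS
  have hpK : p ∉ Δ.D S' := fun h => hp (hKS h)
  let X : Set ℂ := range Δ.pt ∩ Δ.D S
  have hX : X.Finite := (finite_range _).subset inter_subset_left
  have hpX : p ∉ X := fun h => hp h.2
  have hfr : frontier (fc (Δ.D S) p) ⊆ X ∪ Δ.D S' := by
    intro z hz
    have hzD := fc_frontier (Δ.D_cpt S).isClosed p hz
    obtain ⟨e, he, t, rfl⟩ := Δ.mem_D.1 hzD
    by_cases he' : e ∈ S'
    · exact Or.inr (Δ.mem_D.2 ⟨e, he', t, rfl⟩)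
    · have : e ∉ Δ.TE S (fc (Δ.D S) p) := fun h => he' (hT h)
      left
      refine ⟨?_, hzD⟩
      obtain ⟨u, v, _, h0, h1⟩ := Δ.ends e
      by_cases ht0 : t = 0
      · exact ⟨u, by rw [ht0, h0]⟩
      by_cases ht1 : t = 1
      · exact ⟨v, by rw [ht1, h1]⟩
      exact absurd (Finset.mem_filter.2 ⟨he, _, hz, ⟨t, ⟨ht0, ht1⟩, rfl⟩⟩) this
  have hmain : ∀ q ∈ fc (Δ.D S') p, q ∉ X → q ∈ fc (Δ.D S) p := by
    intro q hq hqX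
    have h1 := fc_finite (Δ.D_cpt S') hpK hq hX hpX hqX
    have hqH : q ∈ fc (X ∪ Δ.D S') p := by
      rw [← h1]
      apply fc_mem
      rintro (h | h)
      · exact hqX h
      · exact fc_sub _ _ hq h
    have hpH : p ∈ fc (X ∪ Δ.D S') p := by
      apply fc_mem
      rintro (h | h)
      · exact hpX h
      · exact hpK h
    by_contra hqF
    obtain ⟨z, hz1, hz2⟩ := conn_frontier (fc_conn (X ∪ Δ.D S') p)
      (fc_open (Δ.D_cpt S).isClosed p) ⟨p, hpH, fc_mem hp⟩ ⟨q, hqH, hqF⟩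
    exact fc_sub _ _ hz1 (hfr hz2)
  refine Δ.mem_faces.2 ⟨p, hpK, Subset.antisymm (fc_mono hKS p) ?_⟩
  intro q hq
  by_cases hqX : q ∈ X
  · exfalso
    obtain ⟨⟨x, hx⟩, hqD⟩ := hqX
    obtain ⟨e, he, t, ht⟩ := Δ.mem_D.1 hqD
    have hopen : IsOpen (Δ.γ e ⁻¹' fc (Δ.D S') p) :=
      (fc_open (Δ.D_cpt S').isClosed p).preimage (Δ.cont e)
    have hc : Dense {t : unitInterval | t ≠ 0 ∧ t ≠ 1} := by
      have : {t : unitInterval | t ≠ 0 ∧ t ≠ 1} = Ioo 0 1 := by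
        ext t
        simp [unitInterval.pos_iff_ne_zero, unitInterval.lt_one_iff_ne_one]
      rw [this, dense_iff_closure_eq, closure_Ioo (by simp)]
      exact Set.eq_univ_of_forall (fun t => ⟨t.2.1, t.2.2⟩)
    obtain ⟨s, hs1, hs2⟩ := hc.inter_open_nonempty _ hopen ⟨t, by rw [mem_preimage, ht]; exact hq⟩
    have hsX : Δ.γ e s ∉ X := by
      rintro ⟨⟨y, hy⟩, _⟩
      rcases Δ.end_of_pt hy.symm with h | h
      · exact hs2.1 h
      · exact hs2.2 h
    exact fc_sub _ _ (hmain _ hs1 hsX) (Δ.mem_D.2 ⟨e, he, s, rfl⟩)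
  · exact hmain q hq hqX

lemma TE_of_faces [Finite V] {S S' : Finset G.edgeSet} {F : Set ℂ} (hF : F ∈ Δ.faces S') :
    Δ.TE S F ⊆ S' := by
  obtain ⟨p, hp, rfl⟩ := Δ.mem_faces.1 hF
  intro e he
  obtain ⟨_, z, hz, t, ht, rfl⟩ := Finset.mem_filter.1 he
  by_contra he'
  rcases (Δ.att he').inter t (fc_frontier (Δ.D_cpt S').isClosed p hz) with h | h
  · exact ht.1 h
  · exact ht.2 h

lemma touched_le [Finite V] {S T : Finset G.edgeSet} (z : ℂ)
    (h : ∀ e ∈ T, fc (Δ.D (S \ T)) (Δ.γ e half) = fc (Δ.D (S \ T)) z) :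
    ((Δ.faces S).filter (fun F => (Δ.TE S F ∩ T).Nonempty)).card + (Δ.faces (S \ T)).card ≤
      (Δ.faces S).card + 1 := by
  have h1 : (Δ.faces (S \ T)).erase (fc (Δ.D (S \ T)) z) ⊆
      (Δ.faces S).filter (fun F => ¬ (Δ.TE S F ∩ T).Nonempty) := by
    intro F hF
    obtain ⟨hne, hF⟩ := Finset.mem_erase.1 hF
    have hTE := Δ.TE_of_faces (S := S) hF
    obtain ⟨p, hp, rfl⟩ := Δ.mem_faces.1 hF
    have hd : Disjoint (fc (Δ.D (S \ T)) p) (Δ.D S) := by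
      rw [disjoint_left]
      intro y hy hyD
      obtain ⟨e, he, t, rfl⟩ := Δ.mem_D.1 hyD
      by_cases heT : e ∈ T
      · have hA : Att (Δ.D (S \ T)) (Δ.γ e) := Δ.att (by simp [heT])
        exact disjoint_left.1 (hA.other (by rw [h e heT]; exact hne)) hy (Or.inr ⟨t, rfl⟩)
      · exact fc_sub _ _ hy (Δ.mem_D.2 ⟨e, by simp [he, heT], t, rfl⟩)
    refine Finset.mem_filter.2 ⟨Δ.mem_faces.2 ⟨p, ?_,
      (fc_old (Δ.D_mono Finset.sdiff_subset) hp hd).symm⟩, ?_⟩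
    · exact disjoint_left.1 hd (fc_mem hp)
    · rintro ⟨e, he⟩
      rw [Finset.mem_inter] at he
      exact (Finset.mem_sdiff.1 (hTE he.1)).2 he.2
  have h2 := Finset.card_le_card h1
  have h3 := Finset.pred_card_le_card_erase (s := Δ.faces (S \ T)) (a := fc (Δ.D (S \ T)) z)
  have h4 := Finset.card_filter_add_card_filter_not (s := Δ.faces S)
    (fun F => (Δ.TE S F ∩ T).Nonempty)
  omega

lemma only_le [Finite V] {S S' : Finset G.edgeSet} (hS : S' ⊂ S) :
    ((Δ.faces S).filter (fun F => Δ.TE S F ⊆ S')).card + 1 ≤ (Δ.faces S').card := by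
  obtain ⟨hsub, e, he, he'⟩ := Finset.ssubset_iff_exists_subset_erase.1 hS |>.elim (fun e h =>
    (⟨hS.1, e, h.1, fun h' => absurd rfl (Finset.mem_erase.1 (h.2 h')).1⟩ :
      S' ⊆ S ∧ ∃ e ∈ S, e ∉ S'))
  have hA := Δ.att he'
  have hm : fc (Δ.D S') (Δ.γ e half) ∈ Δ.faces S' := Δ.mem_faces.2 ⟨_, hA.half_notin, rfl⟩
  rw [← Finset.card_erase_add_one hm]
  gcongr
  intro F hF
  obtain ⟨hF, hT⟩ := Finset.mem_filter.1 hF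
  refine Finset.mem_erase.2 ⟨?_, Δ.faces_of_TE hF hsub hT⟩
  rintro rfl
  obtain ⟨p, hp, hpe⟩ := Δ.mem_faces.1 hF
  have : Δ.γ e half ∈ fc (Δ.D S) p := by rw [← hpe]; exact fc_mem hA.half_notin
  exact fc_sub _ _ this (Δ.mem_D.2 ⟨e, he, half, rfl⟩)

lemma TE_star [Finite V] {S : Finset G.edgeSet} {F : Set ℂ} (hF : F ∈ Δ.faces S) {u : V}
    (hu : Δ.pt u ∈ frontier F) : ∃ e ∈ Δ.TE S F, u ∈ (e : Sym2 V) := by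
  classical
  by_contra! hne
  have h := Δ.faces_of_TE (S' := S.filter (fun e : G.edgeSet => u ∉ (e : Sym2 V))) hF
    (Finset.filter_subset _ _) (fun e he => Finset.mem_filter.2 ⟨Δ.TE_sub _ _ he, hne e he⟩)
  obtain ⟨p, hp, rfl⟩ := Δ.mem_faces.1 h
  obtain ⟨e, he, ht⟩ := Δ.mem_D.1 (fc_frontier (Δ.D_cpt _).isClosed p hu)
  exact (Finset.mem_filter.1 he).2 (Δ.mem e u ht)

/-- Touched faces for the set of edges incident to a connected vertex set. -/
lemma touched_star [Finite V] {S T : Finset G.edgeSet} (W : Set V) {w0 : V}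
    (H : SimpleGraph V) (hW : ∀ w ∈ W, H.Reachable w0 w) (hw0 : w0 ∈ W)
    (hH : ∀ a ∈ W, ∀ b, H.Adj a b → b ∈ W ∧ ∃ e ∈ T, (e : Sym2 V) = s(a, b))
    (h1 : ∀ e ∈ S, ∀ w ∈ W, w ∈ (e : Sym2 V) → e ∈ T)
    (h2 : ∀ e ∈ T, ∃ w ∈ W, w ∈ (e : Sym2 V)) :
    ((Δ.faces S).filter (fun F => (Δ.TE S F ∩ T).Nonempty)).card + (Δ.faces (S \ T)).card ≤
      (Δ.faces S).card + 1 := by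
  have hn : ∀ w ∈ W, Δ.pt w ∉ Δ.D (S \ T) := by
    intro w hw hD
    obtain ⟨e, he, ht⟩ := Δ.mem_D.1 hD
    rw [Finset.mem_sdiff] at he
    exact he.2 (h1 e he.1 w hw (Δ.mem e w ht))
  have hstep : ∀ e ∈ T, ∀ w ∈ W, w ∈ (e : Sym2 V) →
      fc (Δ.D (S \ T)) (Δ.γ e half) = fc (Δ.D (S \ T)) (Δ.pt w) := by
    intro e he w hw hwe
    have hA : Att (Δ.D (S \ T)) (Δ.γ e) := Δ.att (by simp [he])
    exact (fc_eq (hA.range_sub ⟨Δ.pt_mem hwe, hn w hw⟩)).symm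
  have hwalk : ∀ a b, H.Walk a b → a ∈ W →
      fc (Δ.D (S \ T)) (Δ.pt b) = fc (Δ.D (S \ T)) (Δ.pt a) := by
    intro a b w
    induction w with
    | nil => intro _; rfl
    | @cons a c b hac w ih =>
      intro ha
      obtain ⟨hc, e, he, hee⟩ := hH a ha c hac
      rw [ih hc, ← hstep e he c hc (by simp [hee]), ← hstep e he a ha (by simp [hee])]
  apply Δ.touched_le (Δ.pt w0)
  intro e he
  obtain ⟨w, hw, hwe⟩ := h2 e he
  rw [hstep e he w hw hwe]
  obtain ⟨p⟩ := hW w hw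
  exact hwalk _ _ p hw0

lemma touched_one [Finite V] {S : Finset G.edgeSet} {e : G.edgeSet} (he : e ∈ S) :
    ((Δ.faces S).filter (fun F => e ∈ Δ.TE S F)).card ≤ 2 := by
  have h := Δ.touched_le (S := S) (T := {e}) (Δ.γ e half) (by simp)
  have e1 := Δ.euler' S
  have e2 := Δ.euler' (S \ {e})
  have h3 : nc S ≤ nc (S \ {e}) := nc_mono Finset.sdiff_subset
  have h4 : (S \ {e}).card + 1 = S.card := by
    rw [← Finset.erase_eq]; exact Finset.card_erase_add_one he
  have h5 : (Δ.faces S).filter (fun F => (Δ.TE S F ∩ {e}).Nonempty) =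
      (Δ.faces S).filter (fun F => e ∈ Δ.TE S F) := by
    apply Finset.filter_congr
    intro F _
    constructor
    · rintro ⟨x, hx⟩
      rw [Finset.mem_inter, Finset.mem_singleton] at hx
      exact hx.2 ▸ hx.1
    · intro h
      exact ⟨e, by simp [h]⟩
  rw [h5] at h
  omega

end Dr

end PF

namespace PF
open Complex Classical

variable {V : Type} {G : SimpleGraph V}

lemma isolated {S : Finset G.edgeSet} {w x : V} (h : ∀ e ∈ S, w ∉ (e : Sym2 V))
    (hr : (Gr S).Reachable w x) : x = w := by
  obtain ⟨p⟩ := hr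
  cases p with
  | nil => rfl
  | cons hab _ =>
    obtain ⟨e, he, hee⟩ := hab
    exact absurd (by simp [hee]) (h e he)

lemma nc_ge [Finite V] {S : Finset G.edgeSet} (W : Finset V) {v0 : V} (hv : v0 ∉ W)
    (h : ∀ e ∈ S, ∀ w ∈ W, w ∉ (e : Sym2 V)) : W.card + 1 ≤ nc S := by
  rw [← Finset.card_insert_of_notMem hv, nc]
  have hinj : InjOn (fun v => (Gr S).connectedComponentMk v) ((insert v0 W : Finset V) : Set V) := by
    intro x hx y hy hxy
    have hr : (Gr S).Reachable x y := SimpleGraph.ConnectedComponent.eq.1 hxy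
    simp only [Finset.coe_insert, mem_insert_iff, Finset.mem_coe] at hx hy
    rcases hx with rfl | hx
    · rcases hy with rfl | hy
      · rfl
      · exact isolated (fun e he => h e he _ hy) hr.symm
    · exact (isolated (fun e he => h e he _ hx) hr).symm
  rw [← ncard_coe_finset, ← hinj.ncard_image, ← ncard_univ]
  exact ncard_le_ncard (subset_univ _) (toFinite _)

lemma nc_le [Fintype V] {S : Finset G.edgeSet} (X : Finset V) {x0 : V}
    (h : ∀ x ∈ X, (Gr S).Reachable x0 x) : nc S + X.card ≤ Nat.card V + 1 := by
  have h1 : (univ : Set (Gr S).ConnectedComponent) ⊆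
      (fun v => (Gr S).connectedComponentMk v) '' ((insert x0 (Finset.univ \ X) : Finset V) : Set V) := by
    intro C _
    induction C using SimpleGraph.ConnectedComponent.ind with | h x =>
    by_cases hxX : x ∈ X
    · exact ⟨x0, by simp, SimpleGraph.ConnectedComponent.eq.2 (h x hxX)⟩
    · exact ⟨x, by simp [hxX], rfl⟩
  have h2 := ncard_le_ncard h1 (toFinite _)
  have h3 := ncard_image_le (f := fun v => (Gr S).connectedComponentMk v)
    (toFinite ((insert x0 (Finset.univ \ X) : Finset V) : Set V))
  rw [ncard_univ] at h2
  rw [ncard_coe_finset] at h3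
  have h4 := Finset.card_insert_le x0 (Finset.univ \ X)
  have h5 := Finset.card_sdiff_add_card_eq_card (Finset.subset_univ X)
  rw [Finset.card_univ, ← Nat.card_eq_fintype_card] at h5
  rw [nc]
  omega

lemma not_adj_self {e : G.edgeSet} {u v : V} (h : (e : Sym2 V) = s(u, v)) : u ≠ v := by
  rintro rfl
  have := e.2
  rw [h] at this
  exact G.loopless.irrefl u this

lemma reach_empty {u v : V} (h : (Gr (∅ : Finset G.edgeSet)).Reachable u v) : v = u :=
  isolated (by simp) h

lemma nc_one [Finite V] (e : G.edgeSet) : nc {e} + 1 = Nat.card V := by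
  obtain ⟨u, v, huv⟩ : ∃ u v, (e : Sym2 V) = s(u, v) := by
    induction h : (e : Sym2 V) with | h a b => exact ⟨a, b, rfl⟩
  have := nc_insert_diff (S := ∅) huv (fun h => not_adj_self huv (reach_empty h).symm)
  rw [nc_empty] at this
  rw [← this]
  rfl

lemma nc_two [Finite V] {e e' : G.edgeSet} (hne : e ≠ e') : nc {e, e'} + 2 = Nat.card V := by
  obtain ⟨u, v, huv⟩ : ∃ u v, (e : Sym2 V) = s(u, v) := by
    induction h : (e : Sym2 V) with | h a b => exact ⟨a, b, rfl⟩
  obtain ⟨a, b, hab⟩ : ∃ u v, (e' : Sym2 V) = s(u, v) := by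
    induction h : (e' : Sym2 V) with | h a b => exact ⟨a, b, rfl⟩
  have h1 := nc_insert_diff (S := {e'}) huv (fun h => by
    rw [show ({e'} : Finset G.edgeSet) = insert e' ∅ from rfl, reach_insert hab] at h
    rcases h with h | ⟨h1, h2⟩ | ⟨h1, h2⟩
    · exact not_adj_self huv (reach_empty h).symm
    · apply hne; apply Subtype.ext
      rw [huv, hab, reach_empty h1, reach_empty h2]
    · apply hne; apply Subtype.ext
      rw [huv, hab, reach_empty h1, reach_empty h2, Sym2.eq_swap])
  have h2 := nc_one e'
  omega

namespace Dr
variable (Δ : Dr G)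

lemma faces_small [Finite V] {S : Finset G.edgeSet} (h : S.card ≤ 2) : (Δ.faces S).card = 1 := by
  have e1 := Δ.euler' S
  have : S.card = 0 ∨ S.card = 1 ∨ S.card = 2 := by omega
  rcases this with h | h | h
  · rw [Finset.card_eq_zero] at h
    subst h
    rw [nc_empty] at e1
    simp at e1
    omega
  · obtain ⟨e, rfl⟩ := Finset.card_eq_one.1 h
    have := nc_one e
    omega
  · obtain ⟨e, e', hne, rfl⟩ := Finset.card_eq_two.1 h
    have := nc_two hne
    omega

lemma TE_card [Finite V] {S : Finset G.edgeSet} {F : Set ℂ} (hF : F ∈ Δ.faces S)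
    {k : ℕ} (hk : k ≤ 3) (hS : k ≤ S.card) : k ≤ (Δ.TE S F).card := by
  by_contra! hlt
  have hss : Δ.TE S F ⊂ S := by
    refine Finset.ssubset_iff_subset_ne.2 ⟨Δ.TE_sub _ _, fun h => ?_⟩
    rw [h] at hlt
    omega
  have h1 := Δ.only_le hss
  rw [Δ.faces_small (by omega)] at h1
  have h2 : 0 < ((Δ.faces S).filter (fun F' => Δ.TE S F' ⊆ Δ.TE S F)).card :=
    Finset.card_pos.2 ⟨F, Finset.mem_filter.2 ⟨hF, Finset.Subset.refl _⟩⟩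
  omega

lemma edges_in_le [Fintype V] (Δ : Dr G) {S : Finset G.edgeSet} (U : Finset V) (hU : U.Nonempty)
    (h : ∀ e ∈ S, ∀ x ∈ (e : Sym2 V), x ∈ U) : S.card ≤ 3 * U.card := by
  by_cases h3 : S.card < 3
  · have := hU.card_pos; omega
  obtain ⟨u0, hu0⟩ := hU
  have h1 := nc_ge (S := S) (Finset.univ \ U) (v0 := u0) (by simp [hu0]) (by
    intro e he w hw hwe
    simp only [Finset.mem_sdiff, Finset.mem_univ, true_and] at hw
    exact hw (h e he w hwe))
  have h5 := Finset.card_sdiff_add_card_eq_card (Finset.subset_univ U)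
  rw [Finset.card_univ, ← Nat.card_eq_fintype_card] at h5
  have e1 := Δ.euler' S
  have h6 : (Δ.faces S).card * 3 ≤ S.card * 2 :=
    Finset.card_mul_le_card_mul (fun F e => e ∈ Δ.TE S F) (s := Δ.faces S) (t := S)
      (fun F hF => by
        refine (Δ.TE_card hF le_rfl (by omega)).trans (Finset.card_le_card ?_)
        intro e he
        exact Finset.mem_filter.2 ⟨Δ.TE_sub _ _ he, he⟩)
      (fun e he => Δ.touched_one he)
  omega

/-- Counting pieces. -/
lemma pieces [Finite V] {S : Finset G.edgeSet} (hS : S.Nonempty) {ι : Type} [DecidableEq ι] (π : G.edgeSet → ι)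
    (I : Finset ι) (hI : ∀ e ∈ S, π e ∈ I) :
    2 * (Δ.faces S).card ≤ ∑ i ∈ I,
      (((Δ.faces S).filter (fun F => (Δ.TE S F ∩ S.filter (fun e => π e = i)).Nonempty)).card +
       ((Δ.faces S).filter (fun F => Δ.TE S F ⊆ S.filter (fun e => π e = i))).card) := by
  simp only [Finset.card_filter]
  rw [Finset.sum_add_distrib, Finset.sum_comm, Finset.sum_comm (s := I) (t := Δ.faces S),
    ← Finset.sum_add_distrib, mul_comm, ← smul_eq_mul, ← Finset.sum_const]
  apply Finset.sum_le_sum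
  intro F hF
  have hc : 0 < (Δ.TE S F).card := Δ.TE_card hF (k := 1) (by omega) hS.card_pos
  obtain ⟨e, he⟩ := Finset.card_pos.1 hc
  have heS := Δ.TE_sub _ _ he
  have hte : ∀ e ∈ Δ.TE S F, (Δ.TE S F ∩ S.filter (fun e' => π e' = π e)).Nonempty := fun e he =>
    ⟨e, Finset.mem_inter.2 ⟨he, Finset.mem_filter.2 ⟨Δ.TE_sub _ _ he, rfl⟩⟩⟩
  rw [← Finset.card_filter, ← Finset.card_filter]
  by_cases hall : ∀ e' ∈ Δ.TE S F, π e' = π e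
  · have h1 : 0 < (I.filter (fun i => (Δ.TE S F ∩ S.filter (fun e' => π e' = i)).Nonempty)).card :=
      Finset.card_pos.2 ⟨π e, Finset.mem_filter.2 ⟨hI e heS, hte e he⟩⟩
    have h2 : 0 < (I.filter (fun i => Δ.TE S F ⊆ S.filter (fun e' => π e' = i))).card :=
      Finset.card_pos.2 ⟨π e, Finset.mem_filter.2 ⟨hI e heS, fun e' he' =>
        Finset.mem_filter.2 ⟨Δ.TE_sub _ _ he', hall e' he'⟩⟩⟩
    omega
  · push Not at hall
    obtain ⟨e', he', hne⟩ := hall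
    have h1 : 1 < (I.filter (fun i => (Δ.TE S F ∩ S.filter (fun e' => π e' = i)).Nonempty)).card :=
      Finset.one_lt_card.2 ⟨π e', Finset.mem_filter.2 ⟨hI e' (Δ.TE_sub _ _ he'), hte e' he'⟩,
        π e, Finset.mem_filter.2 ⟨hI e heS, hte e he⟩, hne⟩
    omega

end Dr

end PF

namespace PF
open Complex Classical

variable {V : Type} {G : SimpleGraph V}

namespace Dr

/-- The edges incident to a vertex of `U`. -/
noncomputable def TU (S : Finset G.edgeSet) (U : Finset V) : Finset G.edgeSet :=
  S.filter (fun e : G.edgeSet => ∃ u ∈ U, u ∈ (e : Sym2 V))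

/-- The edges inside `U`. -/
noncomputable def EU (S : Finset G.edgeSet) (U : Finset V) : Finset G.edgeSet :=
  S.filter (fun e : G.edgeSet => ∀ u ∈ (e : Sym2 V), u ∈ U)

lemma mem_EU {S : Finset G.edgeSet} {U : Finset V} {e : G.edgeSet} :
    e ∈ EU S U ↔ e ∈ S ∧ ∀ u ∈ (e : Sym2 V), u ∈ U := Finset.mem_filter

/-- The edges at a vertex. -/
noncomputable def st (S : Finset G.edgeSet) (u : V) : Finset G.edgeSet :=
  S.filter (fun e : G.edgeSet => u ∈ (e : Sym2 V))

lemma mem_st {S : Finset G.edgeSet} {u : V} {e : G.edgeSet} :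
    e ∈ st S u ↔ e ∈ S ∧ u ∈ (e : Sym2 V) := Finset.mem_filter

/-- The subgraph off `U`. -/
noncomputable def HU (S : Finset G.edgeSet) (U : Finset V) : SimpleGraph V := Gr (S \ TU S U)

/-- The components off `U`. -/
noncomputable def CU [Fintype V] (S : Finset G.edgeSet) (U : Finset V) :
    Finset (HU S U).ConnectedComponent :=
  (Finset.univ \ U).image (fun v => (HU S U).connectedComponentMk v)

lemma HU_adj {S : Finset G.edgeSet} {U : Finset V} {e : G.edgeSet} (he : e ∈ S) {a b : V}
    (ha : a ∉ U) (hb : b ∉ U) (hab : (e : Sym2 V) = s(a, b)) : (HU S U).Adj a b := by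
  refine ⟨e, Finset.mem_sdiff.2 ⟨he, fun h => ?_⟩, hab⟩
  obtain ⟨u, hu, hue⟩ := (Finset.mem_filter.1 h).2
  rw [hab, Sym2.mem_iff] at hue
  rcases hue with rfl | rfl
  · exact ha hu
  · exact hb hu

lemma HU_adj' {S : Finset G.edgeSet} {U : Finset V} {a b : V} (h : (HU S U).Adj a b) :
    a ∉ U ∧ b ∉ U ∧ ∃ e ∈ S, (e : Sym2 V) = s(a, b) := by
  obtain ⟨e, he, hab⟩ := h
  rw [Finset.mem_sdiff] at he
  refine ⟨fun ha => he.2 ?_, fun hb => he.2 ?_, e, he.1, hab⟩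
  · exact Finset.mem_filter.2 ⟨he.1, a, ha, by simp [hab]⟩
  · exact Finset.mem_filter.2 ⟨he.1, b, hb, by simp [hab]⟩

lemma nc_TU [Fintype V] (S : Finset G.edgeSet) (U : Finset V) :
    nc (S \ TU S U) ≤ U.card + (CU S U).card := by
  have h1 : (univ : Set (HU S U).ConnectedComponent) ⊆
      ((U.image (fun v => (HU S U).connectedComponentMk v) ∪ CU S U : Finset _) : Set _) := by
    intro C _
    induction C using SimpleGraph.ConnectedComponent.ind with | h x =>
    by_cases hx : x ∈ U
    · simp only [Finset.coe_union, mem_union, Finset.mem_coe, Finset.mem_image]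
      exact Or.inl ⟨x, hx, rfl⟩
    · simp only [Finset.coe_union, mem_union, Finset.mem_coe, CU, Finset.mem_image]
      exact Or.inr ⟨x, by simp [hx], rfl⟩
  have h2 := ncard_le_ncard h1 (toFinite _)
  rw [ncard_univ, ncard_coe_finset] at h2
  have h3 := Finset.card_union_le (U.image (fun v => (HU S U).connectedComponentMk v)) (CU S U)
  have h4 := Finset.card_image_le (s := U) (f := fun v => (HU S U).connectedComponentMk v)
  have h5 : nc (S \ TU S U) = Nat.card (HU S U).ConnectedComponent := rfl
  omega

/-- vertices of a component off `U` -/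
noncomputable def WC [Fintype V] (S : Finset G.edgeSet) (U : Finset V)
    (C : (HU S U).ConnectedComponent) : Finset V :=
  (Finset.univ \ U).filter (fun v => (HU S U).connectedComponentMk v = C)

/-- The piece of an edge. -/
noncomputable def pi (S : Finset G.edgeSet) (U : Finset V) (e : G.edgeSet) :
    (HU S U).ConnectedComponent ⊕ G.edgeSet :=
  if h : ∃ w, w ∈ (e : Sym2 V) ∧ w ∉ U then Sum.inl ((HU S U).connectedComponentMk h.choose)
  else Sum.inr e

lemma pi_inl [Fintype V] {S : Finset G.edgeSet} {U : Finset V} {e : G.edgeSet} (he : e ∈ S)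
    {C : (HU S U).ConnectedComponent} :
    pi S U e = Sum.inl C ↔ ∃ w ∈ WC S U C, w ∈ (e : Sym2 V) := by
  constructor
  · intro h
    rw [pi] at h
    split_ifs at h with h'
    refine ⟨h'.choose, ?_, h'.choose_spec.1⟩
    simp only [WC, Finset.mem_filter, Finset.mem_sdiff, Finset.mem_univ, true_and]
    exact ⟨h'.choose_spec.2, Sum.inl.inj h⟩
  · rintro ⟨w, hw, hwe⟩
    simp only [WC, Finset.mem_filter, Finset.mem_sdiff, Finset.mem_univ, true_and] at hw
    have h' : ∃ w, w ∈ (e : Sym2 V) ∧ w ∉ U := ⟨w, hwe, hw.1⟩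
    rw [pi, dif_pos h', ← hw.2]
    congr 1
    apply SimpleGraph.ConnectedComponent.eq.2
    by_cases hne : h'.choose = w
    · rw [hne]
    · exact (HU_adj he h'.choose_spec.2 hw.1
        ((Sym2.mem_and_mem_iff hne).1 ⟨h'.choose_spec.1, hwe⟩)).reachable

lemma pi_inr {S : Finset G.edgeSet} {U : Finset V} {e e' : G.edgeSet}  :
    pi S U e = Sum.inr e' ↔ e = e' ∧ ∀ w ∈ (e : Sym2 V), w ∈ U := by
  rw [pi]
  split_ifs with h'
  · simp only [false_iff]
    rintro ⟨_, h⟩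
    obtain ⟨w, h1, h2⟩ := h'
    exact h2 (h w h1)
  · push Not at h'
    simp only [Sum.inr.injEq]
    exact ⟨fun h => ⟨h, h'⟩, fun h => h.1⟩

lemma WC_closed [Fintype V] {S : Finset G.edgeSet} {U : Finset V}
    {C : (HU S U).ConnectedComponent} {a b : V} (ha : a ∈ WC S U C) (hb : b ∉ U)
    (h : (HU S U).Adj a b) : b ∈ WC S U C := by
  simp only [WC, Finset.mem_filter, Finset.mem_sdiff, Finset.mem_univ, true_and] at ha ⊢
  exact ⟨hb, by rw [← ha.2]; exact SimpleGraph.ConnectedComponent.eq.2 h.reachable.symm⟩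

lemma WC_nonempty [Fintype V] {S : Finset G.edgeSet} {U : Finset V}
    {C : (HU S U).ConnectedComponent} (hC : C ∈ CU S U) : (WC S U C).Nonempty := by
  obtain ⟨w, hw, hwC⟩ := Finset.mem_image.1 hC
  exact ⟨w, Finset.mem_filter.2 ⟨hw, hwC⟩⟩

lemma WC_notin [Fintype V] {S : Finset G.edgeSet} {U : Finset V}
    {C : (HU S U).ConnectedComponent} {a : V} (ha : a ∈ WC S U C) : a ∉ U := by
  simp only [WC, Finset.mem_filter, Finset.mem_sdiff, Finset.mem_univ, true_and] at ha
  exact ha.1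

lemma WC_reach [Fintype V] {S : Finset G.edgeSet} {U : Finset V}
    {C : (HU S U).ConnectedComponent} {a b : V} (ha : a ∈ WC S U C) (hb : b ∈ WC S U C) :
    (HU S U).Reachable a b := by
  simp only [WC, Finset.mem_filter, Finset.mem_sdiff, Finset.mem_univ, true_and] at ha hb
  exact SimpleGraph.ConnectedComponent.eq.1 (ha.2.trans hb.2.symm)

/-- edges of a component piece -/
noncomputable def BC (S : Finset G.edgeSet) (U : Finset V)
    (C : (HU S U).ConnectedComponent) : Finset G.edgeSet :=
  S.filter (fun e => pi S U e = Sum.inl C)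

/-- neighbours -/
noncomputable def NC (S : Finset G.edgeSet) (U : Finset V)
    (C : (HU S U).ConnectedComponent) : Finset V :=
  U.filter (fun u => ∃ e ∈ BC S U C, u ∈ (e : Sym2 V))

lemma mem_BC [Fintype V] {S : Finset G.edgeSet} {U : Finset V}
    {C : (HU S U).ConnectedComponent} {e : G.edgeSet} :
    e ∈ BC S U C ↔ e ∈ S ∧ ∃ w ∈ WC S U C, w ∈ (e : Sym2 V) := by
  rw [BC, Finset.mem_filter]
  exact and_congr_right (fun he => pi_inl he)

lemma NC_card [Fintype V] {S : Finset G.edgeSet} (hS : ∀ e, e ∈ S) {U : Finset V}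
    (h3 : ∀ u v : V, u ≠ v → (G.induce {x | x ≠ u ∧ x ≠ v}).Connected) (hU : 2 ≤ U.card)
    {C C' : (HU S U).ConnectedComponent} (hC : C ∈ CU S U) (hC' : C' ∈ CU S U) (hne : C' ≠ C) :
    3 ≤ (NC S U C).card := by
  by_contra! hlt
  obtain ⟨Y, hNY, hYU, hY⟩ := Finset.exists_subsuperset_card_eq (s := NC S U C) (t := U) (n := 2)
    (Finset.filter_subset _ _) (by omega) hU
  obtain ⟨x, y, hxy, rfl⟩ := Finset.card_eq_two.1 hY
  have hxU : x ∈ U := hYU (by simp)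
  have hyU : y ∈ U := hYU (by simp)
  obtain ⟨w, hw⟩ := WC_nonempty hC
  obtain ⟨w', hw'⟩ := WC_nonempty hC'
  have hn : ∀ z, z ∉ U → z ≠ x ∧ z ≠ y := fun z hz =>
    ⟨fun h => hz (h ▸ hxU), fun h => hz (h ▸ hyU)⟩
  have hr := (h3 x y hxy).preconnected ⟨w, hn w (WC_notin hw)⟩ ⟨w', hn w' (WC_notin hw')⟩
  obtain ⟨p⟩ := hr
  have key : ∀ (a b : {z | z ≠ x ∧ z ≠ y}), (G.induce {x_1 | x_1 ≠ x ∧ x_1 ≠ y}).Walk a b →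
      a.1 ∈ WC S U C → b.1 ∈ WC S U C := by
    intro a b p
    induction p with
    | nil => exact id
    | @cons a c b hac p ih =>
      intro ha
      apply ih
      have hG : G.Adj a.1 c.1 := hac
      let e : G.edgeSet := ⟨s(a.1, c.1), hG⟩
      by_cases hc : c.1 ∈ U
      · exfalso
        have : c.1 ∈ NC S U C := Finset.mem_filter.2 ⟨hc, e,
          mem_BC.2 ⟨hS e, a.1, ha, by simp [e]⟩, by simp [e]⟩
        have := hNY this
        simp only [Finset.mem_insert, Finset.mem_singleton] at this
        rcases this with h | h
        · exact c.2.1 h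
        · exact c.2.2 h
      · exact WC_closed ha hc (HU_adj (hS e) (WC_notin ha) hc rfl)
  have h1 := key _ _ p hw
  simp only [WC, Finset.mem_filter] at h1 hw'
  exact hne (hw'.2.symm.trans h1.2)

lemma reach_BC [Fintype V] {S : Finset G.edgeSet} {U : Finset V}
    {C : (HU S U).ConnectedComponent} {a b : V} (ha : a ∈ WC S U C) (h : (HU S U).Reachable a b) :
    (Gr (BC S U C)).Reachable a b := by
  obtain ⟨p⟩ := h
  induction p with
  | nil => rfl
  | @cons a c b hac p ih =>
    obtain ⟨_, hc, e, he, hee⟩ := HU_adj' hac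
    refine SimpleGraph.Reachable.trans ?_ (ih (WC_closed ha hc hac))
    exact reach_edge (mem_BC.2 ⟨he, a, ha, by simp [hee]⟩) (by simp [hee]) (by simp [hee])

variable (Δ : Dr G)

lemma piece_C [Fintype V] {S : Finset G.edgeSet} (hnc : nc S = 1) {U : Finset V} 
    (hU : U.Nonempty)
    {C : (HU S U).ConnectedComponent} (hC : C ∈ CU S U) (hN : 3 ≤ (NC S U C).card)
    (hss : BC S U C ⊂ S) :
    ((Δ.faces S).filter (fun F => (Δ.TE S F ∩ BC S U C).Nonempty)).card +
       ((Δ.faces S).filter (fun F => Δ.TE S F ⊆ BC S U C)).card + (2 * (WC S U C).card + 1) ≤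
       2 * (BC S U C).card := by
  obtain ⟨w0, hw0⟩ := WC_nonempty hC
  obtain ⟨u0, hu0⟩ := hU
  have h1 := Δ.touched_star (S := S) (T := BC S U C) (WC S U C : Set V) (HU S U)
    (fun w hw => WC_reach hw0 hw) hw0
    (fun a ha b hab => by
      obtain ⟨_, hb, e, he, hee⟩ := HU_adj' hab
      exact ⟨WC_closed ha hb hab, e, mem_BC.2 ⟨he, a, ha, by simp [hee]⟩, hee⟩)
    (fun e he w hw hwe => mem_BC.2 ⟨he, w, hw, hwe⟩)
    (fun e he => (mem_BC.1 he).2)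
  have h2 := Δ.only_le hss
  have e1 := Δ.euler' S
  have e2 := Δ.euler' (S \ BC S U C)
  have e3 := Δ.euler' (BC S U C)
  have h3 := Finset.card_sdiff_add_card_eq_card hss.1
  have h4 := nc_ge (S := S \ BC S U C) (WC S U C) (v0 := u0) (fun h => WC_notin h hu0)
    (fun e he w hw hwe => by
      rw [Finset.mem_sdiff] at he
      exact he.2 (mem_BC.2 ⟨he.1, w, hw, hwe⟩))
  have h5 := nc_le (S := BC S U C) (WC S U C ∪ NC S U C) (x0 := w0) (by
    intro x hx
    rcases Finset.mem_union.1 hx with hx | hx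
    · exact reach_BC hw0 (WC_reach hw0 hx)
    · obtain ⟨_, e, he, hxe⟩ := Finset.mem_filter.1 hx
      obtain ⟨heS, w, hw, hwe⟩ := mem_BC.1 he
      exact (reach_BC hw0 (WC_reach hw0 hw)).trans (reach_edge he hwe hxe))
  rw [Finset.card_union_of_disjoint (by
    rw [Finset.disjoint_left]
    intro x hx hx'
    exact WC_notin hx (Finset.mem_filter.1 hx').1)] at h5
  omega

lemma CU_card [Fintype V] {S : Finset G.edgeSet} (hS : ∀ e, e ∈ S) (hnc : nc S = 1) {U : Finset V}
    (h3 : ∀ u v : V, u ≠ v → (G.induce {x | x ≠ u ∧ x ≠ v}).Connected) (hU : 2 ≤ U.card)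
    (Δ : Dr G) :
    (CU S U).card ≤ 2 * U.card := by
  by_cases hk : (CU S U).card ≤ 1
  · omega
  push Not at hk
  have hUn : U.Nonempty := Finset.card_pos.1 (by omega)
  have hoth : ∀ C : (HU S U).ConnectedComponent, ∃ C' ∈ CU S U, C' ≠ C := fun C =>
    Finset.exists_mem_ne hk C
  have hN : ∀ C ∈ CU S U, 3 ≤ (NC S U C).card := fun C hC => by
    obtain ⟨C', hC', hne⟩ := hoth C
    exact NC_card hS h3 hU hC hC' hne
  have hedge : ∀ C ∈ CU S U, ∃ e, pi S U e = Sum.inl C := fun C hC => by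
    obtain ⟨u, hu⟩ := Finset.card_pos.1 (show 0 < (NC S U C).card by have := hN C hC; omega)
    obtain ⟨_, e, he, _⟩ := Finset.mem_filter.1 hu
    exact ⟨e, (Finset.mem_filter.1 he).2⟩
  have hss : ∀ C ∈ CU S U, BC S U C ⊂ S := fun C hC => by
    obtain ⟨C', hC', hne⟩ := hoth C
    obtain ⟨e, he⟩ := hedge C' hC'
    refine Finset.ssubset_iff_subset_ne.2 ⟨Finset.filter_subset _ _, fun h => ?_⟩
    have := hS e
    rw [← h] at this
    have := (Finset.mem_filter.1 this).2
    rw [he] at this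
    exact hne (Sum.inl.inj this)
  obtain ⟨C0, hC0, -⟩ := Finset.one_lt_card.1 hk
  obtain ⟨e0, he0⟩ := hedge C0 hC0
  have hI : ∀ e ∈ S, pi S U e ∈ (CU S U).disjSum (EU S U) := by
    intro e he
    rcases h : pi S U e with C | e'
    · obtain ⟨w, hw, _⟩ := (pi_inl he).1 h
      rw [Finset.inl_mem_disjSum]
      obtain ⟨h1, h2⟩ := Finset.mem_filter.1 hw
      exact Finset.mem_image.2 ⟨w, h1, h2⟩
    · obtain ⟨rfl, h'⟩ := pi_inr.1 h
      rw [Finset.inr_mem_disjSum]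
      exact mem_EU.2 ⟨he, h'⟩
  have hmain := Δ.pieces ⟨e0, hS e0⟩ (pi S U) _ hI
  have hcard := Finset.card_eq_sum_card_fiberwise (s := S) (f := pi S U) hI
  rw [Finset.sum_disjSum] at hmain hcard
  have hA : ∑ C ∈ CU S U, (((Δ.faces S).filter (fun F => (Δ.TE S F ∩ S.filter (fun e => pi S U e = Sum.inl C)).Nonempty)).card +
       ((Δ.faces S).filter (fun F => Δ.TE S F ⊆ S.filter (fun e => pi S U e = Sum.inl C))).card)
      + ∑ C ∈ CU S U, (2 * (WC S U C).card + 1) ≤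
      ∑ C ∈ CU S U, 2 * (S.filter (fun e => pi S U e = Sum.inl C)).card := by
    rw [← Finset.sum_add_distrib]
    exact Finset.sum_le_sum (fun C hC => Δ.piece_C hnc hUn hC (hN C hC) (hss C hC))
  have hB : ∑ e' ∈ EU S U, (((Δ.faces S).filter (fun F => (Δ.TE S F ∩ S.filter (fun e => pi S U e = Sum.inr e')).Nonempty)).card +
       ((Δ.faces S).filter (fun F => Δ.TE S F ⊆ S.filter (fun e => pi S U e = Sum.inr e'))).card)
      ≤ ∑ e' ∈ EU S U, 2 * (S.filter (fun e => pi S U e = Sum.inr e')).card := by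
    apply Finset.sum_le_sum
    intro e' he'
    have hfib : S.filter (fun e => pi S U e = Sum.inr e') = {e'} := by
      ext e
      rw [Finset.mem_filter, pi_inr, Finset.mem_singleton]
      refine ⟨fun h => h.2.1, ?_⟩
      rintro rfl
      exact ⟨hS e, rfl, (mem_EU.1 he').2⟩
    rw [hfib]
    have h1 : ({e'} : Finset G.edgeSet) ⊂ S := by
      refine Finset.ssubset_iff_subset_ne.2 ⟨by simpa using hS e', fun h => ?_⟩
      have := hS e0
      rw [← h, Finset.mem_singleton] at this
      rw [this, pi_inr.2 ⟨rfl, (mem_EU.1 he').2⟩] at he0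
      simp at he0
    have h2 := Δ.only_le h1
    rw [Δ.faces_small (S := {e'}) (by simp)] at h2
    have h3 := Δ.touched_one (hS e')
    have h5 : (Δ.faces S).filter (fun F => (Δ.TE S F ∩ {e'}).Nonempty) =
        (Δ.faces S).filter (fun F => e' ∈ Δ.TE S F) := by
      apply Finset.filter_congr
      intro F _
      constructor
      · rintro ⟨x, hx⟩
        rw [Finset.mem_inter, Finset.mem_singleton] at hx
        exact hx.2 ▸ hx.1
      · intro h
        exact ⟨e', by simp [h]⟩
    rw [h5, Finset.card_singleton]
    omega
  rw [← Finset.mul_sum] at hA hB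
  have hW : (Finset.univ \ U).card = ∑ C ∈ CU S U, (WC S U C).card :=
    Finset.card_eq_sum_card_fiberwise (fun v hv => Finset.mem_image_of_mem _ hv)
  have hW' : ∑ C ∈ CU S U, (2 * (WC S U C).card + 1) =
      2 * (Finset.univ \ U).card + (CU S U).card := by
    rw [Finset.sum_add_distrib, ← Finset.mul_sum, ← hW, Finset.sum_const, smul_eq_mul, mul_one]
  rw [hW'] at hA
  have h5 := Finset.card_sdiff_add_card_eq_card (Finset.subset_univ U)
  rw [Finset.card_univ, ← Nat.card_eq_fintype_card] at h5
  have e1 := Δ.euler' S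
  omega

lemma deg_sum [Fintype V] (S : Finset G.edgeSet) (U : Finset V) :
    ∑ u ∈ U, (st S u).card ≤ (TU S U).card + (EU S U).card := by
  simp only [Finset.card_filter, TU, EU, st]
  rw [Finset.sum_comm, ← Finset.sum_add_distrib]
  apply Finset.sum_le_sum
  intro e he
  rw [← Finset.card_filter]
  obtain ⟨a, b, hab⟩ : ∃ u v, (e : Sym2 V) = s(u, v) := by
    induction h : (e : Sym2 V) with | h a b => exact ⟨a, b, rfl⟩
  have hsub : U.filter (fun u => u ∈ (e : Sym2 V)) ⊆ {a, b} := by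
    intro x hx
    have := (Finset.mem_filter.1 hx).2
    rw [hab, Sym2.mem_iff] at this
    simpa using this
  have h2 : (U.filter (fun u => u ∈ (e : Sym2 V))).card ≤ 2 :=
    (Finset.card_le_card hsub).trans Finset.card_le_two
  by_cases hE : ∀ u ∈ (e : Sym2 V), u ∈ U
  · have hT : ∃ u ∈ U, u ∈ (e : Sym2 V) := ⟨a, hE a (by simp [hab]), by simp [hab]⟩
    rw [if_pos hE, if_pos hT]
    omega
  · by_cases hT : ∃ u ∈ U, u ∈ (e : Sym2 V)
    · rw [if_pos hT]
      push Not at hE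
      obtain ⟨x, hx, hxU⟩ := hE
      have hss : U.filter (fun u => u ∈ (e : Sym2 V)) ⊂ {a, b} := by
        refine Finset.ssubset_iff_subset_ne.2 ⟨hsub, fun h => hxU ?_⟩
        have : x ∈ ({a, b} : Finset V) := by
          rw [hab, Sym2.mem_iff] at hx
          simpa using hx
        rw [← h] at this
        exact (Finset.mem_filter.1 this).1
      have h3 := Finset.card_lt_card hss
      have h4 := Finset.card_le_two (a := a) (b := b)
      omega
    · have : U.filter (fun u => u ∈ (e : Sym2 V)) = ∅ := by
        apply Finset.filter_eq_empty_iff.2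
        intro u hu hue
        exact hT ⟨u, hu, hue⟩
      rw [this]; simp

theorem main [Fintype V] {S : Finset G.edgeSet} (hS : ∀ e, e ∈ S) (hconn : G.Connected)
    (h3 : ∀ u v : V, u ≠ v → (G.induce {x | x ≠ u ∧ x ≠ v}).Connected) {U : Finset V}
    (hU : 2 ≤ U.card) :
    ((Δ.faces S).filter (fun F => ∃ v ∈ U, ∃ w ∈ U, v ≠ w ∧ Δ.pt v ∈ frontier F ∧
      Δ.pt w ∈ frontier F)).card ≤ 6 * U.card := by
  have hUn : U.Nonempty := Finset.card_pos.1 (by omega)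
  have hGr : Gr S = G := by
    ext a b
    constructor
    · rintro ⟨e, he, hab⟩
      have := e.2
      rwa [hab] at this
    · intro h
      exact ⟨⟨s(a, b), h⟩, hS _, rfl⟩
  have hnc : nc S = 1 := by
    rw [nc, hGr, Nat.card_eq_one_iff_unique]
    exact ⟨hconn.preconnected.subsingleton_connectedComponent,
      ⟨G.connectedComponentMk hUn.choose⟩⟩
  have hk := CU_card hS hnc h3 hU Δ
  have hE := edges_in_le Δ (S := EU S U) U hUn (fun e he => (mem_EU.1 he).2)
  have e1 := Δ.euler' S
  have e2 := Δ.euler' (S \ TU S U)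
  have hTS : TU S U ⊆ S := Finset.filter_subset _ _
  have h4 := Finset.card_sdiff_add_card_eq_card hTS
  have h5 := nc_TU S U
  -- a vertex outside
  have hst : ∀ u ∈ U, ((Δ.faces S).filter (fun F => (Δ.TE S F ∩ st S u).Nonempty)).card ≤
      (st S u).card := by
    intro u hu
    obtain ⟨v, hv, hvu⟩ := Finset.exists_mem_ne (by omega : 1 < U.card) u
    have h1 := Δ.touched_star (S := S) (T := st S u) {u} (w0 := u) ⊥
      (fun w hw => by rw [mem_singleton_iff.1 hw]) rfl
      (fun a ha b hab => by simp at hab)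
      (fun e he w hw hwe => mem_st.2 ⟨he, by rwa [mem_singleton_iff.1 hw] at hwe⟩)
      (fun e he => ⟨u, rfl, (mem_st.1 he).2⟩)
    have e3 := Δ.euler' (S \ st S u)
    have h2 := nc_ge (S := S \ st S u) {u} (v0 := v) (by simpa using hvu)
      (fun e he w hw hwe => by
        rw [Finset.mem_sdiff] at he
        rw [Finset.mem_singleton.1 hw] at hwe
        exact he.2 (mem_st.2 ⟨he.1, hwe⟩))
    have h3 := Finset.card_sdiff_add_card_eq_card (show st S u ⊆ S from Finset.filter_subset _ _)
    rw [Finset.card_singleton] at h2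
    omega
  have hsum := (Finset.sum_le_sum hst).trans (deg_sum S U)
  -- nonempty TU
  have hne : S \ TU S U ⊂ S := by
    refine Finset.ssubset_iff_subset_ne.2 ⟨Finset.sdiff_subset, fun h => ?_⟩
    have h0 : ∀ e ∈ S, ∀ u ∈ U, u ∉ (e : Sym2 V) := by
      intro e he u hu hue
      have h' := he
      rw [← h, Finset.mem_sdiff] at h'
      exact h'.2 (Finset.mem_filter.2 ⟨he, u, hu, hue⟩)
    obtain ⟨u, hu, v, hv, huv⟩ := Finset.one_lt_card.1 (by omega : 1 < U.card)
    have hr : (Gr S).Reachable u v := by rw [hGr]; exact hconn.preconnected u v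
    exact huv (isolated (fun e he => h0 e he u hu) hr).symm
  have h6 := Δ.only_le hne
  -- counting
  let j : Set ℂ → ℕ := fun F => (U.filter (fun u => (Δ.TE S F ∩ st S u).Nonempty)).card
  have hj : ∑ F ∈ Δ.faces S, j F =
      ∑ u ∈ U, ((Δ.faces S).filter (fun F => (Δ.TE S F ∩ st S u).Nonempty)).card := by
    simp only [j, Finset.card_filter]
    exact Finset.sum_comm
  have hcount : (Δ.faces S).card + ((Δ.faces S).filter (fun F => ∃ v ∈ U, ∃ w ∈ U, v ≠ w ∧
      Δ.pt v ∈ frontier F ∧ Δ.pt w ∈ frontier F)).card ≤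
      ∑ F ∈ Δ.faces S, j F + ((Δ.faces S).filter (fun F => Δ.TE S F ⊆ S \ TU S U)).card := by
    rw [Finset.card_eq_sum_ones, Finset.card_filter, Finset.card_filter,
      ← Finset.sum_add_distrib, ← Finset.sum_add_distrib]
    apply Finset.sum_le_sum
    intro F hF
    have hpt : ∀ v, Δ.pt v ∈ frontier F → (Δ.TE S F ∩ st S v).Nonempty := by
      intro v hv
      obtain ⟨e, he, hve⟩ := Δ.TE_star hF hv
      exact ⟨e, Finset.mem_inter.2 ⟨he, mem_st.2 ⟨Δ.TE_sub _ _ he, hve⟩⟩⟩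
    split_ifs with h1 h2
    · obtain ⟨v, hv, w, hw, hvw, h1, h2⟩ := h1
      have : 1 < j F := Finset.one_lt_card.2 ⟨v, Finset.mem_filter.2 ⟨hv, hpt v h1⟩,
        w, Finset.mem_filter.2 ⟨hw, hpt w h2⟩, hvw⟩
      omega
    · obtain ⟨v, hv, w, hw, hvw, h1, h2⟩ := h1
      have : 1 < j F := Finset.one_lt_card.2 ⟨v, Finset.mem_filter.2 ⟨hv, hpt v h1⟩,
        w, Finset.mem_filter.2 ⟨hw, hpt w h2⟩, hvw⟩
      omega
    · omega
    · rename_i h2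
      have : 0 < j F := by
        obtain ⟨e, he, he'⟩ := Finset.not_subset.1 h2
        have heS := Δ.TE_sub _ _ he
        have heT : e ∈ TU S U := by
          by_contra hh
          exact he' (Finset.mem_sdiff.2 ⟨heS, hh⟩)
        obtain ⟨u, hu, hue⟩ := (Finset.mem_filter.1 heT).2
        exact Finset.card_pos.2 ⟨u, Finset.mem_filter.2 ⟨hu, e, Finset.mem_inter.2 ⟨he,
          mem_st.2 ⟨heS, hue⟩⟩⟩⟩
      omega
  rw [hj] at hcount
  omega

end Dr

end PF

namespace PF
open Complex Classical

/-- The plane as the complex plane. -/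
noncomputable def psi : ℝ × ℝ ≃ₜ ℂ := Complex.equivRealProdCLM.symm.toHomeomorph

/-- The drawing in the complex plane of a plane embedding. -/
noncomputable def ofPE {V : Type} {G : SimpleGraph V} (Φ : PlaneEmbedding G) : Dr G where
  pt v := psi (Φ.vmap v)
  pt_inj := psi.injective.comp Φ.vmap_inj
  γ e t := psi ((Φ.arc_path e).choose t)
  cont e := psi.continuous.comp (Φ.arc_path e).choose_spec.1
  inj e := psi.injective.comp (Φ.arc_path e).choose_spec.2.1
  ends e := by
    obtain ⟨u, v, h, h0, h1⟩ := (Φ.arc_path e).choose_spec.2.2.2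
    exact ⟨u, v, h, congrArg psi h0, congrArg psi h1⟩
  inter e e' hne := by
    rintro _ ⟨⟨t, rfl⟩, ⟨t', ht'⟩⟩
    have h1 := (Φ.arc_path e).choose_spec.2.2.1
    have h2 := (Φ.arc_path e').choose_spec.2.2.1
    have h3 := psi.injective ht'
    obtain ⟨x, hx, hxe⟩ := Φ.arc_inter e e' hne
      ⟨by rw [← h1]; exact ⟨t, rfl⟩, by rw [← h2]; exact ⟨t', h3⟩⟩
    exact ⟨x, hx, congrArg psi hxe⟩
  mem e x := by
    rintro ⟨t, ht⟩
    have h1 := (Φ.arc_path e).choose_spec.2.2.1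
    apply Φ.vmap_mem_arc
    rw [← h1]
    exact ⟨t, psi.injective ht⟩

lemma ofPE_D {V : Type} {G : SimpleGraph V} (Φ : PlaneEmbedding G) {S : Finset G.edgeSet}
    (hS : ∀ e, e ∈ S) : (ofPE Φ).D S = psi '' Φ.drawing := by
  ext z
  rw [Dr.mem_D, PlaneEmbedding.drawing, image_iUnion, mem_iUnion]
  constructor
  · rintro ⟨e, _, t, rfl⟩
    refine ⟨e, _, ?_, rfl⟩
    exact (Φ.arc_path e).choose_spec.2.2.1.subset ⟨t, rfl⟩
  · rintro ⟨e, y, hy, rfl⟩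
    rw [← (Φ.arc_path e).choose_spec.2.2.1] at hy
    obtain ⟨t, ht⟩ := hy
    exact ⟨e, hS e, t, congrArg psi ht⟩

theorem final {V : Type} [Fintype V] {G : SimpleGraph V} (hG : Triconnected G)
    (Φ : PlaneEmbedding G) (U : Set V) :
    {F : Set (ℝ × ℝ) | Φ.IsFace F ∧
      ∃ v ∈ U, ∃ w ∈ U, v ≠ w ∧ Φ.OnFace F v ∧ Φ.OnFace F w}.Finite ∧
    {F : Set (ℝ × ℝ) | Φ.IsFace F ∧
      ∃ v ∈ U, ∃ w ∈ U, v ≠ w ∧ Φ.OnFace F v ∧ Φ.OnFace F w}.ncard ≤ 6 * U.ncard := by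
  obtain ⟨S, hS⟩ : ∃ S : Finset G.edgeSet, ∀ e, e ∈ S :=
    ⟨(toFinite (univ : Set G.edgeSet)).toFinset, by simp⟩
  have hD := ofPE_D Φ hS
  let T : Finset (Set ℂ) := ((ofPE Φ).faces S).filter (fun F => ∃ v ∈ U.toFinset,
    ∃ w ∈ U.toFinset, v ≠ w ∧ (ofPE Φ).pt v ∈ frontier F ∧ (ofPE Φ).pt w ∈ frontier F)
  have hmem : ∀ F ∈ {F : Set (ℝ × ℝ) | Φ.IsFace F ∧
      ∃ v ∈ U, ∃ w ∈ U, v ≠ w ∧ Φ.OnFace F v ∧ Φ.OnFace F w}, psi '' F ∈ (T : Set (Set ℂ)) := by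
    rintro F ⟨⟨p, hp, rfl⟩, v, hv, w, hw, hvw, h1, h2⟩
    have hfr : ∀ v, Φ.OnFace (connectedComponentIn Φ.drawingᶜ p) v → (ofPE Φ).pt v ∈
        frontier (psi '' connectedComponentIn Φ.drawingᶜ p) := by
      intro v hv
      rw [← psi.image_frontier]
      exact ⟨_, hv, rfl⟩
    refine Finset.mem_coe.2 (Finset.mem_filter.2 ⟨?_, v, by simpa using hv, w, by simpa using hw,
      hvw, hfr v h1, hfr w h2⟩)
    refine ((ofPE Φ).mem_faces).2 ⟨psi p, ?_, ?_⟩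
    · rw [hD]
      rintro ⟨q, hq, hqp⟩
      exact hp (psi.injective hqp ▸ hq)
    · rw [hD, fc, psi.image_connectedComponentIn hp, image_compl_eq psi.bijective]
  have hinj : InjOn (fun F : Set (ℝ × ℝ) => psi '' F) {F : Set (ℝ × ℝ) | Φ.IsFace F ∧
      ∃ v ∈ U, ∃ w ∈ U, v ≠ w ∧ Φ.OnFace F v ∧ Φ.OnFace F w} :=
    (image_injective.2 psi.injective).injOn
  refine ⟨Finite.of_injOn hmem hinj T.finite_toSet, ?_⟩
  have hle := ncard_le_ncard_of_injOn _ hmem hinj T.finite_toSet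
  rw [ncard_coe_finset] at hle
  rw [ncard_eq_toFinset_card' U]
  by_cases hU : 2 ≤ U.toFinset.card
  · exact hle.trans ((ofPE Φ).main hS hG.1.1 hG.2.2 hU)
  · have : T = ∅ := by
      apply Finset.filter_eq_empty_iff.2
      rintro F _ ⟨v, hv, w, hw, hvw, _⟩
      exact hU (Finset.one_lt_card.2 ⟨v, hv, w, hw, hvw⟩)
    rw [this, Finset.card_empty] at hle
    omega

end PF

/-- there is a constant `c > 0` such that for every finite simple triconnected
graph `G` with a plane embedding `Φ` and every set `U` of vertices, the set of faces whose
boundary contains at least two vertices of `U` is finite of cardinality at most `c * |U|`. -/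
theorem statement5 :
    ∃ c : ℕ, 0 < c ∧
      ∀ (V : Type) [Fintype V] (G : SimpleGraph V), Triconnected G →
        ∀ (Φ : PlaneEmbedding G) (U : Set V),
          {F : Set (ℝ × ℝ) | Φ.IsFace F ∧
            ∃ v ∈ U, ∃ w ∈ U, v ≠ w ∧ Φ.OnFace F v ∧ Φ.OnFace F w}.Finite ∧
          {F : Set (ℝ × ℝ) | Φ.IsFace F ∧
            ∃ v ∈ U, ∃ w ∈ U, v ≠ w ∧ Φ.OnFace F v ∧ Φ.OnFace F w}.ncard ≤ c * U.ncard := by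
  exact ⟨6, by norm_num, fun V _ G hG Φ U => PF.final hG Φ U⟩
end
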